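/- Let α, β, γ, ω ∈ ℂ satisfy α + β + γ + ω = −iQ and −Q/2 < Im α, Im β, Im γ, Im ω < 0, and let u, v, w, z ∈ ℝ. Set σ⋆ = −iQ/2 − σ for σ ∈ {α, β, γ, ω}. Then ∫_ℝ D_α(x−u)·D_β(x−v)·D_γ(x−w)·D_ω(x−z) dx = w_b(2α + iQ/2)·w_b(2β + iQ/2)·w_b(2γ + iQ/2)·w_b(2ω + iQ/2)·(D_{α+β+iQ/2}(u−v) / D_{α+β+iQ/2}(w−z))·∫_ℝ D_{α⋆}(x−v)·D_{β⋆}(x−u)·D_{γ⋆}(x−z)·D_{ω⋆}(x−w) dx, both integrals converging absolutely. -/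

import Mathlib

open MeasureTheory

/-- The non-compact quantum dilogarithm `w_b`. -/
noncomputable def wb (b ε : ℝ) (z : ℂ) : ℂ :=
  Complex.exp (Complex.I * ((Real.pi : ℝ) : ℂ) / 2 * z ^ 2 +
    Complex.I * ((Real.pi : ℝ) : ℂ) / 24 * ((b : ℂ) ^ 2 + ((b : ℂ))⁻¹ ^ 2) -
    ∫ t : ℝ,
      Complex.exp (-(2 * Complex.I * ((t : ℂ) + Complex.I * (ε : ℂ)) * z)) /
        (4 * ((t : ℂ) + Complex.I * (ε : ℂ)) *
          Complex.sinh ((b : ℂ) * ((t : ℂ) + Complex.I * (ε : ℂ))) *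
          Complex.sinh (((t : ℂ) + Complex.I * (ε : ℂ)) / (b : ℂ))))

/-- The function `D_α`. -/
noncomputable def Dfun (b ε : ℝ) (α z : ℂ) : ℂ :=
  Complex.exp (Complex.I *
    ∫ t : ℝ,
      Complex.cos (2 * ((t : ℂ) + Complex.I * (ε : ℂ)) * z) *
          Complex.sin (2 * α * ((t : ℂ) + Complex.I * (ε : ℂ))) /
        (2 * ((t : ℂ) + Complex.I * (ε : ℂ)) *
          Complex.sinh ((b : ℂ) * ((t : ℂ) + Complex.I * (ε : ℂ))) *
          Complex.sinh (((t : ℂ) + Complex.I * (ε : ℂ)) / (b : ℂ))))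

section
open MeasureTheory Filter Topology

/-- local dominated differentiation under the integral for holomorphic integrands -/
theorem hol_param (F : ℂ → ℝ → ℂ) (s0 : ℂ) (r : ℝ) (hr : 0 < r) (bound : ℝ → ℝ)
    (hbi : Integrable bound)
    (hm : ∀ s ∈ Metric.ball s0 r, AEStronglyMeasurable (F s) volume)
    (hd : ∀ a, DifferentiableOn ℂ (fun s => F s a) (Metric.ball s0 r))
    (hb : ∀ s ∈ Metric.ball s0 r, ∀ a, ‖F s a‖ ≤ bound a) :
    HasDerivAt (fun s => ∫ a, F s a) (∫ a, deriv (fun s => F s a) s0) s0 := by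
  have hs0 : s0 ∈ Metric.ball s0 r := Metric.mem_ball_self hr
  have hdiff : ∀ a, ∀ s ∈ Metric.ball s0 r, HasDerivAt (fun s => F s a) (deriv (fun s => F s a) s) s := by
    intro a s hs
    exact ((hd a).differentiableAt (Metric.isOpen_ball.mem_nhds hs)).hasDerivAt
  have hhalf : Metric.ball s0 (r/2) ⊆ Metric.ball s0 r := Metric.ball_subset_ball (by linarith)
  have key := hasDerivAt_integral_of_dominated_loc_of_deriv_le (μ := volume) (F := F) (x₀ := s0)
    (s := Metric.ball s0 (r/2)) (bound := fun a => bound a / (r/4))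
    (F' := fun s a => deriv (fun s => F s a) s)
    (Metric.ball_mem_nhds s0 (by linarith)) ?_ ?_ ?_ ?_ ?_ ?_
  · exact key.2
  · filter_upwards [Metric.ball_mem_nhds s0 hr] with s hs using hm s hs
  · exact hbi.mono' (hm s0 hs0) (Eventually.of_forall (hb s0 hs0))
  · have hseq : Tendsto (fun n : ℕ => ((r / 2 / (n + 1 : ℝ) : ℝ) : ℂ)) atTop (𝓝[≠] 0) := by
      rw [tendsto_nhdsWithin_iff]
      constructor
      · have h1 : Tendsto (fun n : ℕ => (r / 2 / (n + 1 : ℝ) : ℝ)) atTop (𝓝 0) := by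
          have := (tendsto_one_div_add_atTop_nhds_zero_nat (𝕜 := ℝ)).const_mul (r/2)
          simpa [div_eq_mul_inv] using this
        have := (Complex.continuous_ofReal.tendsto 0).comp h1
        rw [Complex.ofReal_zero] at this
        exact this
      · refine Eventually.of_forall fun n => ?_
        simp only [Set.mem_compl_iff, Set.mem_singleton_iff, Complex.ofReal_eq_zero]
        positivity
    refine aestronglyMeasurable_of_tendsto_ae (u := atTop)
      (f := fun n : ℕ => fun a => (((r / 2 / (n + 1 : ℝ) : ℝ) : ℂ))⁻¹ • (F (s0 + ((r / 2 / (n + 1 : ℝ) : ℝ) : ℂ)) a - F s0 a)) ?_ ?_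
    · intro n
      refine AEStronglyMeasurable.const_smul (𝕜 := ℂ) (f := fun a => F (s0 + ((r / 2 / (n + 1 : ℝ) : ℝ) : ℂ)) a - F s0 a) ((hm _ ?_).sub (hm s0 hs0)) ((((r / 2 / (n + 1 : ℝ) : ℝ) : ℂ))⁻¹)
      rw [Metric.mem_ball, dist_eq_norm, add_sub_cancel_left, Complex.norm_real, Real.norm_eq_abs,
        abs_of_pos (by positivity)]
      have : (1:ℝ) ≤ n + 1 := by have : (0:ℝ) ≤ n := by positivity
                                 linarith
      calc r / 2 / (n + 1 : ℝ) ≤ r / 2 := div_le_self (by linarith) this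
        _ < r := by linarith
    · refine Eventually.of_forall fun a => ?_
      have := (hdiff a s0 hs0)
      rw [hasDerivAt_iff_tendsto_slope_zero] at this
      exact this.comp hseq
  · refine Eventually.of_forall fun a s hs => ?_
    refine Complex.norm_deriv_le_of_forall_mem_sphere_norm_le (by linarith) ?_ ?_
    · have hsub : Metric.closedBall s (r/4) ⊆ Metric.ball s0 r := by
        intro y hy
        rw [Metric.mem_ball] at *
        rw [Metric.mem_closedBall] at hy
        linarith [dist_triangle y s s0]
      refine DifferentiableOn.diffContOnCl ?_
      rw [closure_ball _ (by positivity)]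
      exact (hd a).mono hsub
    · intro y hy
      refine hb y ?_ a
      rw [mem_sphere_iff_norm] at hy
      rw [Metric.mem_ball] at *
      have : dist y s = r/4 := by rw [dist_eq_norm, hy]
      linarith [dist_triangle y s s0]
  · exact hbi.div_const _
  · exact Eventually.of_forall fun a s hs => hdiff a s (hhalf hs)

theorem exp_le_inv_sq {c : ℝ} (hc : 0 < c) (x : ℝ) :
    Real.exp (-c * |x|) ≤ (1 + 2 / c ^ 2) * (1 + x ^ 2)⁻¹ := by
  have h1 := Real.quadratic_le_exp_of_nonneg (x := c * |x|) (by positivity)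
  rw [neg_mul, Real.exp_neg, ← div_eq_mul_inv, le_div_iff₀ (by positivity), inv_mul_le_iff₀ (Real.exp_pos _)]
  have h2 : (c * |x|)^2 = c^2 * x^2 := by rw [mul_pow, sq_abs]
  rw [h2] at h1
  have h3 : 0 ≤ c * |x| := by positivity
  have : (1 + c^2*x^2/2) * (1 + 2 / c^2) ≤ Real.exp (c * |x|) * (1 + 2 / c^2) := by
    gcongr; linarith
  refine le_trans ?_ this
  have h4 : c^2*x^2/2 * (2/c^2) = x^2 := by field_simp
  have h5 : 0 ≤ c^2*x^2/2 := by positivity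
  have h6 : 0 ≤ 2/c^2 := by positivity
  nlinarith

theorem integrable_exp_abs {c : ℝ} (hc : 0 < c) : Integrable (fun x : ℝ => Real.exp (-c * |x|)) := by
  refine Integrable.mono' (integrable_inv_one_add_sq.const_mul (1 + 2 / c ^ 2)) (by fun_prop) ?_
  refine Eventually.of_forall fun x => ?_
  rw [Real.norm_eq_abs, abs_of_pos (Real.exp_pos _)]
  exact exp_le_inv_sq hc x

theorem tendsto_inv_sq (C : ℝ) : Tendsto (fun x : ℝ => C * (1 + x ^ 2)⁻¹) atTop (𝓝 0) := by
  have : Tendsto (fun x : ℝ => 1 + x ^ 2) atTop atTop :=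
    tendsto_atTop_add_const_left _ _ (tendsto_pow_atTop (by norm_num))
  simpa using (tendsto_inv_atTop_zero.comp this).const_mul C

/-- moving the contour -/
theorem contour_shift (f : ℂ → ℂ) (y1 y2 C : ℝ)
    (hd : ∀ z : ℂ, z.im ∈ Set.uIcc y1 y2 → DifferentiableAt ℂ f z)
    (hb : ∀ z : ℂ, z.im ∈ Set.uIcc y1 y2 → ‖f z‖ ≤ C * (1 + z.re ^ 2)⁻¹) :
    ∫ x : ℝ, f (x + y1 * Complex.I) = ∫ x : ℝ, f (x + y2 * Complex.I) := by
  have hint : ∀ y ∈ Set.uIcc y1 y2, Integrable (fun x : ℝ => f (x + y * Complex.I)) := by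
    intro y hy
    refine Integrable.mono' (integrable_inv_one_add_sq.const_mul C) ?_ ?_
    · refine Continuous.aestronglyMeasurable ?_
      rw [continuous_iff_continuousAt]
      intro x
      refine ContinuousAt.comp (f := fun x : ℝ => (x : ℂ) + y * Complex.I) (hd _ (by simpa using hy)).continuousAt (by fun_prop)
    · refine Eventually.of_forall fun x => ?_
      simpa using hb (x + y * Complex.I) (by simpa using hy)
  have h1 := intervalIntegral_tendsto_integral (hint y1 Set.left_mem_uIcc) tendsto_neg_atTop_atBot tendsto_id
  have h2 := intervalIntegral_tendsto_integral (hint y2 Set.right_mem_uIcc) tendsto_neg_atTop_atBot tendsto_id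
  have h3 := h1.sub h2
  have hz : Tendsto (fun i : ℝ => (∫ x in -i..id i, f (x + y1 * Complex.I)) - ∫ x in -i..id i, f (x + y2 * Complex.I)) atTop (𝓝 0) := by
    have hs : ∀ T : ℝ, ‖∫ y in y1..y2, f (T + y * Complex.I)‖ ≤ C * (1 + T^2)⁻¹ * |y2 - y1| := by
      intro T
      refine intervalIntegral.norm_integral_le_of_norm_le_const fun y hy => ?_
      simpa using hb (T + y * Complex.I) (by simpa using Set.uIoc_subset_uIcc hy)
    refine squeeze_zero_norm (a := fun T => 2 * (C * (1 + T^2)⁻¹ * |y2 - y1|)) ?_ ?_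
    · intro T
      have hr := Complex.integral_boundary_rect_eq_zero_of_differentiableOn f (-T + y1 * Complex.I) (T + y2 * Complex.I) ?_
      · simp only [Complex.add_re, Complex.neg_re, Complex.ofReal_re, Complex.mul_re, Complex.I_re, mul_zero, Complex.ofReal_im, Complex.I_im, mul_one, sub_self, add_zero, Complex.add_im, Complex.neg_im, neg_zero, Complex.mul_im, zero_add, smul_eq_mul] at hr
        have e : (∫ x in -T..id T, f (x + y1 * Complex.I)) - ∫ x in -T..id T, f (x + y2 * Complex.I) =
          Complex.I * (∫ y in y1..y2, f (((-T : ℝ):ℂ) + y * Complex.I)) - Complex.I * (∫ y in y1..y2, f (T + y * Complex.I)) := by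
          simp only [id]
          linear_combination hr
        rw [e]
        refine (norm_sub_le _ _).trans ?_
        rw [norm_mul, norm_mul, Complex.norm_I, one_mul, one_mul]
        have a1 := hs T
        have a2 := hs (-T)
        rw [neg_sq] at a2
        linarith
      · intro z hz
        refine (hd z ?_).differentiableWithinAt
        have := hz.2
        simpa using this
    · have := ((tendsto_inv_sq C).mul_const |y2 - y1|).const_mul 2
      simpa using this
  have := tendsto_nhds_unique h3 hz
  exact sub_eq_zero.mp this

/-- the half-residue at the origin of an odd function -/
theorem odd_res (φ : ℂ → ℂ) (ε C : ℝ) (hε : 0 < ε)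
    (hd : ∀ z : ℂ, |z.im| ≤ ε → DifferentiableAt ℂ φ z)
    (he : ∀ z : ℂ, |z.im| ≤ ε → φ (-z) = φ z)
    (hb : ∀ z : ℂ, |z.im| ≤ ε → ‖φ z‖ ≤ C)
    (hi : Integrable (fun t : ℝ => φ (t + ε * Complex.I) / (t + ε * Complex.I))) :
    ∫ t : ℝ, φ (t + ε * Complex.I) / (t + ε * Complex.I) = -(Real.pi * Complex.I) * φ 0 := by
  have hC : 0 ≤ C := (norm_nonneg _).trans (hb 0 (by simpa using hε.le))
  have hne : ∀ t : ℝ, (t : ℂ) + ε * Complex.I ≠ 0 := by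
    intro t h
    have := congrArg Complex.im h
    simp at this
    exact hε.ne' this
  set ψ : ℂ → ℂ := dslope φ 0 with hψ
  have hψd : ∀ z : ℂ, |z.im| < ε → DifferentiableAt ℂ ψ z := by
    intro z hz
    have ho : IsOpen {z : ℂ | |z.im| < ε} := isOpen_lt (by fun_prop) (by fun_prop)
    have : DifferentiableOn ℂ ψ {z : ℂ | |z.im| < ε} := by
      rw [hψ, Complex.differentiableOn_dslope (ho.mem_nhds (by simpa using hε))]
      intro z hz
      exact (hd z (le_of_lt hz)).differentiableWithinAt
    exact this.differentiableAt (ho.mem_nhds hz)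
  have hψv : ∀ z : ℂ, z ≠ 0 → ψ z = (φ z - φ 0) / z := by
    intro z hz
    rw [hψ, dslope_of_ne _ hz, slope_def_field, sub_zero]
  have hψd' : ∀ z : ℂ, |z.im| ≤ ε → DifferentiableAt ℂ ψ z := by
    intro z hz
    by_cases h0 : z = 0
    · exact hψd z (by simp [h0, hε])
    · rw [hψ, differentiableAt_dslope_of_ne h0]
      exact hd z hz
  have hψo : ∀ z : ℂ, |z.im| ≤ ε → z ≠ 0 → ψ (-z) = - ψ z := by
    intro z hz h0
    rw [hψv z h0, hψv (-z) (neg_ne_zero.mpr h0), he z hz, div_neg]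
  have hlim := intervalIntegral_tendsto_integral hi tendsto_neg_atTop_atBot tendsto_id
  refine tendsto_nhds_unique hlim ?_
  -- split
  have hcont1 : Continuous (fun t : ℝ => ψ (t + ε * Complex.I)) := by
    rw [continuous_iff_continuousAt]
    intro x
    refine ContinuousAt.comp (f := fun x : ℝ => (x : ℂ) + ε * Complex.I) (hψd' _ (by simp [abs_of_pos hε])).continuousAt (by fun_prop)
  have hcont2 : Continuous (fun t : ℝ => ((t : ℂ) + ε * Complex.I)⁻¹) := by
    refine Continuous.inv₀ (by fun_prop) hne
  have hsplit : ∀ T : ℝ, (∫ t in -T..id T, φ (t + ε * Complex.I) / (t + ε * Complex.I)) =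
      (∫ t in -T..T, ψ (t + ε * Complex.I)) + φ 0 * ∫ t in -T..T, ((t : ℂ) + ε * Complex.I)⁻¹ := by
    intro T
    rw [← intervalIntegral.integral_const_mul, ← intervalIntegral.integral_add (hcont1.intervalIntegrable _ _)
      ((hcont2.const_mul _).intervalIntegrable _ _)]
    refine intervalIntegral.integral_congr fun t _ => ?_
    rw [hψv _ (hne t)]
    field_simp [hne t]
    ring
  have hψ0 : Tendsto (fun T : ℝ => ∫ t in -T..T, ψ (t + ε * Complex.I)) atTop (𝓝 0) := by
    have hs : ∀ T : ℝ, T ≠ 0 → ‖∫ y in (-ε)..ε, ψ (T + y * Complex.I)‖ ≤ (2 * C / |T|) * |ε - -ε| := by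
      intro T hT
      refine intervalIntegral.norm_integral_le_of_norm_le_const fun y hy => ?_
      have hz0 : (T : ℂ) + y * Complex.I ≠ 0 := by
        intro h
        have := congrArg Complex.re h
        simp at this
        exact hT this
      rw [hψv _ hz0, norm_div]
      have hy' : |y| ≤ ε := by
        have := Set.uIoc_subset_uIcc hy
        rw [Set.uIcc_of_le (by linarith)] at this
        exact abs_le.mpr this
      have e1 : ‖φ (T + y * Complex.I) - φ 0‖ ≤ 2 * C := by
        refine (norm_sub_le _ _).trans ?_
        have := hb (T + y * Complex.I) (by simpa using hy')
        have := hb 0 (by simpa using hε.le)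
        linarith
      have e2 : |T| ≤ ‖(T:ℂ) + y * Complex.I‖ := by
        have := Complex.abs_re_le_norm ((T:ℂ) + y * Complex.I)
        simpa using this
      have : 0 < |T| := abs_pos.mpr hT
      gcongr
    refine squeeze_zero_norm' (a := fun T => (2 * C / |T|) * |ε - -ε|) ?_ ?_
    · filter_upwards [eventually_gt_atTop 0] with T hT
      have hr := Complex.integral_boundary_rect_eq_zero_of_differentiableOn ψ (-T + (-ε : ℝ) * Complex.I) (T + ε * Complex.I) ?_
      · simp only [Complex.add_re, Complex.neg_re, Complex.ofReal_re, Complex.mul_re, Complex.I_re, mul_zero, Complex.ofReal_im, Complex.I_im, mul_one, sub_self, add_zero, Complex.add_im, Complex.neg_im, neg_zero, Complex.mul_im, zero_add, smul_eq_mul] at hr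
        have e1 : (∫ x in -T..T, ψ (x + ((-ε : ℝ):ℂ) * Complex.I)) = - ∫ x in -T..T, ψ (x + ε * Complex.I) := by
          rw [← intervalIntegral.integral_neg]
          have hc := intervalIntegral.integral_comp_neg (a := -T) (b := T) (fun x : ℝ => ψ (x + ((-ε : ℝ):ℂ) * Complex.I))
          rw [neg_neg] at hc
          rw [← hc]
          refine intervalIntegral.integral_congr fun t _ => ?_
          rw [← hψo _ (by simp [abs_of_pos hε]) (hne t)]
          congr 1
          push_cast; ring
        have e2 : (∫ x in -T..T, ψ (x + ε * Complex.I)) = 2⁻¹ * (Complex.I * (∫ y in (-ε)..ε, ψ (T + y * Complex.I)) - Complex.I * (∫ y in (-ε)..ε, ψ (((-T : ℝ):ℂ) + y * Complex.I))) := by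
          rw [e1] at hr
          linear_combination (-1/2 : ℂ) * hr
        rw [e2, norm_mul]
        have a1 := hs T hT.ne'
        have a2 := hs (-T) (by linarith)
        rw [abs_neg] at a2
        have := norm_sub_le (Complex.I * (∫ y in (-ε)..ε, ψ (T + y * Complex.I))) (Complex.I * (∫ y in (-ε)..ε, ψ (((-T : ℝ):ℂ) + y * Complex.I)))
        rw [norm_mul, norm_mul, Complex.norm_I, one_mul, one_mul] at this
        rw [norm_inv, Complex.norm_ofNat]
        linarith
      · intro z hz
        refine (hψd' z ?_).differentiableWithinAt
        have := hz.2
        simp at this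
        rw [Set.uIcc_of_le (by linarith)] at this
        exact abs_le.mpr this
    · have : Tendsto (fun T : ℝ => 2 * C / |T|) atTop (𝓝 0) :=
        tendsto_const_nhds.div_atTop tendsto_abs_atTop_atTop
      simpa using this.mul_const |ε - -ε|
  have hinv : ∀ T : ℝ, ∫ t in -T..T, ((t : ℂ) + ε * Complex.I)⁻¹ = -(2 * Real.arctan (T / ε) : ℝ) * Complex.I := by
    intro T
    have hodd : ∫ t in -T..T, ((t : ℂ) + ε * Complex.I)⁻¹ = ∫ t in -T..T, (-(t : ℂ) + ε * Complex.I)⁻¹ := by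
      have := intervalIntegral.integral_comp_neg (a := -T) (b := T) (fun t : ℝ => ((t : ℂ) + ε * Complex.I)⁻¹)
      rw [neg_neg] at this
      rw [← this]
      simp
    have hcont3 : Continuous (fun t : ℝ => (-(t : ℂ) + ε * Complex.I)⁻¹) := by
      refine Continuous.inv₀ (by fun_prop) fun t => ?_
      simpa using hne (-t)
    have h2 : 2 * ∫ t in -T..T, ((t : ℂ) + ε * Complex.I)⁻¹ = ∫ t in -T..T, (((2 * (ε / (ε^2 + t^2)) : ℝ) : ℂ) * (-Complex.I)) := by
      rw [two_mul]
      nth_rewrite 2 [hodd]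
      rw [← intervalIntegral.integral_add (hcont2.intervalIntegrable _ _) (hcont3.intervalIntegrable _ _)]
      refine intervalIntegral.integral_congr fun t _ => ?_
      have n1 := hne t
      have n2 := hne (-t)
      push_cast at n2 ⊢
      have n3 : (ε:ℂ)^2 + (t:ℂ)^2 ≠ 0 := by
        norm_cast
        positivity
      field_simp
      ring_nf
      simp only [Complex.I_sq, Complex.I_pow_three]
      ring
    rw [intervalIntegral.integral_mul_const, intervalIntegral.integral_ofReal, intervalIntegral.integral_const_mul,
      integral_div_sq_add_sq] at h2
    rw [neg_div, Real.arctan_neg] at h2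
    have h3 : (2:ℂ) ≠ 0 := two_ne_zero
    apply mul_left_cancel₀ h3
    rw [h2]
    push_cast
    ring
  have hi2 : Tendsto (fun T : ℝ => ∫ t in -T..T, ((t : ℂ) + ε * Complex.I)⁻¹) atTop (𝓝 (-(Real.pi * Complex.I))) := by
    simp_rw [hinv]
    have h1 : Tendsto (fun T : ℝ => Real.arctan (T / ε)) atTop (𝓝 (Real.pi / 2)) :=
      (tendsto_nhdsWithin_iff.mp Real.tendsto_arctan_atTop).1.comp (tendsto_id.atTop_div_const hε)
    have h2 := (Complex.continuous_ofReal.tendsto _).comp (h1.const_mul 2)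
    have h3 := h2.neg.mul_const Complex.I
    have e : -((2 * (Real.pi / 2) : ℝ) : ℂ) * Complex.I = -(Real.pi * Complex.I) := by
      push_cast; ring
    rw [e] at h3
    exact h3
  simp_rw [hsplit]
  have := hψ0.add (hi2.const_mul (φ 0))
  rw [zero_add] at this
  convert this using 2
  ring
end

section
open MeasureTheory Filter Topology

theorem norm_sinh_sq (z : ℂ) : ‖Complex.sinh z‖ ^ 2 = Real.sinh z.re ^ 2 + Real.sin z.im ^ 2 := by
  have h : Complex.sinh z = (Real.sinh z.re * Real.cos z.im : ℝ) + (Real.cosh z.re * Real.sin z.im : ℝ) * Complex.I := by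
    conv_lhs => rw [← Complex.re_add_im z, Complex.sinh_add, Complex.sinh_mul_I, Complex.cosh_mul_I]
    push_cast
    ring
  rw [h, ← Complex.normSq_eq_norm_sq, Complex.normSq_add_mul_I]
  have h1 := Real.cosh_sq z.re
  have h2 := Real.sin_sq_add_cos_sq z.im
  linear_combination Real.sin z.im ^ 2 * h1 + Real.sinh z.re ^ 2 * h2

theorem half_exp_le_cosh (x : ℝ) : Real.exp |x| / 2 ≤ Real.cosh x := by
  rw [← Real.cosh_abs, Real.cosh_eq]
  linarith [Real.exp_pos (-|x|)]

theorem sinh_lower (z : ℂ) : |Real.sin z.im| * (Real.exp |z.re| / 2) ≤ ‖Complex.sinh z‖ := by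
  refine le_trans (mul_le_mul_of_nonneg_left (half_exp_le_cosh z.re) (abs_nonneg _)) ?_
  refine abs_le_of_sq_le_sq' ?_ (norm_nonneg _) |>.2
  rw [norm_sinh_sq, mul_pow, sq_abs, Real.cosh_sq]
  nlinarith [Real.sin_sq_le_one z.im, sq_nonneg (Real.sinh z.re)]

theorem sinh_lower' (z : ℂ) : Real.sinh |z.re| ≤ ‖Complex.sinh z‖ := by
  refine abs_le_of_sq_le_sq' ?_ (norm_nonneg _) |>.2
  rw [norm_sinh_sq, ← Real.abs_sinh, sq_abs]
  nlinarith [sq_nonneg (Real.sin z.im)]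

theorem norm_cos_le (w : ℂ) : ‖Complex.cos w‖ ≤ Real.exp |w.im| := by
  rw [Complex.cos, norm_div, Complex.norm_ofNat, div_le_iff₀ two_pos]
  refine (norm_add_le _ _).trans ?_
  rw [Complex.norm_exp, Complex.norm_exp]
  have h1 : (w * Complex.I).re ≤ |w.im| := by simpa using neg_le_abs w.im
  have h2 : (-w * Complex.I).re ≤ |w.im| := by simpa using le_abs_self w.im
  have := Real.exp_le_exp.mpr h1
  have := Real.exp_le_exp.mpr h2
  linarith

theorem norm_sin_le (w : ℂ) : ‖Complex.sin w‖ ≤ Real.exp |w.im| := by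
  rw [Complex.sin, norm_div, Complex.norm_ofNat, div_le_iff₀ two_pos, norm_mul, Complex.norm_I, mul_one]
  refine (norm_sub_le _ _).trans ?_
  rw [Complex.norm_exp, Complex.norm_exp]
  have h1 : (w * Complex.I).re ≤ |w.im| := by simpa using neg_le_abs w.im
  have h2 : (-w * Complex.I).re ≤ |w.im| := by simpa using le_abs_self w.im
  have := Real.exp_le_exp.mpr h1
  have := Real.exp_le_exp.mpr h2
  linarith

theorem sinh_ne_zero_of (z : ℂ) (h1 : z ≠ 0) (h2 : |z.im| < Real.pi) : Complex.sinh z ≠ 0 := by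
  intro h
  have h3 := norm_sinh_sq z
  rw [h, norm_zero] at h3
  have h4 : Real.sinh z.re = 0 := by nlinarith [sq_nonneg (Real.sinh z.re), sq_nonneg (Real.sin z.im)]
  have h5 : Real.sin z.im = 0 := by nlinarith [sq_nonneg (Real.sinh z.re), sq_nonneg (Real.sin z.im)]
  rw [Real.sinh_eq_zero] at h4
  rw [abs_lt] at h2
  rw [Real.sin_eq_zero_iff_of_lt_of_lt h2.1 h2.2] at h5
  exact h1 (Complex.ext h4 h5)

/-- `z / sinh (c z)` with the singularity removed -/
noncomputable def chi (c : ℝ) (z : ℂ) : ℂ := (dslope (fun z : ℂ => Complex.sinh (c * z)) 0 z)⁻¹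

theorem chi_of_ne (c : ℝ) {z : ℂ} (hz : z ≠ 0) : chi c z = z / Complex.sinh (c * z) := by
  rw [chi, dslope_of_ne _ hz, slope_def_field]
  simp

theorem chi_zero (c : ℝ) : chi c 0 = (c : ℂ)⁻¹ := by
  rw [chi, dslope_same]
  have : HasDerivAt (fun z : ℂ => Complex.sinh (c * z)) (Complex.cosh (c * 0) * (c * 1)) 0 :=
    ((hasDerivAt_id (0:ℂ)).const_mul (c:ℂ)).csinh
  rw [this.deriv]
  simp

theorem chi_even (c : ℝ) (z : ℂ) : chi c (-z) = chi c z := by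
  by_cases h : z = 0
  · simp [h]
  · rw [chi_of_ne c h, chi_of_ne c (neg_ne_zero.mpr h), mul_neg, Complex.sinh_neg, neg_div_neg_eq]

theorem chi_diff (c : ℝ) (hc : 0 < c) (z : ℂ) (hz : c * |z.im| < Real.pi) :
    DifferentiableAt ℂ (chi c) z := by
  refine DifferentiableAt.inv ?_ ?_
  · have : DifferentiableOn ℂ (dslope (fun z : ℂ => Complex.sinh (c * z)) 0) Set.univ := by
      rw [Complex.differentiableOn_dslope univ_mem]
      exact ((differentiable_id.const_mul (c:ℂ)).csinh).differentiableOn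
    exact this.differentiableAt univ_mem
  · intro h
    have h1 : chi c z = 0 := by rw [chi, h, inv_zero]
    by_cases h0 : z = 0
    · rw [h0, chi_zero] at h1
      simp [hc.ne'] at h1
    · rw [chi_of_ne c h0, div_eq_zero_iff] at h1
      rcases h1 with h1 | h1
      · exact h0 h1
      · refine sinh_ne_zero_of _ ?_ ?_ h1
        · exact mul_ne_zero (by exact_mod_cast hc.ne') h0
        · simpa [abs_mul, abs_of_pos hc] using hz

theorem compact_bound (f : ℂ → ℂ) (h : ℝ) (hd : ∀ z : ℂ, |z.im| ≤ h → DifferentiableAt ℂ f z) :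
    ∃ M : ℝ, 0 ≤ M ∧ ∀ z : ℂ, |z.im| ≤ h → |z.re| ≤ 1 → ‖f z‖ ≤ M := by
  have hK : IsCompact (Set.Icc (-1:ℝ) 1 ×ℂ Set.Icc (-h) h) := isCompact_Icc.reProdIm isCompact_Icc
  obtain ⟨M, hM⟩ := hK.exists_bound_of_continuousOn (f := f) (by
    intro z hz
    exact (hd z (abs_le.mpr hz.2)).continuousAt.continuousWithinAt)
  refine ⟨max M 0, le_max_right _ _, fun z h1 h2 => (hM z ⟨abs_le.mp h2, abs_le.mp h1⟩).trans (le_max_left _ _)⟩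

theorem chi_bound (c : ℝ) (hc : 0 < c) (h : ℝ) (hh : 0 < h) (hch : c * h < Real.pi) (δ : ℝ) (hδ : 0 < δ) :
    ∃ C : ℝ, 0 ≤ C ∧ ∀ z : ℂ, |z.im| ≤ h → ‖chi c z‖ ≤ C * Real.exp (-(c - δ) * |z.re|) := by
  obtain ⟨M, hM0, hM⟩ := compact_bound (chi c) h (fun z hz => chi_diff c hc z
    (lt_of_le_of_lt (mul_le_mul_of_nonneg_left hz hc.le) hch))
  have hm : 0 < 1 - Real.exp (-(2 * c)) := by
    have : Real.exp (-(2 * c)) < 1 := by rw [Real.exp_lt_one_iff]; linarith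
    linarith
  set m := (1 - Real.exp (-(2 * c))) / 2 with hmdef
  have hm' : 0 < m := by positivity
  refine ⟨M * Real.exp |c - δ| + (1 + h) / δ / m, by positivity, fun z hz => ?_⟩
  rcases le_total |z.re| 1 with h1 | h1
  · have e1 : 1 ≤ Real.exp |c - δ| * Real.exp (-(c - δ) * |z.re|) := by
      rw [← Real.exp_add]
      apply Real.one_le_exp
      have : (c - δ) * |z.re| ≤ |c - δ| * 1 := by
        calc (c - δ) * |z.re| ≤ |c - δ| * |z.re| := by gcongr; exact le_abs_self _
          _ ≤ _ := by gcongr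
      linarith
    have e2 : 0 ≤ (1 + h) / δ / m * Real.exp (-(c - δ) * |z.re|) := by positivity
    calc ‖chi c z‖ ≤ M * 1 := by rw [mul_one]; exact hM z hz h1
      _ ≤ M * (Real.exp |c - δ| * Real.exp (-(c - δ) * |z.re|)) := by gcongr
      _ ≤ _ := by rw [add_mul, mul_assoc]; linarith
  · have hz0 : z ≠ 0 := by
      rintro rfl
      simp at h1
      linarith
    rw [chi_of_ne c hz0, norm_div]
    have e1 : m * Real.exp (c * |z.re|) ≤ ‖Complex.sinh (c * z)‖ := by
      refine le_trans ?_ (sinh_lower' _)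
      have : |((c:ℂ) * z).re| = c * |z.re| := by simp [abs_mul, abs_of_pos hc]
      rw [this, Real.sinh_eq, hmdef]
      have : Real.exp (-(c * |z.re|)) = Real.exp (-(2 * (c * |z.re|))) * Real.exp (c * |z.re|) := by
        rw [← Real.exp_add]; ring_nf
      rw [this]
      have : Real.exp (-(2 * (c * |z.re|))) ≤ Real.exp (-(2 * c)) := by
        apply Real.exp_le_exp.mpr
        nlinarith
      have := mul_le_mul_of_nonneg_right this (Real.exp_pos (c * |z.re|)).le
      linarith
    have e2 : ‖z‖ ≤ (1 + h) / δ * Real.exp (δ * |z.re|) := by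
      have := Complex.norm_le_abs_re_add_abs_im z
      have h3 : δ * |z.re| ≤ Real.exp (δ * |z.re|) := by linarith [Real.add_one_le_exp (δ * |z.re|)]
      have h4 : |z.re| ≤ Real.exp (δ * |z.re|) / δ := by
        rw [le_div_iff₀ hδ]; linarith
      calc ‖z‖ ≤ |z.re| + h := by linarith
        _ ≤ (1 + h) * |z.re| := by nlinarith
        _ ≤ (1 + h) * (Real.exp (δ * |z.re|) / δ) := by gcongr
        _ = _ := by ring
    have e3 : 0 ≤ M * Real.exp |c - δ| * Real.exp (-(c - δ) * |z.re|) := by positivity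
    calc ‖z‖ / ‖Complex.sinh (c * z)‖ ≤ ((1 + h) / δ * Real.exp (δ * |z.re|)) / (m * Real.exp (c * |z.re|)) := by
          gcongr
      _ = (1 + h) / δ / m * Real.exp (-(c - δ) * |z.re|) := by
          have : Real.exp (-(c - δ) * |z.re|) = Real.exp (δ * |z.re|) / Real.exp (c * |z.re|) := by
            rw [← Real.exp_sub]; ring_nf
          rw [this]
          field_simp
      _ ≤ _ := by rw [add_mul]; linarith

theorem tendsto_of_le_norm (f : ℂ → ℂ) (l : ℂ) (K : ℝ)
    (h : ∀ z : ℂ, z ≠ 0 → ‖z‖ ≤ 1 → ‖f z - l‖ ≤ K * ‖z‖) : Tendsto f (𝓝[≠] 0) (𝓝 l) := by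
  rw [tendsto_iff_norm_sub_tendsto_zero]
  refine squeeze_zero' (g := fun z => K * ‖z‖) (Eventually.of_forall fun _ => norm_nonneg _) ?_ ?_
  · have : Metric.ball (0:ℂ) 1 ∈ 𝓝[≠] (0:ℂ) := mem_nhdsWithin_of_mem_nhds (Metric.ball_mem_nhds _ one_pos)
    filter_upwards [this, self_mem_nhdsWithin] with z hz hz0
    refine h z hz0 ?_
    simpa using (Metric.mem_ball.mp hz).le
  · have : Tendsto (fun z : ℂ => K * ‖z‖) (𝓝 0) (𝓝 (K * ‖(0:ℂ)‖)) := by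
      apply Continuous.tendsto; fun_prop
    rw [norm_zero, mul_zero] at this
    exact this.mono_left nhdsWithin_le_nhds

theorem cos_lim : Tendsto (fun z : ℂ => (Complex.cos z - 1) / z ^ 2) (𝓝[≠] 0) (𝓝 (-1/2)) := by
  refine tendsto_of_le_norm _ _ 1 fun z hz h1 => ?_
  have h := Complex.cos_bound h1
  have e : (Complex.cos z - 1) / z ^ 2 - (-1/2) = (Complex.cos z - (1 - z^2/2)) / z^2 := by
    field_simp; ring
  rw [e, norm_div, norm_pow, div_le_iff₀ (by positivity)]
  have h3 : 0 < ‖z‖ := norm_pos_iff.mpr hz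
  refine h.trans ?_
  have : ‖z‖^4 ≤ ‖z‖^3 := pow_le_pow_of_le_one h3.le h1 (by norm_num)
  nlinarith [pow_pos h3 3]

theorem sinh_lim : Tendsto (fun z : ℂ => (Complex.sinh z - z) / z ^ 3) (𝓝[≠] 0) (𝓝 (1/6)) := by
  refine tendsto_of_le_norm _ _ 1 fun z hz h1 => ?_
  have h := Complex.sin_bound (x := z * Complex.I) (by simpa using h1)
  rw [Complex.sin_mul_I] at h
  have e : (Complex.sinh z - z) / z ^ 3 - 1/6 = (Complex.sinh z * Complex.I - (z * Complex.I - (z * Complex.I)^3/6)) / (z^3 * Complex.I) := by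
    rw [mul_pow, Complex.I_pow_three]
    have := Complex.I_ne_zero
    field_simp
    ring
  rw [e, norm_div, norm_mul, norm_pow, Complex.norm_I, mul_one, div_le_iff₀ (by positivity)]
  have h3 : 0 < ‖z‖ := norm_pos_iff.mpr hz
  refine h.trans ?_
  rw [norm_mul, Complex.norm_I, mul_one]
  nlinarith [pow_pos h3 4]
end

section
open MeasureTheory Filter Topology

theorem tau_ne {ε : ℝ} (hε : 0 < ε) (t : ℝ) : (t : ℂ) + ε * Complex.I ≠ 0 := by
  intro h
  have := congrArg Complex.im h
  simp at this
  exact hε.ne' this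

theorem int_tau_pow {ε : ℝ} (hε : 0 < ε) : Integrable (fun t : ℝ => (((t : ℂ) + ε * Complex.I) ^ 3)⁻¹) := by
  refine Integrable.mono' (integrable_inv_one_add_sq.const_mul (ε⁻¹ * (min 1 (ε^2))⁻¹)) ?_ ?_
  · refine Continuous.aestronglyMeasurable ?_
    exact Continuous.inv₀ (by fun_prop) fun t => pow_ne_zero _ (tau_ne hε t)
  · refine Eventually.of_forall fun t => ?_
    rw [norm_inv, norm_pow, mul_assoc, ← mul_inv, ← mul_inv]
    have h1 : ε ≤ ‖(t : ℂ) + ε * Complex.I‖ := by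
      have := Complex.abs_im_le_norm ((t : ℂ) + ε * Complex.I)
      simp [abs_of_pos hε] at this
      exact this
    have h2 : ‖(t : ℂ) + ε * Complex.I‖ ^ 2 = t ^ 2 + ε ^ 2 := by
      rw [← Complex.normSq_eq_norm_sq, Complex.normSq_add_mul_I]
    have h3 : 0 < min 1 (ε^2) := by positivity
    have h4 : min 1 (ε^2) * (1 + t^2) ≤ t^2 + ε^2 := by
      have := min_le_left 1 (ε^2)
      have := min_le_right 1 (ε^2)
      nlinarith [sq_nonneg t]
    apply inv_anti₀ (by positivity)
    calc ε * (min 1 (ε^2) * (1 + t^2)) ≤ ‖(t : ℂ) + ε * Complex.I‖ * ‖(t : ℂ) + ε * Complex.I‖ ^ 2 := by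
          rw [h2]; gcongr
      _ = _ := by ring

theorem int_tau_pow_zero {ε : ℝ} (hε : 0 < ε) : ∫ t : ℝ, (((t : ℂ) + ε * Complex.I) ^ 3)⁻¹ = 0 := by
  have hd : ∀ t : ℝ, HasDerivAt (fun t : ℝ => (-1/2 : ℂ) * (((t : ℂ) + ε * Complex.I) ^ 2)⁻¹)
      ((((t : ℂ) + ε * Complex.I) ^ 3)⁻¹) t := by
    intro t
    have h1 : HasDerivAt (fun t : ℝ => (t : ℂ) + ε * Complex.I) 1 t := by
      simpa using (Complex.ofRealCLM.hasDerivAt (x := t)).add_const (ε * Complex.I)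
    have h2 := ((h1.pow 2).inv (pow_ne_zero 2 (tau_ne hε t))).const_mul (-1/2 : ℂ)
    refine h2.congr_deriv ?_
    have := tau_ne hε t
    simp only [Pi.pow_apply]
    field_simp
    norm_num
  have ht : Tendsto (fun t : ℝ => ‖(t : ℂ) + ε * Complex.I‖) (cocompact ℝ) atTop := by
    refine tendsto_atTop_mono (f := fun t : ℝ => ‖t‖) ?_ (tendsto_norm_cocompact_atTop)
    intro t
    have := Complex.abs_re_le_norm ((t : ℂ) + ε * Complex.I)
    simpa using this
  have hl : Tendsto (fun t : ℝ => (-1/2 : ℂ) * (((t : ℂ) + ε * Complex.I) ^ 2)⁻¹) (cocompact ℝ) (𝓝 0) := by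
    rw [tendsto_zero_iff_norm_tendsto_zero]
    simp only [norm_mul, norm_inv, norm_pow]
    have : Tendsto (fun t : ℝ => (‖(t : ℂ) + ε * Complex.I‖^2)⁻¹) (cocompact ℝ) (𝓝 0) :=
      tendsto_inv_atTop_zero.comp ((tendsto_pow_atTop two_ne_zero).comp ht)
    simpa using this.const_mul ‖(-1/2 : ℂ)‖
  have := integral_of_hasDerivAt_of_tendsto hd (int_tau_pow hε) (hl.mono_left atBot_le_cocompact) (hl.mono_left atTop_le_cocompact)
  simpa using this

theorem odd_res3 (φ : ℂ → ℂ) (ε C : ℝ) (l : ℂ) (hε : 0 < ε)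
    (hd : ∀ z : ℂ, |z.im| ≤ ε → DifferentiableAt ℂ φ z)
    (he : ∀ z : ℂ, φ (-z) = φ z)
    (hb : ∀ z : ℂ, |z.im| ≤ ε → ‖φ z‖ ≤ C)
    (hl : Tendsto (fun z => (φ z - φ 0) / z ^ 2) (𝓝[≠] 0) (𝓝 l)) :
    ∫ t : ℝ, φ (t + ε * Complex.I) / (t + ε * Complex.I) ^ 3 = -(Real.pi * Complex.I) * l := by
  have hC : 0 ≤ C := (norm_nonneg _).trans (hb 0 (by simpa using hε.le))
  have ho : IsOpen {z : ℂ | |z.im| < ε} := isOpen_lt (by fun_prop) (by fun_prop)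
  have hmem : {z : ℂ | |z.im| < ε} ∈ 𝓝 (0:ℂ) := ho.mem_nhds (by simpa using hε)
  have hds : ∀ f : ℂ → ℂ, (∀ z : ℂ, |z.im| ≤ ε → DifferentiableAt ℂ f z) →
      ∀ z : ℂ, |z.im| ≤ ε → DifferentiableAt ℂ (dslope f 0) z := by
    intro f hf z hz
    by_cases h0 : z = 0
    · have : DifferentiableOn ℂ (dslope f 0) {z : ℂ | |z.im| < ε} := by
        rw [Complex.differentiableOn_dslope hmem]
        intro z hz
        exact (hf z (le_of_lt hz)).differentiableWithinAt
      rw [h0]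
      exact this.differentiableAt hmem
    · rw [differentiableAt_dslope_of_ne h0]
      exact hf z hz
  set ψ := dslope φ 0 with hψ
  set φ1 := dslope ψ 0 with hφ1
  have hψ0 : ψ 0 = 0 := by
    rw [hψ, dslope_same]
    have h1 : HasDerivAt φ (deriv φ 0) 0 := (hd 0 (by simpa using hε.le)).hasDerivAt
    have h2 : HasDerivAt φ (-(deriv φ 0)) 0 := by
      have h3 : HasDerivAt φ (deriv φ 0) (-0) := by simpa using h1
      have h4 := HasDerivAt.comp (0:ℂ) h3 (hasDerivAt_neg (0:ℂ))
      have e : φ ∘ Neg.neg = φ := funext he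
      rw [e] at h4
      simpa using h4
    have h5 := h1.unique h2
    linear_combination (1/2 : ℂ) * h5
  have hv : ∀ z : ℂ, z ≠ 0 → φ1 z = (φ z - φ 0) / z ^ 2 := by
    intro z hz
    rw [hφ1, dslope_of_ne _ hz, slope_def_field, hψ0, hψ, dslope_of_ne _ hz, slope_def_field]
    simp only [sub_zero]
    field_simp
  have hd1 : ∀ z : ℂ, |z.im| ≤ ε → DifferentiableAt ℂ φ1 z := hds ψ (hds φ hd)
  have he1 : ∀ z : ℂ, φ1 (-z) = φ1 z := by
    intro z
    by_cases h : z = 0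
    · simp [h]
    · rw [hv z h, hv _ (neg_ne_zero.mpr h), he, neg_sq]
  have h10 : φ1 0 = l := by
    have h1 : Tendsto φ1 (𝓝[≠] 0) (𝓝 (φ1 0)) := (hd1 0 (by simpa using hε.le)).continuousAt.tendsto.mono_left nhdsWithin_le_nhds
    refine tendsto_nhds_unique (h1.congr' ?_) hl
    filter_upwards [self_mem_nhdsWithin] with z hz using hv z hz
  obtain ⟨M, hM0, hM⟩ := compact_bound φ1 ε hd1
  have hb1 : ∀ z : ℂ, |z.im| ≤ ε → ‖φ1 z‖ ≤ M + 2 * C := by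
    intro z hz
    rcases le_total |z.re| 1 with h | h
    · linarith [hM z hz h]
    · have hz1 : 1 ≤ ‖z‖ := h.trans (Complex.abs_re_le_norm z)
      have hz0 : z ≠ 0 := by rintro rfl; simp at hz1; linarith
      rw [hv z hz0, norm_div, norm_pow]
      have h1 : ‖φ z - φ 0‖ ≤ 2 * C := by
        refine (norm_sub_le _ _).trans ?_
        linarith [hb z hz, hb 0 (by simpa using hε.le)]
      have := div_le_self (norm_nonneg (φ z - φ 0)) (one_le_pow₀ hz1 (n := 2))
      linarith
  have him : ∀ t : ℝ, |((t:ℂ) + ε * Complex.I).im| ≤ ε := fun t => by simp [abs_of_pos hε]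
  have hcφ : Continuous (fun t : ℝ => φ (t + ε * Complex.I)) := by
    rw [continuous_iff_continuousAt]
    intro x
    exact ContinuousAt.comp (f := fun x : ℝ => (x : ℂ) + ε * Complex.I) (hd _ (him x)).continuousAt (by fun_prop)
  have hi3 := int_tau_pow hε
  have hiφ : Integrable (fun t : ℝ => φ (t + ε * Complex.I) / (t + ε * Complex.I) ^ 3) := by
    simp only [div_eq_mul_inv]
    exact hi3.bdd_mul (c := C) hcφ.aestronglyMeasurable (Eventually.of_forall fun t => hb _ (him t))
  have e1 : ∀ t : ℝ, φ1 (t + ε * Complex.I) / (t + ε * Complex.I) =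
     φ (t + ε * Complex.I) / (t + ε * Complex.I) ^ 3 - φ 0 * ((t + ε * Complex.I) ^ 3)⁻¹ := by
    intro t
    have := tau_ne hε t
    rw [hv _ this]
    field_simp
  have hi1 : Integrable (fun t : ℝ => φ1 (t + ε * Complex.I) / (t + ε * Complex.I)) := by
    simp_rw [e1]
    exact hiφ.sub (hi3.const_mul _)
  have := odd_res φ1 ε (M + 2 * C) hε hd1 (fun z _ => he1 z) hb1 hi1
  simp_rw [e1] at this
  rw [integral_sub hiφ (hi3.const_mul _), integral_const_mul, int_tau_pow_zero hε, h10] at this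
  simpa using this

theorem chi_lim (c : ℝ) (hc : 0 < c) :
    Tendsto (fun z : ℂ => (chi c z - (c:ℂ)⁻¹) / z ^ 2) (𝓝[≠] 0) (𝓝 (-(c:ℂ)/6)) := by
  have hc' : (c:ℂ) ≠ 0 := by exact_mod_cast hc.ne'
  have h1 : Tendsto (chi c) (𝓝[≠] 0) (𝓝 ((c:ℂ)⁻¹)) := by
    rw [← chi_zero]
    exact (chi_diff c hc 0 (by simpa using Real.pi_pos)).continuousAt.tendsto.mono_left nhdsWithin_le_nhds
  have h2 : Tendsto (fun z : ℂ => (c:ℂ) * z) (𝓝[≠] 0) (𝓝[≠] 0) := by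
    rw [tendsto_nhdsWithin_iff]
    constructor
    · have : Tendsto (fun z : ℂ => (c:ℂ) * z) (𝓝 0) (𝓝 (c * 0)) := by apply Continuous.tendsto; fun_prop
      rw [mul_zero] at this
      exact this.mono_left nhdsWithin_le_nhds
    · filter_upwards [self_mem_nhdsWithin] with z hz using mul_ne_zero hc' hz
  have h3 := ((sinh_lim.comp h2).mul h1).const_mul (-(c:ℂ)^2)
  have e : -(c:ℂ)^2 * (1/6 * (c:ℂ)⁻¹) = -(c:ℂ)/6 := by field_simp
  rw [e] at h3
  refine h3.congr' ?_
  have hn : {z : ℂ | c * |z.im| < Real.pi} ∈ 𝓝[≠] (0:ℂ) :=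
    mem_nhdsWithin_of_mem_nhds ((isOpen_lt (by fun_prop) (by fun_prop)).mem_nhds (by simpa using Real.pi_pos))
  filter_upwards [self_mem_nhdsWithin, hn] with z hz hz2
  have hs : Complex.sinh (c * z) ≠ 0 := sinh_ne_zero_of _ (mul_ne_zero hc' hz) (by simpa [abs_mul, abs_of_pos hc] using hz2)
  have hz : z ≠ 0 := hz
  rw [chi_of_ne c hz]
  simp only [Function.comp]
  field_simp
  ring
end

section
open MeasureTheory Filter Topology

structure Adm (b ε : ℝ) : Prop where
  hb : 0 < b
  hε : 0 < ε
  h1 : b * ε < Real.pi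
  h2 : b⁻¹ * ε < Real.pi

noncomputable def tau (ε t : ℝ) : ℂ := (t : ℂ) + Complex.I * (ε : ℂ)

noncomputable def kerb (b ε t : ℝ) : ℂ :=
  4 * tau ε t * Complex.sinh ((b : ℂ) * tau ε t) * Complex.sinh (tau ε t / (b : ℂ))

theorem tau_re (ε t : ℝ) : (tau ε t).re = t := by simp [tau]
theorem tau_im (ε t : ℝ) : (tau ε t).im = ε := by simp [tau]
theorem tau_cont (ε : ℝ) : Continuous (tau ε) := by unfold tau; fun_prop
theorem tau_neg (ε t : ℝ) : tau ε (-t) = -(starRingEnd ℂ) (tau ε t) := by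
  simp [tau]; ring

theorem kerb_lower {b ε : ℝ} (h : Adm b ε) :
    ∃ m : ℝ, 0 < m ∧ ∀ t : ℝ, m * Real.exp ((b + b⁻¹) * |t|) ≤ ‖kerb b ε t‖ := by
  have hb := h.hb
  have hbi : 0 < b⁻¹ := inv_pos.mpr hb
  have s1 : 0 < Real.sin (b * ε) := Real.sin_pos_of_pos_of_lt_pi (mul_pos hb h.hε) h.h1
  have s2 : 0 < Real.sin (b⁻¹ * ε) := Real.sin_pos_of_pos_of_lt_pi (mul_pos hbi h.hε) h.h2
  refine ⟨4 * ε * (Real.sin (b * ε) / 2) * (Real.sin (b⁻¹ * ε) / 2), by have := h.hε; positivity, fun t => ?_⟩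
  have hε := h.hε
  have a0 : ε ≤ ‖tau ε t‖ := by
    have := Complex.abs_im_le_norm (tau ε t)
    rwa [tau_im, abs_of_pos h.hε] at this
  have a1 := sinh_lower ((b:ℂ) * tau ε t)
  have a2 := sinh_lower (tau ε t / (b:ℂ))
  have i1 : ((b:ℂ) * tau ε t).im = b * ε := by simp [tau_im]
  have r1 : ((b:ℂ) * tau ε t).re = b * t := by simp [tau_re]
  have i2 : (tau ε t / (b:ℂ)).im = b⁻¹ * ε := by rw [Complex.div_ofReal_im, tau_im]; ring
  have r2 : (tau ε t / (b:ℂ)).re = b⁻¹ * t := by rw [Complex.div_ofReal_re, tau_re]; ring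
  rw [i1, r1, abs_of_pos s1, abs_mul, abs_of_pos hb] at a1
  rw [i2, r2, abs_of_pos s2, abs_mul, abs_of_pos hbi] at a2
  rw [kerb, norm_mul, norm_mul, norm_mul, Complex.norm_ofNat]
  calc _ = 4 * ε * (Real.sin (b * ε) * (Real.exp (b * |t|) / 2)) * (Real.sin (b⁻¹ * ε) * (Real.exp (b⁻¹ * |t|) / 2)) := by
        rw [add_mul, Real.exp_add]; ring
    _ ≤ _ := by gcongr

theorem kerb_ne {b ε : ℝ} (h : Adm b ε) (t : ℝ) : kerb b ε t ≠ 0 := by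
  obtain ⟨m, hm, hk⟩ := kerb_lower h
  rw [← norm_pos_iff]
  exact lt_of_lt_of_le (by positivity) (hk t)

theorem kerb_cont (b ε : ℝ) : Continuous (kerb b ε) := by
  have := tau_cont ε
  unfold kerb; fun_prop

theorem kerb_int {b ε : ℝ} (h : Adm b ε) (N : ℝ → ℂ) (hN : Continuous N) (C c : ℝ) (hc : c < b + b⁻¹)
    (hb : ∀ t, ‖N t‖ ≤ C * Real.exp (c * |t|)) : Integrable (fun t => N t / kerb b ε t) := by
  obtain ⟨m, hm, hk⟩ := kerb_lower h
  have hC : 0 ≤ C := by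
    have := (norm_nonneg _).trans (hb 0)
    simpa using this
  refine Integrable.mono' ((integrable_exp_abs (sub_pos.mpr hc)).const_mul (C / m)) ?_ ?_
  · exact (hN.div (kerb_cont b ε) (kerb_ne h)).aestronglyMeasurable
  · refine Eventually.of_forall fun t => ?_
    rw [norm_div]
    calc ‖N t‖ / ‖kerb b ε t‖ ≤ (C * Real.exp (c * |t|)) / (m * Real.exp ((b + b⁻¹) * |t|)) := by
          gcongr
          · exact hb t
          · exact hk t
      _ = _ := by
          rw [mul_div_mul_comm, ← Real.exp_sub]; congr 2; ring

theorem im_2tau {ε : ℝ} (hε : 0 < ε) (t : ℝ) (s : ℂ) :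
    |(2 * tau ε t * s).im| ≤ 2 * |s.im| * |t| + 2 * ε * |s.re| := by
  have : (2 * tau ε t * s).im = 2 * t * s.im + 2 * ε * s.re := by
    simp [tau_re, tau_im]
  rw [this]
  refine (abs_add_le _ _).trans ?_
  rw [abs_mul, abs_mul, abs_mul, abs_mul, abs_of_pos hε, abs_of_pos (two_pos : (0:ℝ) < 2)]
  linarith

theorem sin_bd {ε : ℝ} (hε : 0 < ε) (t : ℝ) (s : ℂ) :
    ‖Complex.sin (2 * tau ε t * s)‖ ≤ Real.exp (2 * ε * |s.re|) * Real.exp (2 * |s.im| * |t|) := by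
  refine (norm_sin_le _).trans ?_
  rw [← Real.exp_add]
  apply Real.exp_le_exp.mpr
  linarith [im_2tau hε t s]

theorem cos_bd {ε : ℝ} (hε : 0 < ε) (t : ℝ) (s : ℂ) :
    ‖Complex.cos (2 * tau ε t * s)‖ ≤ Real.exp (2 * ε * |s.re|) * Real.exp (2 * |s.im| * |t|) := by
  refine (norm_cos_le _).trans ?_
  rw [← Real.exp_add]
  apply Real.exp_le_exp.mpr
  linarith [im_2tau hε t s]

theorem sin_int {b ε : ℝ} (h : Adm b ε) (s : ℂ) (hs : |s.im| < (b + b⁻¹) / 2) :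
    Integrable (fun t => Complex.sin (2 * tau ε t * s) / kerb b ε t) := by
  have := tau_cont ε
  exact kerb_int h _ (by fun_prop) _ (2 * |s.im|) (by linarith) (fun t => sin_bd h.hε t s)

theorem cos_int {b ε : ℝ} (h : Adm b ε) (s : ℂ) (hs : |s.im| < (b + b⁻¹) / 2) :
    Integrable (fun t => Complex.cos (2 * tau ε t * s) / kerb b ε t) := by
  have := tau_cont ε
  exact kerb_int h _ (by fun_prop) _ (2 * |s.im|) (by linarith) (fun t => cos_bd h.hε t s)

theorem cos_eval {b ε : ℝ} (h : Adm b ε) (s : ℂ) (hs : |s.im| < (b + b⁻¹) / 2) :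
    ∫ t, Complex.cos (2 * tau ε t * s) / kerb b ε t =
      Complex.I * Real.pi / 2 * s ^ 2 + Complex.I * Real.pi / 24 * ((b:ℂ)^2 + ((b:ℂ))⁻¹^2) := by
  have hb := h.hb
  have hbi : 0 < b⁻¹ := inv_pos.mpr hb
  have hb' : (b:ℂ) ≠ 0 := by exact_mod_cast hb.ne'
  set δ := ((b + b⁻¹) / 2 - |s.im|) with hδ
  have hδ0 : 0 < δ := by linarith
  obtain ⟨C1, hC1, hB1⟩ := chi_bound b hb ε h.hε h.h1 δ hδ0
  obtain ⟨C2, hC2, hB2⟩ := chi_bound b⁻¹ hbi ε h.hε h.h2 δ hδ0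
  set φ : ℂ → ℂ := fun z => Complex.cos (2 * z * s) * chi b z * chi b⁻¹ z with hφ
  have h0 : φ 0 = 1 := by
    simp only [hφ, chi_zero]; push_cast; simp [hb']
  have hd1 : ∀ z : ℂ, |z.im| ≤ ε → DifferentiableAt ℂ (chi b) z := fun z hz => chi_diff b hb z
    (lt_of_le_of_lt (mul_le_mul_of_nonneg_left hz hb.le) h.h1)
  have hd2 : ∀ z : ℂ, |z.im| ≤ ε → DifferentiableAt ℂ (chi b⁻¹) z := fun z hz => chi_diff b⁻¹ hbi z
    (lt_of_le_of_lt (mul_le_mul_of_nonneg_left hz hbi.le) h.h2)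
  have hd : ∀ z : ℂ, |z.im| ≤ ε → DifferentiableAt ℂ φ z := by
    intro z hz
    have := hd1 z hz
    have := hd2 z hz
    simp only [hφ]
    fun_prop
  have he : ∀ z, φ (-z) = φ z := by
    intro z
    simp only [hφ, chi_even]
    rw [← Complex.cos_neg]; congr 3; ring
  have hbd : ∀ z : ℂ, |z.im| ≤ ε → ‖φ z‖ ≤ Real.exp (2 * ε * |s.re|) * C1 * C2 := by
    intro z hz
    simp only [hφ]
    rw [norm_mul, norm_mul]
    have a0 : ‖Complex.cos (2 * z * s)‖ ≤ Real.exp (2 * ε * |s.re|) * Real.exp (2 * |s.im| * |z.re|) := by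
      refine (norm_cos_le _).trans ?_
      rw [← Real.exp_add]
      apply Real.exp_le_exp.mpr
      have : (2 * z * s).im = 2 * z.re * s.im + 2 * z.im * s.re := by simp
      rw [this]
      refine (abs_add_le _ _).trans ?_
      rw [abs_mul, abs_mul, abs_mul, abs_mul, abs_of_pos (two_pos : (0:ℝ) < 2)]
      have := mul_le_mul_of_nonneg_right hz (abs_nonneg s.re)
      linarith
    calc _ ≤ (Real.exp (2 * ε * |s.re|) * Real.exp (2 * |s.im| * |z.re|)) * (C1 * Real.exp (-(b - δ) * |z.re|)) * (C2 * Real.exp (-(b⁻¹ - δ) * |z.re|)) := by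
          gcongr
          · exact hB1 z hz
          · exact hB2 z hz
      _ = Real.exp (2 * ε * |s.re|) * C1 * C2 * (Real.exp (2 * |s.im| * |z.re|) * Real.exp (-(b - δ) * |z.re|) * Real.exp (-(b⁻¹ - δ) * |z.re|)) := by ring
      _ = Real.exp (2 * ε * |s.re|) * C1 * C2 := by
          rw [← Real.exp_add, ← Real.exp_add]
          have : 2 * |s.im| * |z.re| + -(b - δ) * |z.re| + -(b⁻¹ - δ) * |z.re| = 0 := by rw [hδ]; ring
          rw [this, Real.exp_zero, mul_one]
  have hlim : Tendsto (fun z => (φ z - φ 0) / z ^ 2) (𝓝[≠] 0) (𝓝 (-2 * s^2 - ((b:ℂ)^2 + ((b:ℂ))⁻¹^2) / 6)) := by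
    have l1 := chi_lim b hb
    have l2 := chi_lim b⁻¹ hbi
    have c1 : Tendsto (chi b) (𝓝[≠] 0) (𝓝 (chi b 0)) := (hd1 0 (by simpa using h.hε.le)).continuousAt.tendsto.mono_left nhdsWithin_le_nhds
    have c2 : Tendsto (chi b⁻¹) (𝓝[≠] 0) (𝓝 (chi b⁻¹ 0)) := (hd2 0 (by simpa using h.hε.le)).continuousAt.tendsto.mono_left nhdsWithin_le_nhds
    have l0 : Tendsto (fun z : ℂ => (Complex.cos (2 * z * s) - 1) / z ^ 2) (𝓝[≠] 0) (𝓝 (-2 * s^2)) := by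
      by_cases hs0 : s = 0
      · simp [hs0]
      have h2 : Tendsto (fun z : ℂ => 2 * z * s) (𝓝[≠] 0) (𝓝[≠] 0) := by
        rw [tendsto_nhdsWithin_iff]
        constructor
        · have : Tendsto (fun z : ℂ => 2 * z * s) (𝓝 0) (𝓝 (2 * 0 * s)) := by apply Continuous.tendsto; fun_prop
          simp only [mul_zero, zero_mul] at this
          exact this.mono_left nhdsWithin_le_nhds
        · filter_upwards [self_mem_nhdsWithin] with z hz using mul_ne_zero (mul_ne_zero two_ne_zero hz) hs0
      have := (cos_lim.comp h2).mul_const (4 * s^2)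
      have e : (-1/2 : ℂ) * (4 * s^2) = -2 * s^2 := by ring
      rw [e] at this
      refine this.congr' ?_
      filter_upwards [self_mem_nhdsWithin] with z hz
      have hz : z ≠ 0 := hz
      simp only [Function.comp]
      field_simp
      ring
    have := ((l0.mul c1).mul c2).add ((c2.mul l1).add (l2.const_mul ((b:ℂ)⁻¹)))
    have e : (-2 * s^2) * chi b 0 * chi b⁻¹ 0 + (chi b⁻¹ 0 * (-(b:ℂ)/6) + (b:ℂ)⁻¹ * (-((b⁻¹ : ℝ):ℂ)/6)) =
       -2 * s^2 - ((b:ℂ)^2 + ((b:ℂ))⁻¹^2) / 6 := by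
      rw [chi_zero, chi_zero]; push_cast; field_simp; ring
    rw [e] at this
    refine this.congr' ?_
    filter_upwards [self_mem_nhdsWithin] with z hz
    have hz : z ≠ 0 := hz
    rw [h0]
    simp only [hφ]
    push_cast
    field_simp
    ring
  have := odd_res3 φ ε _ _ h.hε hd he hbd hlim
  have e : ∀ t : ℝ, Complex.cos (2 * tau ε t * s) / kerb b ε t = (1/4) * (φ (t + ε * Complex.I) / (t + ε * Complex.I) ^ 3) := by
    intro t
    have hn := tau_ne h.hε t
    simp only [hφ]
    rw [chi_of_ne _ hn, chi_of_ne _ hn, kerb, tau, mul_comm Complex.I (ε:ℂ)]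
    have hk := kerb_ne h t
    rw [kerb, tau, mul_comm Complex.I (ε:ℂ)] at hk
    push_cast
    rw [inv_mul_eq_div]
    have k1 := right_ne_zero_of_mul hk
    have k2 := right_ne_zero_of_mul (left_ne_zero_of_mul hk)
    field_simp
  simp_rw [e]
  rw [integral_const_mul, this]
  ring
end

section
open MeasureTheory Filter Topology

noncomputable def Lw (b ε : ℝ) (s : ℂ) : ℂ := ∫ t, Complex.sin (2 * tau ε t * s) / kerb b ε t

theorem wb_eq {b ε : ℝ} (h : Adm b ε) (s : ℂ) (hs : |s.im| < (b + b⁻¹) / 2) :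
    wb b ε s = Complex.exp (Complex.I * Lw b ε s) := by
  have e : ∀ t : ℝ, Complex.exp (-(2 * Complex.I * ((t : ℂ) + Complex.I * (ε : ℂ)) * s)) /
        (4 * ((t : ℂ) + Complex.I * (ε : ℂ)) *
          Complex.sinh ((b : ℂ) * ((t : ℂ) + Complex.I * (ε : ℂ))) *
          Complex.sinh (((t : ℂ) + Complex.I * (ε : ℂ)) / (b : ℂ))) =
      Complex.cos (2 * tau ε t * s) / kerb b ε t - Complex.I * (Complex.sin (2 * tau ε t * s) / kerb b ε t) := by
    intro t
    have : Complex.exp (-(2 * Complex.I * ((t : ℂ) + Complex.I * (ε : ℂ)) * s)) = Complex.cos (2 * tau ε t * s) - Complex.I * Complex.sin (2 * tau ε t * s) := by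
      have e1 : -(2 * Complex.I * ((t : ℂ) + Complex.I * (ε : ℂ)) * s) = (-(2 * tau ε t * s)) * Complex.I := by
        rw [tau]; ring
      rw [e1, Complex.exp_mul_I, Complex.cos_neg, Complex.sin_neg]; ring
    rw [this, kerb, tau]; ring
  rw [wb]
  simp_rw [e]
  rw [integral_sub (cos_int h s hs) ((sin_int h s hs).const_mul _), integral_const_mul, cos_eval h s hs, ← Lw]
  congr 1; ring

theorem Lw_neg (b ε : ℝ) (s : ℂ) : Lw b ε (-s) = - Lw b ε s := by
  rw [Lw, Lw, ← integral_neg]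
  congr 1; ext t
  rw [mul_neg, Complex.sin_neg, neg_div]

theorem wb_inv {b ε : ℝ} (h : Adm b ε) (s : ℂ) (hs : |s.im| < (b + b⁻¹) / 2) :
    wb b ε s * wb b ε (-s) = 1 := by
  rw [wb_eq h s hs, wb_eq h (-s) (by simpa using hs), Lw_neg, ← Complex.exp_add]
  simp

theorem Dfun_eq {b ε : ℝ} (h : Adm b ε) (α z : ℂ) (h1 : |(α + z).im| < (b + b⁻¹) / 2)
    (h2 : |(α - z).im| < (b + b⁻¹) / 2) :
    Dfun b ε α z = wb b ε (α + z) * wb b ε (α - z) := by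
  rw [wb_eq h _ h1, wb_eq h _ h2, ← Complex.exp_add, ← mul_add, Lw, Lw,
    ← integral_add (sin_int h _ h1) (sin_int h _ h2), Dfun]
  congr 2
  refine integral_congr_ae (Eventually.of_forall fun t => ?_)
  have e : Complex.sin (2 * tau ε t * (α + z)) + Complex.sin (2 * tau ε t * (α - z)) =
      2 * (Complex.cos (2 * tau ε t * z) * Complex.sin (2 * α * tau ε t)) := by
    rw [mul_add, mul_sub, Complex.sin_add, Complex.sin_sub,
      show 2 * α * tau ε t = 2 * tau ε t * α by ring]; ring
  have hk := kerb_ne h t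
  simp only
  rw [← add_div, e, ← tau]
  rw [kerb] at hk ⊢
  have k1 := right_ne_zero_of_mul hk
  have k2 := right_ne_zero_of_mul (left_ne_zero_of_mul hk)
  have k3 := right_ne_zero_of_mul (left_ne_zero_of_mul (left_ne_zero_of_mul hk))
  generalize Complex.sinh (tau ε t / (b:ℂ)) = S1 at *
  generalize Complex.sinh ((b:ℂ) * tau ε t) = S2 at *
  field_simp
  ring

theorem Lw_diff {b ε : ℝ} (h : Adm b ε) (s : ℂ) (hs : |s.im| < (b + b⁻¹) / 2) :
    DifferentiableAt ℂ (Lw b ε) s := by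
  have hε := h.hε
  set r := ((b + b⁻¹) / 2 - |s.im|) / 2 with hr
  have hr0 : 0 < r := by rw [hr]; linarith
  have ht := tau_cont ε
  refine (hol_param (fun s t => Complex.sin (2 * tau ε t * s) / kerb b ε t) s r hr0
    (fun t => ‖((Real.exp (2 * ε * (|s.re| + r)) * Real.exp (2 * (|s.im| + r) * |t|) : ℝ) : ℂ) / kerb b ε t‖) ?_ ?_ ?_ ?_).differentiableAt
  · refine (kerb_int h (fun t => ((Real.exp (2 * ε * (|s.re| + r)) * Real.exp (2 * (|s.im| + r) * |t|) : ℝ) : ℂ)) (by fun_prop)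
      (Real.exp (2 * ε * (|s.re| + r))) (2 * (|s.im| + r)) (by linarith) ?_).norm
    intro t
    rw [Complex.norm_real, Real.norm_eq_abs, abs_of_pos (by positivity)]
  · intro s _
    exact ((by fun_prop : Continuous fun t => Complex.sin (2 * tau ε t * s)).div (kerb_cont b ε) (kerb_ne h)).aestronglyMeasurable
  · intro t
    have : Differentiable ℂ (fun s => Complex.sin (2 * tau ε t * s) / kerb b ε t) := by fun_prop
    exact this.differentiableOn
  · intro s' hs' t
    rw [norm_div, norm_div]
    refine div_le_div_of_nonneg_right ?_ (norm_nonneg _)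
    rw [Complex.norm_real, Real.norm_eq_abs, abs_of_pos (by positivity)]
    refine (sin_bd hε t s').trans ?_
    rw [Metric.mem_ball, dist_eq_norm] at hs'
    have h1 := (Complex.abs_re_le_norm (s' - s)).trans hs'.le
    have h2 := (Complex.abs_im_le_norm (s' - s)).trans hs'.le
    rw [Complex.sub_re] at h1
    rw [Complex.sub_im] at h2
    have h3 : |s'.re| ≤ |s.re| + r := by linarith [abs_sub_abs_le_abs_sub s'.re s.re]
    have h4 : |s'.im| ≤ |s.im| + r := by linarith [abs_sub_abs_le_abs_sub s'.im s.im]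
    gcongr

theorem wb_diff {b ε : ℝ} (h : Adm b ε) (s : ℂ) (hs : |s.im| < (b + b⁻¹) / 2) :
    DifferentiableAt ℂ (wb b ε) s := by
  have h1 : DifferentiableAt ℂ (fun s => Complex.exp (Complex.I * Lw b ε s)) s := by
    have := Lw_diff h s hs
    fun_prop
  refine h1.congr_of_eventuallyEq ?_
  have ho : IsOpen {z : ℂ | |z.im| < (b + b⁻¹) / 2} := isOpen_lt (by fun_prop) (by fun_prop)
  filter_upwards [ho.mem_nhds hs] with z hz using wb_eq h z hz

theorem Lw_conj (b ε : ℝ) (s : ℂ) : (starRingEnd ℂ) (Lw b ε s) = Lw b ε ((starRingEnd ℂ) s) := by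
  rw [Lw, Lw, ← integral_conj, ← integral_neg_eq_self]
  refine integral_congr_ae (Eventually.of_forall fun t => ?_)
  simp only
  rw [kerb, kerb, tau_neg]
  simp only [map_div₀, map_mul, ← Complex.sin_conj, ← Complex.sinh_conj, map_neg, Complex.conj_conj, Complex.conj_ofReal, map_ofNat]
  rw [show 2 * -tau ε t * (starRingEnd ℂ) s = -(2 * tau ε t * (starRingEnd ℂ) s) by ring,
    show (b:ℂ) * -tau ε t = -(b * tau ε t) by ring, show -tau ε t / (b:ℂ) = -(tau ε t / b) by ring,
    Complex.sin_neg, Complex.sinh_neg, Complex.sinh_neg,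
    show 4 * -tau ε t * -Complex.sinh (b * tau ε t) * -Complex.sinh (tau ε t / b) = -(4 * tau ε t * Complex.sinh (b * tau ε t) * Complex.sinh (tau ε t / b)) by ring, neg_div_neg_eq]

theorem wb_pos {b ε : ℝ} (h : Adm b ε) (s : ℂ) (hs : |s.im| < (b + b⁻¹) / 2) :
    ∃ r : ℝ, 0 < r ∧ wb b ε s * wb b ε (-(starRingEnd ℂ) s) = (r : ℂ) := by
  refine ⟨Real.exp (-2 * (Lw b ε s).im), Real.exp_pos _, ?_⟩
  rw [wb_eq h s hs, wb_eq h _ (by simpa using hs), Lw_neg, ← Lw_conj, ← Complex.exp_add, Complex.ofReal_exp]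
  congr 1
  apply Complex.ext <;> simp
  ring

theorem wb_bound0 {b ε : ℝ} (h : Adm b ε) (d : ℝ) (hd : d < (b + b⁻¹) / 2) :
    ∃ C : ℝ, 0 < C ∧ ∀ z : ℂ, |z.im| ≤ d → z.re ≤ 0 →
      ‖wb b ε z‖ ≤ C * Real.exp (-(Real.pi * z.im * z.re)) ∧ Real.exp (-(Real.pi * z.im * z.re)) ≤ C * ‖wb b ε z‖ := by
  set K := ∫ t, ‖((Real.exp (2 * d * |t|) : ℝ) : ℂ) / kerb b ε t‖ with hK
  have hKi : Integrable (fun t => ‖((Real.exp (2 * d * |t|) : ℝ) : ℂ) / kerb b ε t‖) := by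
    refine (kerb_int h (fun t => ((Real.exp (2 * d * |t|) : ℝ) : ℂ)) (by fun_prop)
      1 (2 * d) (by linarith) ?_).norm
    intro t
    rw [Complex.norm_real, Real.norm_eq_abs, abs_of_pos (by positivity), one_mul]
  refine ⟨Real.exp K, Real.exp_pos _, fun z hz hre => ?_⟩
  set J := ∫ t : ℝ,
      Complex.exp (-(2 * Complex.I * ((t : ℂ) + Complex.I * (ε : ℂ)) * z)) /
        (4 * ((t : ℂ) + Complex.I * (ε : ℂ)) *
          Complex.sinh ((b : ℂ) * ((t : ℂ) + Complex.I * (ε : ℂ))) *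
          Complex.sinh (((t : ℂ) + Complex.I * (ε : ℂ)) / (b : ℂ))) with hJ
  have hJK : ‖J‖ ≤ K := by
    refine norm_integral_le_of_norm_le hKi (Eventually.of_forall fun t => ?_)
    rw [norm_div, norm_div]
    change _ / ‖kerb b ε t‖ ≤ _
    refine div_le_div_of_nonneg_right ?_ (norm_nonneg _)
    rw [Complex.norm_real, Real.norm_eq_abs, abs_of_pos (by positivity), Complex.norm_exp]
    apply Real.exp_le_exp.mpr
    have : (-(2 * Complex.I * ((t : ℂ) + Complex.I * (ε : ℂ)) * z)).re = 2 * (t * z.im) + 2 * (ε * z.re) := by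
      simp; ring
    rw [this]
    have h1 : t * z.im ≤ |t| * |z.im| := by rw [← abs_mul]; exact le_abs_self _
    have h2 : |t| * |z.im| ≤ |t| * d := by gcongr
    have h3 : ε * z.re ≤ 0 := mul_nonpos_of_nonneg_of_nonpos h.hε.le hre
    linarith
  have e : ‖wb b ε z‖ = Real.exp (-(Real.pi * z.im * z.re) - J.re) := by
    rw [wb, ← hJ, Complex.norm_exp]
    congr 1
    have e2 : ((b : ℂ) ^ 2 + ((b : ℂ))⁻¹ ^ 2) = ((b^2 + b⁻¹^2 : ℝ) : ℂ) := by push_cast; ring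
    rw [e2]
    rw [Complex.sub_re, Complex.add_re]
    have e3 : (Complex.I * (Real.pi:ℂ) / 24 * ((b^2 + b⁻¹^2 : ℝ) : ℂ)).re = 0 := by
      rw [show Complex.I * (Real.pi:ℂ) / 24 * ((b^2 + b⁻¹^2 : ℝ) : ℂ) = ((Real.pi / 24 * (b^2 + b⁻¹^2) : ℝ) : ℂ) * Complex.I by push_cast; ring]
      simp only [Complex.re_ofReal_mul, Complex.I_re, mul_zero]
    have e4 : (Complex.I * (Real.pi:ℂ) / 2 * z^2).re = -(Real.pi * z.im * z.re) := by
      rw [show Complex.I * (Real.pi:ℂ) / 2 * z^2 = ((Real.pi / 2 : ℝ):ℂ) * (Complex.I * z^2) by push_cast; ring]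
      rw [Complex.re_ofReal_mul, sq]
      simp
      ring
    rw [e3, e4]; ring
  have hJ1 := (Complex.abs_re_le_norm J).trans hJK
  rw [abs_le] at hJ1
  rw [e, ← Real.exp_add, ← Real.exp_add]
  constructor <;> apply Real.exp_le_exp.mpr <;> linarith

theorem wb_bound {b ε : ℝ} (h : Adm b ε) (d : ℝ) (hd : d < (b + b⁻¹) / 2) :
    ∃ C : ℝ, 0 < C ∧ ∀ z : ℂ, |z.im| ≤ d →
      ‖wb b ε z‖ ≤ C * Real.exp (Real.pi * z.im * |z.re|) ∧ Real.exp (Real.pi * z.im * |z.re|) ≤ C * ‖wb b ε z‖ := by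
  obtain ⟨C, hC, hB⟩ := wb_bound0 h d hd
  refine ⟨C, hC, fun z hz => ?_⟩
  rcases le_total z.re 0 with h0 | h0
  · have := hB z hz h0
    rw [abs_of_nonpos h0]
    have e : Real.pi * z.im * -z.re = -(Real.pi * z.im * z.re) := by ring
    rwa [e]
  · have := hB (-z) (by simpa using hz) (by simpa using h0)
    rw [abs_of_nonneg h0]
    have e : -(Real.pi * (-z).im * (-z).re) = -(Real.pi * z.im * z.re) := by simp
    rw [e, Real.exp_neg] at this
    have hi := congrArg norm (wb_inv h z (lt_of_le_of_lt hz hd))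
    rw [norm_mul, norm_one] at hi
    set x := ‖wb b ε z‖
    set y := ‖wb b ε (-z)‖
    set E := Real.exp (Real.pi * z.im * z.re)
    have hE : 0 < E := Real.exp_pos _
    have hx : 0 ≤ x := norm_nonneg _
    obtain ⟨a1, a2⟩ := this
    have a1' : y * E ≤ C := by
      calc y * E ≤ C * E⁻¹ * E := by gcongr
        _ = C := by field_simp
    have a2' : 1 ≤ C * y * E := by
      calc 1 = E⁻¹ * E := by field_simp
        _ ≤ _ := by gcongr
    constructor
    · calc x = x * 1 := by ring
        _ ≤ x * (C * y * E) := by gcongr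
        _ = C * E * (x * y) := by ring
        _ = _ := by rw [hi]; ring
    · calc E = x * y * E := by rw [hi]; ring
        _ = x * (y * E) := by ring
        _ ≤ x * C := by gcongr
        _ = _ := by ring
end

section
open MeasureTheory Filter Topology

theorem cosh_int (b : ℝ) (hb : 0 < b) (N : ℝ → ℂ) (hN : Continuous N) (C c : ℝ) (hc : c < b⁻¹)
    (hbd : ∀ t, ‖N t‖ ≤ C * Real.exp (c * |t|)) : Integrable (fun t : ℝ => N t / Complex.cosh (t / b)) := by
  have hbi : 0 < b⁻¹ := inv_pos.mpr hb
  have hC : 0 ≤ C := by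
    have := (norm_nonneg _).trans (hbd 0)
    simpa using this
  have key : ∀ t : ℝ, Real.exp (b⁻¹ * |t|) / 2 ≤ ‖Complex.cosh (t / b)‖ := by
    intro t
    have e : Complex.cosh (t / b) = ((Real.cosh (t / b) : ℝ) : ℂ) := by push_cast; rfl
    rw [e, Complex.norm_real, Real.norm_eq_abs, abs_of_pos (Real.cosh_pos _)]
    have := half_exp_le_cosh (t / b)
    rwa [abs_div, abs_of_pos hb, div_eq_inv_mul |t|] at this
  have hne : ∀ t : ℝ, Complex.cosh (t / b) ≠ 0 := fun t => by
    rw [← norm_pos_iff]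
    exact lt_of_lt_of_le (by positivity) (key t)
  refine Integrable.mono' ((integrable_exp_abs (sub_pos.mpr hc)).const_mul (2 * C)) ?_ ?_
  · exact (hN.div (by fun_prop) hne).aestronglyMeasurable
  · refine Eventually.of_forall fun t => ?_
    rw [norm_div]
    calc ‖N t‖ / ‖Complex.cosh (t / b)‖ ≤ (C * Real.exp (c * |t|)) / (Real.exp (b⁻¹ * |t|) / 2) := by
          gcongr
          · exact hbd t
          · exact key t
      _ = 2 * C * (Real.exp (c * |t|) / Real.exp (b⁻¹ * |t|)) := by field_simp
      _ = _ := by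
          rw [← Real.exp_sub]; congr 2; ring

theorem alg1 (N ζ c : ℂ) (hζ : ζ ≠ 0) : N * (ζ / (Complex.I * c)) / ζ = -Complex.I * (N / c) := by
  rw [div_eq_mul_inv _ (Complex.I * _), mul_inv, Complex.inv_I]
  field_simp

theorem im_mul_le (ζ z : ℂ) (h : ℝ) (hζ : |ζ.im| ≤ h) :
    |(2 * ζ * z).im| ≤ 2 * |z.im| * |ζ.re| + 2 * h * |z.re| := by
  have : (2 * ζ * z).im = 2 * ζ.re * z.im + 2 * ζ.im * z.re := by simp
  rw [this]
  refine (abs_add_le _ _).trans ?_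
  rw [abs_mul, abs_mul, abs_mul, abs_mul, abs_of_pos (two_pos : (0:ℝ) < 2)]
  have := mul_le_mul_of_nonneg_right hζ (abs_nonneg z.re)
  linarith

theorem trig_bd (f : ℂ → ℂ) (hf : ∀ w, ‖f w‖ ≤ Real.exp |w.im|) (ζ z : ℂ) (h : ℝ) (hζ : |ζ.im| ≤ h) :
    ‖f (2 * ζ * z)‖ ≤ Real.exp (2 * h * |z.re|) * Real.exp (2 * |z.im| * |ζ.re|) := by
  refine (hf _).trans ?_
  rw [← Real.exp_add]
  apply Real.exp_le_exp.mpr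
  linarith [im_mul_le ζ z h hζ]

/-- the value of the derivative integral -/
theorem sinh_fourier {b ε : ℝ} (h : Adm b ε) (z : ℂ) (hz : |z.im| < b⁻¹ / 2) :
    (∫ t : ℝ, Complex.sin (2 * tau ε t * z) / Complex.sinh (tau ε t / b)) * Complex.cosh (Real.pi * b * z) =
      Real.pi * b * Complex.sinh (Real.pi * b * z) := by
  have hb := h.hb
  have hbi : 0 < b⁻¹ := inv_pos.mpr hb
  have hb' : (b:ℂ) ≠ 0 := by exact_mod_cast hb.ne'
  have hπ := Real.pi_pos
  set y := Real.pi * b / 2 with hy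
  have hy0 : 0 < y := by positivity
  have hyπ : b⁻¹ * y < Real.pi := by rw [hy]; field_simp; linarith
  set H := max ε y with hH
  have hH0 : 0 < H := lt_max_of_lt_right hy0
  have hHπ : b⁻¹ * H < Real.pi := by
    rcases max_choice ε y with e | e <;> rw [hH, e]
    · exact h.h2
    · exact hyπ
  set δ := (b⁻¹ - 2 * |z.im|) / 2 with hδ
  have hδ0 : 0 < δ := by rw [hδ]; linarith
  obtain ⟨C, hC, hB⟩ := chi_bound b⁻¹ hbi H hH0 hHπ δ hδ0
  set X : ℂ := Real.pi * b * z with hX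
  set S : ℝ → ℂ := fun t => Complex.sin (2 * t * z) with hS
  set Co : ℝ → ℂ := fun t => Complex.cos (2 * t * z) with hCo
  have iS : Integrable (fun t : ℝ => S t / Complex.cosh (t / b)) := by
    refine cosh_int b hb S (by fun_prop) 1 (2 * |z.im|) (by linarith) fun t => ?_
    have := trig_bd Complex.sin norm_sin_le t z 0 (by simp)
    simpa using this
  have iC : Integrable (fun t : ℝ => Co t / Complex.cosh (t / b)) := by
    refine cosh_int b hb Co (by fun_prop) 1 (2 * |z.im|) (by linarith) fun t => ?_
    have := trig_bd Complex.cos norm_cos_le t z 0 (by simp)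
    simpa using this
  have hS0 : ∫ t : ℝ, S t / Complex.cosh (t / b) = 0 := by
    have h1 := integral_neg_eq_self (fun t : ℝ => S t / Complex.cosh (t / b)) volume
    have h2 : ∀ t : ℝ, S (-t) / Complex.cosh ((-t : ℝ) / b) = -(S t / Complex.cosh (t / b)) := by
      intro t
      simp only [hS]
      push_cast
      rw [show 2 * -(t:ℂ) * z = -(2 * t * z) by ring, Complex.sin_neg, neg_div (b:ℂ) (t:ℂ), Complex.cosh_neg, neg_div]
    simp_rw [h2] at h1
    rw [integral_neg] at h1
    linear_combination (-1/2 : ℂ) * h1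
  set J := ∫ t : ℝ, Co t / Complex.cosh (t / b) with hJ
  -- hyperbolic shift
  have hsh : ∀ t : ℝ, Complex.sinh (((t:ℂ) + y * Complex.I) / b) = Complex.I * Complex.cosh (t / b) := by
    intro t
    have : ((t:ℂ) + y * Complex.I) / b = t / b + (Real.pi / 2) * Complex.I := by
      rw [hy]; push_cast; field_simp
    rw [this, Complex.sinh_add, Complex.cosh_mul_I, Complex.sinh_mul_I, Complex.cos_pi_div_two, Complex.sin_pi_div_two]
    ring
  have hsin : ∀ t : ℝ, Complex.sin (2 * ((t:ℂ) + y * Complex.I) * z) = S t * Complex.cosh X + Complex.I * Co t * Complex.sinh X := by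
    intro t
    have : 2 * ((t:ℂ) + y * Complex.I) * z = 2 * t * z + X * Complex.I := by
      rw [hy, hX]; push_cast; ring
    rw [this, Complex.sin_add, Complex.cos_mul_I, Complex.sin_mul_I]
    simp only [hS, hCo]; ring
  have hcos : ∀ t : ℝ, Complex.cos (2 * ((t:ℂ) + y * Complex.I) * z) = Co t * Complex.cosh X - Complex.I * S t * Complex.sinh X := by
    intro t
    have : 2 * ((t:ℂ) + y * Complex.I) * z = 2 * t * z + X * Complex.I := by
      rw [hy, hX]; push_cast; ring
    rw [this, Complex.cos_add, Complex.cos_mul_I, Complex.sin_mul_I]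
    simp only [hS, hCo]; ring
  have hdchi : ∀ ζ : ℂ, |ζ.im| ≤ H → DifferentiableAt ℂ (chi b⁻¹) ζ := fun ζ hζ => chi_diff b⁻¹ hbi ζ
    (lt_of_le_of_lt (mul_le_mul_of_nonneg_left hζ hbi.le) hHπ)
  have hbdd : ∀ f : ℂ → ℂ, (∀ w, ‖f w‖ ≤ Real.exp |w.im|) → ∀ ζ : ℂ, |ζ.im| ≤ H →
      ‖f (2 * ζ * z) * chi b⁻¹ ζ‖ ≤ Real.exp (2 * H * |z.re|) * C * Real.exp (-δ * |ζ.re|) := by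
    intro f hf ζ hζ
    rw [norm_mul]
    calc _ ≤ (Real.exp (2 * H * |z.re|) * Real.exp (2 * |z.im| * |ζ.re|)) * (C * Real.exp (-(b⁻¹ - δ) * |ζ.re|)) := by
          gcongr
          · exact trig_bd f hf ζ z H hζ
          · exact hB ζ hζ
      _ = Real.exp (2 * H * |z.re|) * C * (Real.exp (2 * |z.im| * |ζ.re|) * Real.exp (-(b⁻¹ - δ) * |ζ.re|)) := by ring
      _ = _ := by
          rw [← Real.exp_add]
          congr 2
          rw [hδ]; ring
  -- first: J
  have hJv : Complex.cosh X * J = Real.pi * b := by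
    have hr := odd_res (fun ζ => Complex.cos (2 * ζ * z) * chi b⁻¹ ζ) y (Real.exp (2 * H * |z.re|) * C) hy0 ?_ ?_ ?_ ?_
    · have e : ∀ t : ℝ, Complex.cos (2 * ((t:ℂ) + y * Complex.I) * z) * chi b⁻¹ ((t:ℂ) + y * Complex.I) / ((t:ℂ) + y * Complex.I) =
          (-Complex.I * Complex.cosh X) * (Co t / Complex.cosh (t / b)) - Complex.sinh X * (S t / Complex.cosh (t / b)) := by
        intro t
        have hn := tau_ne hy0 t
        rw [chi_of_ne _ hn, hcos, Complex.ofReal_inv, inv_mul_eq_div, hsh, alg1 _ _ _ hn]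
        linear_combination (S t * Complex.sinh X / Complex.cosh (t / b)) * Complex.I_sq
      simp_rw [e] at hr
      rw [integral_sub (iC.const_mul _) (iS.const_mul _), integral_const_mul, integral_const_mul, hS0, chi_zero] at hr
      push_cast at hr
      simp only [mul_zero, sub_zero, zero_mul, Complex.cos_zero, one_mul, inv_inv] at hr
      have : Complex.I * (Complex.cosh X * J) = Complex.I * (Real.pi * b) := by
        rw [hJ]; linear_combination (-1:ℂ) * hr
      exact mul_left_cancel₀ Complex.I_ne_zero this
    · intro ζ hζ
      have := hdchi ζ (hζ.trans (le_max_right _ _))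
      fun_prop
    · intro ζ _
      rw [chi_even, show 2 * -ζ * z = -(2 * ζ * z) by ring, Complex.cos_neg]
    · intro ζ hζ
      refine (hbdd Complex.cos norm_cos_le ζ (hζ.trans (le_max_right _ _))).trans ?_
      have : Real.exp (-δ * |ζ.re|) ≤ 1 := by
        rw [Real.exp_le_one_iff, neg_mul]
        have : 0 ≤ δ * |ζ.re| := by positivity
        linarith
      exact mul_le_of_le_one_right (by positivity) this
    · have e : ∀ t : ℝ, Complex.cos (2 * ((t:ℂ) + y * Complex.I) * z) * chi b⁻¹ ((t:ℂ) + y * Complex.I) / ((t:ℂ) + y * Complex.I) =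
          (-Complex.I * Complex.cosh X) * (Co t / Complex.cosh (t / b)) - Complex.sinh X * (S t / Complex.cosh (t / b)) := by
        intro t
        have hn := tau_ne hy0 t
        rw [chi_of_ne _ hn, hcos, Complex.ofReal_inv, inv_mul_eq_div, hsh, alg1 _ _ _ hn]
        linear_combination (S t * Complex.sinh X / Complex.cosh (t / b)) * Complex.I_sq
      simp_rw [e]
      exact (iC.const_mul _).sub (iS.const_mul _)
  -- second: contour shift
  have hpos : ∀ ζ : ℂ, ζ.im ∈ Set.uIcc ε y → min ε y ≤ ζ.im ∧ ζ.im ≤ H := fun ζ hζ => hζ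
  have hmin : 0 < min ε y := lt_min h.hε hy0
  have hshift := contour_shift (fun ζ => Complex.sin (2 * ζ * z) * chi b⁻¹ ζ / ζ) ε y
    (Real.exp (2 * H * |z.re|) * C * (1 + 2 / δ ^ 2) / min ε y) ?_ ?_
  · have e1 : ∀ t : ℝ, Complex.sin (2 * ((t:ℂ) + y * Complex.I) * z) * chi b⁻¹ ((t:ℂ) + y * Complex.I) / ((t:ℂ) + y * Complex.I) =
          (-Complex.I * Complex.cosh X) * (S t / Complex.cosh (t / b)) + Complex.sinh X * (Co t / Complex.cosh (t / b)) := by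
      intro t
      have hn := tau_ne hy0 t
      rw [chi_of_ne _ hn, hsin, Complex.ofReal_inv, inv_mul_eq_div, hsh, alg1 _ _ _ hn]
      linear_combination (-Co t * Complex.sinh X / Complex.cosh (t / b)) * Complex.I_sq
    have e2 : ∀ t : ℝ, Complex.sin (2 * ((t:ℂ) + ε * Complex.I) * z) * chi b⁻¹ ((t:ℂ) + ε * Complex.I) / ((t:ℂ) + ε * Complex.I) =
        Complex.sin (2 * tau ε t * z) / Complex.sinh (tau ε t / b) := by
      intro t
      have hn := tau_ne h.hε t
      rw [chi_of_ne _ hn, Complex.ofReal_inv, inv_mul_eq_div, tau, mul_comm Complex.I]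
      field_simp
    simp_rw [e1, e2] at hshift
    rw [hshift, integral_add (iS.const_mul _) (iC.const_mul _), integral_const_mul, integral_const_mul, hS0, ← hJ]
    linear_combination Complex.sinh X * hJv
  · intro ζ hζ
    obtain ⟨a1, a2⟩ := hpos ζ hζ
    have hz0 : ζ ≠ 0 := by rintro rfl; simp at a1; rcases a1 with a1 | a1 <;> linarith [h.hε]
    have := hdchi ζ (by rw [abs_of_nonneg (by linarith)]; exact a2)
    have h2 : DifferentiableAt ℂ (fun ζ => Complex.sin (2 * ζ * z) * chi b⁻¹ ζ) ζ := by fun_prop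
    exact h2.div differentiableAt_id hz0
  · intro ζ hζ
    obtain ⟨a1, a2⟩ := hpos ζ hζ
    have hζH : |ζ.im| ≤ H := by rw [abs_of_nonneg (by linarith)]; exact a2
    have a3 : min ε y ≤ ‖ζ‖ := by
      have := Complex.abs_im_le_norm ζ
      rw [abs_of_nonneg (by linarith)] at this
      linarith
    rw [norm_div]
    calc _ ≤ (Real.exp (2 * H * |z.re|) * C * Real.exp (-δ * |ζ.re|)) / min ε y := by
          gcongr
          exact hbdd Complex.sin norm_sin_le ζ hζH
      _ ≤ (Real.exp (2 * H * |z.re|) * C * ((1 + 2 / δ ^ 2) * (1 + ζ.re^2)⁻¹)) / min ε y := by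
          gcongr
          exact exp_le_inv_sq hδ0 _
      _ = _ := by ring
end

section
open MeasureTheory Filter Topology

theorem norm_sinh_le (w : ℂ) : ‖Complex.sinh w‖ ≤ Real.exp |w.re| := by
  have := norm_sin_le (w * Complex.I)
  rw [Complex.sin_mul_I, norm_mul, Complex.norm_I, mul_one] at this
  simpa using this

noncomputable def Ew (b ε : ℝ) (z : ℂ) : ℂ :=
  ∫ t, 2 * Complex.cos (2 * tau ε t * z) * Complex.sinh (b * tau ε t) / kerb b ε t

theorem Ew_bd {b ε : ℝ} (h : Adm b ε) (t : ℝ) (z : ℂ) :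
    ‖2 * Complex.cos (2 * tau ε t * z) * Complex.sinh (b * tau ε t)‖ ≤
      2 * Real.exp (2 * ε * |z.re|) * Real.exp ((2 * |z.im| + b) * |t|) := by
  rw [norm_mul, norm_mul, Complex.norm_ofNat]
  have h1 := cos_bd h.hε t z
  have h2 := norm_sinh_le (b * tau ε t)
  have e : ((b:ℂ) * tau ε t).re = b * t := by simp [tau_re]
  rw [e, abs_mul, abs_of_pos h.hb] at h2
  calc _ ≤ 2 * (Real.exp (2 * ε * |z.re|) * Real.exp (2 * |z.im| * |t|)) * Real.exp (b * |t|) := by gcongr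
    _ = _ := by rw [add_mul, Real.exp_add]; ring

theorem Ew_hasDeriv {b ε : ℝ} (h : Adm b ε) (z : ℂ) (hz : |z.im| < b⁻¹ / 2) :
    HasDerivAt (Ew b ε) (-∫ t : ℝ, Complex.sin (2 * tau ε t * z) / Complex.sinh (tau ε t / b)) z := by
  have hε := h.hε
  set r := (b⁻¹ / 2 - |z.im|) / 2 with hr
  have hr0 : 0 < r := by rw [hr]; linarith
  have ht := tau_cont ε
  have key := hol_param (fun z t => 2 * Complex.cos (2 * tau ε t * z) * Complex.sinh (b * tau ε t) / kerb b ε t) z r hr0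
    (fun t => ‖((2 * Real.exp (2 * ε * (|z.re| + r)) * Real.exp ((2 * (|z.im| + r) + b) * |t|) : ℝ) : ℂ) / kerb b ε t‖) ?_ ?_ ?_ ?_
  · refine key.congr_deriv ?_
    rw [← integral_neg]
    refine integral_congr_ae (Eventually.of_forall fun t => ?_)
    have hd : HasDerivAt (fun z => 2 * Complex.cos (2 * tau ε t * z) * Complex.sinh (b * tau ε t) / kerb b ε t)
        (2 * (-Complex.sin (2 * tau ε t * z) * (2 * tau ε t * 1)) * Complex.sinh (b * tau ε t) / kerb b ε t) z :=
      (((((hasDerivAt_id z).const_mul (2 * tau ε t)).ccos).const_mul 2).mul_const _).div_const _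
    simp only
    rw [hd.deriv]
    have hk := kerb_ne h t
    rw [kerb] at hk ⊢
    have k1 := right_ne_zero_of_mul hk
    have k2 := right_ne_zero_of_mul (left_ne_zero_of_mul hk)
    have k3 := right_ne_zero_of_mul (left_ne_zero_of_mul (left_ne_zero_of_mul hk))
    generalize Complex.sinh (tau ε t / (b:ℂ)) = S1 at *
    generalize Complex.sinh ((b:ℂ) * tau ε t) = S2 at *
    field_simp
    ring
  · refine (kerb_int h (fun t => ((2 * Real.exp (2 * ε * (|z.re| + r)) * Real.exp ((2 * (|z.im| + r) + b) * |t|) : ℝ) : ℂ)) (by fun_prop)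
      (2 * Real.exp (2 * ε * (|z.re| + r))) (2 * (|z.im| + r) + b) (by linarith) ?_).norm
    intro t
    rw [Complex.norm_real, Real.norm_eq_abs, abs_of_pos (by positivity)]
  · intro s _
    exact ((by fun_prop : Continuous fun t => 2 * Complex.cos (2 * tau ε t * s) * Complex.sinh (b * tau ε t)).div (kerb_cont b ε) (kerb_ne h)).aestronglyMeasurable
  · intro t
    have : Differentiable ℂ (fun s => 2 * Complex.cos (2 * tau ε t * s) * Complex.sinh (b * tau ε t) / kerb b ε t) := by fun_prop
    exact this.differentiableOn
  · intro s' hs' t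
    rw [norm_div, norm_div]
    refine div_le_div_of_nonneg_right ?_ (norm_nonneg _)
    rw [Complex.norm_real, Real.norm_eq_abs, abs_of_pos (by positivity)]
    refine (Ew_bd h t s').trans ?_
    rw [Metric.mem_ball, dist_eq_norm] at hs'
    have h1 := (Complex.abs_re_le_norm (s' - z)).trans hs'.le
    have h2 := (Complex.abs_im_le_norm (s' - z)).trans hs'.le
    rw [Complex.sub_re] at h1
    rw [Complex.sub_im] at h2
    have h3 : |s'.re| ≤ |z.re| + r := by linarith [abs_sub_abs_le_abs_sub s'.re z.re]
    have h4 : |s'.im| ≤ |z.im| + r := by linarith [abs_sub_abs_le_abs_sub s'.im z.im]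
    gcongr

theorem wb_FE {b ε : ℝ} (h : Adm b ε) :
    ∃ κ : ℂ, κ ≠ 0 ∧ ∀ z : ℂ, |z.im| < b⁻¹ / 2 →
      wb b ε (z + Complex.I * b / 2) = κ * Complex.cosh (Real.pi * b * z) * wb b ε (z - Complex.I * b / 2) := by
  have hb := h.hb
  have hbi : 0 < b⁻¹ := inv_pos.mpr hb
  set U : Set ℂ := {z : ℂ | |z.im| < b⁻¹ / 2} with hU
  have hUo : IsOpen U := isOpen_lt (by fun_prop) (by fun_prop)
  have hUc : IsPreconnected U := by
    have : U = Complex.imCLM ⁻¹' (Set.Ioo (-(b⁻¹/2)) (b⁻¹/2)) := by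
      ext z; simp [hU, abs_lt]
    rw [this]
    exact ((convex_Ioo _ _).linear_preimage Complex.imCLM.toLinearMap).isPreconnected
  have h0U : (0:ℂ) ∈ U := by simp [hU, hbi]
  set g : ℂ → ℂ := fun z => Complex.exp (Ew b ε z) * Complex.cosh (Real.pi * b * z) with hg
  have hgd : ∀ z ∈ U, HasDerivAt g 0 z := by
    intro z hz
    have e1 := (Ew_hasDeriv h z hz).cexp
    have e2 : HasDerivAt (fun z => Complex.cosh (Real.pi * b * z)) (Complex.sinh (Real.pi * b * z) * (Real.pi * b * 1)) z :=
      ((hasDerivAt_id z).const_mul _).ccosh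
    refine (e1.mul e2).congr_deriv ?_
    have := sinh_fourier h z hz
    linear_combination (-Complex.exp (Ew b ε z)) * this
  have hconst : ∀ z ∈ U, g z = g 0 := by
    intro z hz
    exact hUo.is_const_of_deriv_eq_zero hUc (fun z hz => (hgd z hz).differentiableAt.differentiableWithinAt)
      (fun z hz => (hgd z hz).deriv) hz h0U
  have hg0 : g 0 ≠ 0 := by
    simp [hg]
  refine ⟨(g 0)⁻¹, inv_ne_zero hg0, fun z hz => ?_⟩
  have him1 : |(z + Complex.I * b / 2).im| < (b + b⁻¹) / 2 := by
    have : (z + Complex.I * b / 2).im = z.im + b / 2 := by simp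
    rw [this]; rw [abs_lt] at *; constructor <;> linarith
  have him2 : |(z - Complex.I * b / 2).im| < (b + b⁻¹) / 2 := by
    have : (z - Complex.I * b / 2).im = z.im - b / 2 := by simp
    rw [this]; rw [abs_lt] at *; constructor <;> linarith
  have hL : Lw b ε (z + Complex.I * b / 2) - Lw b ε (z - Complex.I * b / 2) = Complex.I * Ew b ε z := by
    rw [Lw, Lw, ← integral_sub (sin_int h _ him1) (sin_int h _ him2), Ew, ← integral_const_mul]
    refine integral_congr_ae (Eventually.of_forall fun t => ?_)
    simp only
    rw [← sub_div, show 2 * tau ε t * (z + Complex.I * b / 2) = 2 * tau ε t * z + (b * tau ε t) * Complex.I by ring,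
      show 2 * tau ε t * (z - Complex.I * b / 2) = 2 * tau ε t * z - (b * tau ε t) * Complex.I by ring,
      Complex.sin_add, Complex.sin_sub, Complex.sin_mul_I]
    ring
  have hc := hconst z hz
  rw [wb_eq h _ him1, wb_eq h _ him2]
  have e3 : Complex.exp (Complex.I * Lw b ε (z + Complex.I * b / 2)) =
     Complex.exp (-Ew b ε z) * Complex.exp (Complex.I * Lw b ε (z - Complex.I * b / 2)) := by
    rw [← Complex.exp_add]
    congr 1
    linear_combination Complex.I * hL + Ew b ε z * Complex.I_sq
  rw [e3, ← hc]
  simp only [hg]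
  have hne : Complex.cosh (Real.pi * b * z) ≠ 0 := by
    intro h0
    simp only [hg] at hc
    rw [h0, mul_zero] at hc
    exact hg0 hc.symm
  rw [Complex.exp_neg]
  have := Complex.exp_ne_zero (Ew b ε z)
  generalize Complex.cosh (Real.pi * b * z) = c at *
  field_simp
end

section
open MeasureTheory Filter Topology

structure QW (b Q : ℝ) (W : ℂ → ℂ) (κ : ℂ) : Prop where
  hb : 0 < b
  hbQ : b ≤ Q / 2
  hbb : b * (Q - b) = 1
  hκ : κ ≠ 0
  diff : ∀ s : ℂ, |s.im| < Q / 2 → DifferentiableAt ℂ W s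
  inv : ∀ s : ℂ, |s.im| < Q / 2 → W s * W (-s) = 1
  pos : ∀ s : ℂ, |s.im| < Q / 2 → ∃ r : ℝ, 0 < r ∧ W s * W (-(starRingEnd ℂ) s) = (r : ℂ)
  bound : ∀ d : ℝ, d < Q / 2 → ∃ C : ℝ, 0 < C ∧ ∀ z : ℂ, |z.im| ≤ d →
    ‖W z‖ ≤ C * Real.exp (Real.pi * z.im * |z.re|) ∧ Real.exp (Real.pi * z.im * |z.re|) ≤ C * ‖W z‖
  FE : ∀ z : ℂ, |z.im| < (Q - b) / 2 →
    W (z + Complex.I * b / 2) = κ * Complex.cosh (Real.pi * b * z) * W (z - Complex.I * b / 2)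

theorem wb_symm (b ε : ℝ) : wb b⁻¹ ε = wb b ε := by
  funext z
  unfold wb
  congr 1
  congr 1
  · push_cast
    rw [inv_inv]; ring
  · refine integral_congr_ae (Eventually.of_forall fun t => ?_)
    simp only [Complex.ofReal_inv]
    congr 1
    rw [div_eq_mul_inv _ ((b:ℂ)⁻¹), inv_inv, div_eq_mul_inv _ (b:ℂ), mul_comm (b:ℂ)⁻¹, mul_comm (b:ℂ)]
    ring

theorem Adm.symm {b ε : ℝ} (h : Adm b ε) : Adm b⁻¹ ε :=
  ⟨inv_pos.mpr h.hb, h.hε, h.h2, by rw [inv_inv]; exact h.h1⟩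

theorem QW_of_le {b ε : ℝ} (h : Adm b ε) (hb1 : b ≤ 1) : ∃ κ, QW b (b + b⁻¹) (wb b ε) κ := by
  obtain ⟨κ, h0, hFE⟩ := wb_FE h
  have hb := h.hb
  have h1 : 1 ≤ b⁻¹ := (one_le_inv₀ hb).mpr hb1
  refine ⟨κ, hb, by linarith, ?_, h0, wb_diff h, wb_inv h, wb_pos h, wb_bound h, fun z hz => hFE z ?_⟩
  · rw [add_sub_cancel_left]; exact mul_inv_cancel₀ hb.ne'
  · simpa using hz

theorem QW_exists {b ε : ℝ} (h : Adm b ε) : ∃ b' κ, QW b' (b + b⁻¹) (wb b ε) κ := by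
  rcases le_total b 1 with h1 | h1
  · exact ⟨b, QW_of_le h h1⟩
  · obtain ⟨κ, hk⟩ := QW_of_le h.symm (inv_le_one_of_one_le₀ h1)
    rw [wb_symm, inv_inv, add_comm] at hk
    exact ⟨_, κ, hk⟩

namespace QW
variable {b Q : ℝ} {W : ℂ → ℂ} {κ : ℂ}

theorem Qpos (h : QW b Q W κ) : 0 < Q := by linarith [h.hb, h.hbQ]

theorem ne (h : QW b Q W κ) (s : ℂ) (hs : |s.im| < Q / 2) : W s ≠ 0 := by
  intro h0
  have := h.inv s hs
  rw [h0, zero_mul] at this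
  exact zero_ne_one this

/-- upper and lower bounds with a base point -/
theorem bd (h : QW b Q W κ) (d R : ℝ) (hd : d < Q / 2) : ∃ C : ℝ, 0 < C ∧ ∀ (x : ℝ) (z : ℂ), |z.im| ≤ d →
    |z.re - x| ≤ R →
    ‖W z‖ ≤ C * Real.exp (Real.pi * z.im * |x|) ∧ Real.exp (Real.pi * z.im * |x|) ≤ C * ‖W z‖ := by
  obtain ⟨C, hC, hb⟩ := h.bound d hd
  refine ⟨C * Real.exp (Real.pi * (Q/2) * |R|), by positivity, fun x z hz hR => ?_⟩
  have hR' : |(|z.re| - |x|)| ≤ |R| := (abs_abs_sub_abs_le _ _).trans (hR.trans (le_abs_self R))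
  have key : |(z.im * |z.re| - z.im * |x|)| ≤ (Q/2) * |R| := by
    rw [← mul_sub, abs_mul]
    apply mul_le_mul (hz.trans hd.le) hR' (abs_nonneg _) (by linarith [h.Qpos])
  rw [abs_le] at key
  have hp := Real.pi_pos
  obtain ⟨h1, h2⟩ := hb z hz
  constructor
  · calc _ ≤ _ := h1
      _ ≤ C * (Real.exp (Real.pi * (Q/2) * |R|) * Real.exp (Real.pi * z.im * |x|)) := by
        rw [← Real.exp_add]; gcongr; nlinarith
      _ = _ := by ring
  · calc Real.exp (Real.pi * z.im * |x|)
      _ ≤ Real.exp (Real.pi * (Q/2) * |R|) * Real.exp (Real.pi * z.im * |z.re|) := by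
        rw [← Real.exp_add]; gcongr; nlinarith
      _ ≤ Real.exp (Real.pi * (Q/2) * |R|) * (C * ‖W z‖) := by gcongr
      _ = _ := by ring

end QW
end

section
open MeasureTheory Filter Topology

section
variable {ι : Type} [Fintype ι]

noncomputable def PP (W : ℂ → ℂ) (σ : ι → ℝ) (a : ι → ℂ) (z : ℂ) : ℂ := ∏ i, W (σ i * z + a i)
noncomputable def JJ (W : ℂ → ℂ) (σ : ι → ℝ) (a : ι → ℂ) : ℂ := ∫ x : ℝ, PP W σ a x

def Good (Q : ℝ) (a : ι → ℂ) : Prop := (∀ i, |(a i).im| < Q / 2) ∧ ∑ i, (a i).im < 0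

theorem JJ_equiv {ι' : Type} [Fintype ι'] (W : ℂ → ℂ) (e : ι' ≃ ι) (σ : ι → ℝ) (a : ι → ℂ) :
    JJ W (σ ∘ e) (a ∘ e) = JJ W σ a := by
  unfold JJ PP
  congr 1; funext x
  exact Equiv.prod_comp e (fun i => W (σ i * x + a i))

variable {b Q : ℝ} {W : ℂ → ℂ} {κ : ℂ}

theorem PP_bd (h : QW b Q W κ) (σ : ι → ℝ) (hσ : ∀ i, |σ i| = 1) (d R : ℝ) (hd : d < Q / 2) :
    ∃ C : ℝ, 0 < C ∧ ∀ a : ι → ℂ, (∀ i, |(a i).im| ≤ d) → (∀ i, |(a i).re| ≤ R) → ∀ x : ℝ,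
      ‖PP W σ a x‖ ≤ C * Real.exp (Real.pi * (∑ i, (a i).im) * |x|) := by
  obtain ⟨C, hC, hb⟩ := h.bd d R hd
  refine ⟨C ^ (Fintype.card ι), by positivity, fun a h1 h2 x => ?_⟩
  unfold PP
  rw [norm_prod]
  calc ∏ i, ‖W (σ i * (x:ℂ) + a i)‖ ≤ ∏ i, (C * Real.exp (Real.pi * (a i).im * |x|)) := by
        apply Finset.prod_le_prod
        · intros; positivity
        · intro i _
          have := (hb (σ i * x) (σ i * (x:ℂ) + a i) (by simpa using h1 i) (by simpa using h2 i)).1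
          rw [abs_mul, hσ i, one_mul] at this
          simpa using this
    _ = _ := by
        rw [Finset.prod_mul_distrib, ← Real.exp_sum, Finset.prod_const, Finset.card_univ]
        congr 2
        rw [Finset.mul_sum, Finset.sum_mul]

theorem PP_diff (h : QW b Q W κ) (σ : ι → ℝ) (a : ι → ℂ) (z : ℂ) (hz : ∀ i, |σ i * z.im + (a i).im| < Q / 2) :
    DifferentiableAt ℂ (PP W σ a) z := by
  unfold PP
  apply DifferentiableAt.fun_finset_prod
  intro i _
  have : DifferentiableAt ℂ W (σ i * z + a i) := h.diff _ (by simpa using hz i)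
  exact DifferentiableAt.comp (f := fun z : ℂ => σ i * z + a i) z this (by fun_prop)

theorem PP_cont (h : QW b Q W κ) (σ : ι → ℝ) (a : ι → ℂ) (ha : ∀ i, |(a i).im| < Q / 2) :
    Continuous (fun x : ℝ => PP W σ a x) := by
  rw [continuous_iff_continuousAt]
  intro x
  have := (PP_diff h σ a (x:ℂ) (by simpa using ha)).continuousAt
  exact ContinuousAt.comp (f := fun x : ℝ => (x:ℂ)) this (by fun_prop)

theorem PP_diff2 (h : QW b Q W κ) (σ : ι → ℝ) (a v : ι → ℂ) (x : ℝ) (s : ℂ)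
    (hs : ∀ i, |((a + s • v) i).im| < Q / 2) :
    DifferentiableAt ℂ (fun s : ℂ => PP W σ (a + s • v) x) s := by
  unfold PP
  apply DifferentiableAt.fun_finset_prod
  intro i _
  have : DifferentiableAt ℂ W (σ i * x + (a + s • v) i) := h.diff _ (by simpa using hs i)
  exact DifferentiableAt.comp (f := fun s : ℂ => σ i * x + (a + s • v) i) s this (by simp)

theorem exists_d {Q : ℝ} (hQ : 0 < Q) (a : ι → ℂ) (ha : ∀ i, |(a i).im| < Q / 2) :
    ∃ d, 0 < d ∧ d < Q / 2 ∧ ∀ i, |(a i).im| < d := by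
  have h1 : ‖fun i => (a i).im‖ < Q / 2 := (pi_norm_lt_iff (by linarith)).mpr (by simpa using ha)
  refine ⟨(‖fun i => (a i).im‖ + Q/2) / 2, by positivity, by linarith, fun i => ?_⟩
  have := norm_le_pi_norm (fun i => (a i).im) i
  rw [Real.norm_eq_abs] at this
  linarith

theorem PP_int (h : QW b Q W κ) (σ : ι → ℝ) (hσ : ∀ i, |σ i| = 1) (a : ι → ℂ) (ha : Good Q a) :
    Integrable (fun x : ℝ => PP W σ a x) := by
  obtain ⟨d, hd0, hd, hda⟩ := exists_d h.Qpos a ha.1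
  obtain ⟨C, hC, hb⟩ := PP_bd h σ hσ d ‖a‖ hd
  have hp := Real.pi_pos
  have hc : 0 < - (Real.pi * (∑ i, (a i).im)) := by nlinarith [ha.2]
  refine ((integrable_exp_abs hc).const_mul C).mono' (PP_cont h σ a ha.1).aestronglyMeasurable
    (Eventually.of_forall fun x => ?_)
  have := hb a (fun i => (hda i).le) (fun i => (Complex.abs_re_le_norm _).trans (norm_le_pi_norm a i)) x
  simpa using this

theorem JJ_diff (h : QW b Q W κ) (σ : ι → ℝ) (hσ : ∀ i, |σ i| = 1) (a v : ι → ℂ) (s0 : ℂ)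
    (ha : Good Q (a + s0 • v)) :
    DifferentiableAt ℂ (fun s : ℂ => JJ W σ (a + s • v)) s0 := by
  obtain ⟨d, hd0, hd, hda⟩ := exists_d h.Qpos _ ha.1
  set S := ∑ i, ((a + s0 • v) i).im with hS
  set R := ‖a + s0 • v‖ + 1 with hR
  obtain ⟨C, hC, hb⟩ := PP_bd h σ hσ d R hd
  have hp := Real.pi_pos
  have hS0 : S < 0 := ha.2
  have hc : 0 < - (Real.pi * (S / 2)) := by nlinarith
  have hcont : Continuous fun s : ℂ => a + s • v := by fun_prop
  have ho : IsOpen {s : ℂ | (∀ i, |((a + s • v) i).im| < d) ∧ ∑ i, ((a + s • v) i).im < S / 2 ∧ ‖a + s • v‖ < R} := by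
    simp only [Set.setOf_and]
    refine IsOpen.inter ?_ (IsOpen.inter ?_ ?_)
    · rw [Set.setOf_forall]
      exact isOpen_iInter_of_finite fun i => isOpen_lt (by simp; fun_prop) continuous_const
    · refine isOpen_lt ?_ continuous_const
      simp; fun_prop
    · exact isOpen_lt (by fun_prop) continuous_const
  obtain ⟨r, hr, hball⟩ := Metric.isOpen_iff.mp ho s0 ⟨hda, by linarith, by linarith⟩
  refine (hol_param (fun s x => PP W σ (a + s • v) x) s0 r hr (fun x => C * Real.exp (-(-(Real.pi * (S/2))) * |x|))
    ((integrable_exp_abs hc).const_mul C) ?_ ?_ ?_).differentiableAt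
  · intro s hs
    exact (PP_cont h σ _ fun i => ((hball hs).1 i).trans hd).aestronglyMeasurable
  · intro x s hs
    exact (PP_diff2 h σ a v x s fun i => ((hball hs).1 i).trans hd).differentiableWithinAt
  · intro s hs x
    obtain ⟨h1, h2, h3⟩ := hball hs
    refine (hb _ (fun i => (h1 i).le) (fun i => ((Complex.abs_re_le_norm _).trans (norm_le_pi_norm _ i)).trans h3.le) x).trans ?_
    gcongr
    have := abs_nonneg x
    rw [neg_neg]
    gcongr

theorem PP_shift (h : QW b Q W κ) (σ : ι → ℝ) (hσ : ∀ i, |σ i| = 1) (hσ0 : ∑ i, σ i = 0) (a : ι → ℂ) (y : ℝ)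
    (hy : 0 < y) (h1 : ∀ i, |(a i).im| + y < Q / 2) (h2 : ∑ i, (a i).im < 0) :
    JJ W σ (fun i => a i + σ i * y * Complex.I) = JJ W σ (fun i => a i - σ i * y * Complex.I) := by
  obtain ⟨d, hd0, hd, hda⟩ := exists_d (Q := Q - 2 * y) (by
    rcases isEmpty_or_nonempty ι with hh | ⟨⟨i⟩⟩
    · simp at h2
    · linarith [h1 i, abs_nonneg (a i).im]) a (fun i => by linarith [h1 i])
  obtain ⟨C, hC, hb⟩ := PP_bd h σ hσ (d + y) ‖a‖ (by linarith)
  have hp := Real.pi_pos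
  set S := ∑ i, (a i).im
  have hc : 0 < - (Real.pi * S) := by nlinarith
  have key : ∀ z : ℂ, z.im ∈ Set.uIcc y (-y) → ∀ i, |σ i * z.im + (a i).im| ≤ d + y := by
    intro z hz i
    rw [Set.uIcc_of_ge (by linarith)] at hz
    have : |σ i * z.im| ≤ y := by rw [abs_mul, hσ i, one_mul]; exact abs_le.mpr hz
    exact (abs_add_le _ _).trans (by linarith [hda i])
  have hPz : ∀ z : ℂ, PP W σ a z = PP W σ (fun i => a i + σ i * z.im * Complex.I) z.re := by
    intro z
    unfold PP
    refine Finset.prod_congr rfl fun i _ => ?_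
    congr 1
    conv_lhs => rw [← Complex.re_add_im z]
    ring
  have := contour_shift (PP W σ a) y (-y) (C * (1 + 2 / (-(Real.pi * S)) ^ 2)) (fun z hz => ?_) (fun z hz => ?_)
  · unfold JJ
    convert this using 3 with x x
    · rw [hPz]; simp
    · rw [hPz]; simp [sub_eq_add_neg]
  · exact PP_diff h σ a z fun i => (key z hz i).trans_lt (by linarith)
  · rw [hPz]
    refine (hb _ (fun i => ?_) (fun i => ?_) _).trans ?_
    · have := key z hz i
      simpa [add_comm] using this
    · simpa using (Complex.abs_re_le_norm _).trans (norm_le_pi_norm a i)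
    · rw [mul_assoc C]
      gcongr
      refine le_trans (le_of_eq ?_) (exp_le_inv_sq hc _)
      congr 1
      simp [Finset.sum_add_distrib, ← Finset.sum_mul, hσ0, S]
end
end

section
open MeasureTheory Filter Topology

theorem trig_id (x a1 a2 a3 b1 b2 b3 : ℂ) (hs : a1 + a2 + a3 + b1 + b2 + b3 = -(2 * Real.pi * Complex.I)) :
    Complex.cosh (x + a1) * Complex.cosh (x + a2) * Complex.cosh (x + a3) -
      Complex.cosh (-x + b1) * Complex.cosh (-x + b2) * Complex.cosh (-x + b3) =
    Complex.cosh (-x + b1) * (Complex.sinh (a1 + b2) * Complex.sinh (a1 + b3)) -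
      Complex.cosh (x + a1) * (Complex.sinh (b1 + a2) * Complex.sinh (b1 + a3)) := by
  have hb3 : Complex.exp b3 = (Complex.exp a1 * Complex.exp a2 * Complex.exp a3 * Complex.exp b1 * Complex.exp b2)⁻¹ := by
    rw [← Complex.exp_add, ← Complex.exp_add, ← Complex.exp_add, ← Complex.exp_add, ← Complex.exp_neg]
    rw [show b3 = -(a1 + a2 + a3 + b1 + b2) - 2 * Real.pi * Complex.I by linear_combination hs,
      Complex.exp_periodic.sub_eq]
  simp only [Complex.cosh, Complex.sinh, neg_add, neg_neg, Complex.exp_add, Complex.exp_neg, hb3]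
  have h0 := Complex.exp_ne_zero x
  have h1 := Complex.exp_ne_zero a1
  have h2 := Complex.exp_ne_zero a2
  have h3 := Complex.exp_ne_zero a3
  have h4 := Complex.exp_ne_zero b1
  have h5 := Complex.exp_ne_zero b2
  generalize Complex.exp x = e0 at *
  generalize Complex.exp a1 = e1 at *
  generalize Complex.exp a2 = e2 at *
  generalize Complex.exp a3 = e3 at *
  generalize Complex.exp b1 = e4 at *
  generalize Complex.exp b2 = e5 at *
  field_simp
  ring

def sg : Fin 3 ⊕ Fin 3 → ℝ := Sum.elim (fun _ => 1) (fun _ => -1)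
def mk6 (a1 a2 a3 b1 b2 b3 : ℂ) : Fin 3 ⊕ Fin 3 → ℂ := Sum.elim ![a1, a2, a3] ![b1, b2, b3]

theorem sg_abs (i) : |sg i| = 1 := by rcases i with i | i <;> simp [sg]
theorem sg_sum : ∑ i, sg i = 0 := by simp [sg]

theorem mk6_eta (P : Fin 3 ⊕ Fin 3 → ℂ) : P = mk6 (P (.inl 0)) (P (.inl 1)) (P (.inl 2)) (P (.inr 0)) (P (.inr 1)) (P (.inr 2)) := by
  funext i
  rcases i with i | i <;> fin_cases i <;> rfl

theorem PP6 (W : ℂ → ℂ) (a1 a2 a3 b1 b2 b3 z : ℂ) :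
    PP W sg (mk6 a1 a2 a3 b1 b2 b3) z =
      W (z + a1) * W (z + a2) * W (z + a3) * (W (-z + b1) * W (-z + b2) * W (-z + b3)) := by
  simp [PP, Fin.prod_univ_three, sg, mk6]

theorem mk6_forall (p : ℂ → Prop) (a1 a2 a3 b1 b2 b3 : ℂ) (h1 : p a1) (h2 : p a2) (h3 : p a3) (h4 : p b1) (h5 : p b2)
    (h6 : p b3) : ∀ i, p (mk6 a1 a2 a3 b1 b2 b3 i) := by
  intro i
  rcases i with i | i <;> fin_cases i <;> assumption

theorem mk6_sum (a1 a2 a3 b1 b2 b3 : ℂ) : ∑ i, (mk6 a1 a2 a3 b1 b2 b3 i).im = a1.im + a2.im + a3.im + b1.im + b2.im + b3.im := by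
  simp [Fin.sum_univ_three, mk6]; ring

theorem mk6_shift (a1 a2 a3 b1 b2 b3 : ℂ) (t : ℂ) :
    (fun i => mk6 a1 a2 a3 b1 b2 b3 i + sg i * t) = mk6 (a1 + t) (a2 + t) (a3 + t) (b1 - t) (b2 - t) (b3 - t) := by
  funext i
  rcases i with i | i <;> fin_cases i <;> simp [mk6, sg, sub_eq_add_neg]

variable {b Q : ℝ} {W : ℂ → ℂ} {κ : ℂ}

theorem tel_int (h : QW b Q W κ) (a1 a2 a3 b1 b2 b3 : ℂ)
    (hs : a1 + a2 + a3 + b1 + b2 + b3 = -(2 * Q * Complex.I))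
    (ha1 : |a1.im| < (Q - b) / 2) (hb1 : |b1.im| < (Q - b) / 2)
    (ha2 : -(Q / 2) < a2.im) (ha2' : a2.im + b < Q / 2) (ha3 : -(Q / 2) < a3.im) (ha3' : a3.im + b < Q / 2)
    (hb2 : -(Q / 2) < b2.im) (hb2' : b2.im + b < Q / 2) (hb3 : -(Q / 2) < b3.im) (hb3' : b3.im + b < Q / 2) :
    Complex.sinh (Real.pi * b * (a1 + b2 + Complex.I * b / 2)) * Complex.sinh (Real.pi * b * (a1 + b3 + Complex.I * b / 2)) *
      JJ W sg (mk6 (a1 - Complex.I * b / 2) a2 a3 (b1 + Complex.I * b / 2) b2 b3) =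
    Complex.sinh (Real.pi * b * (b1 + a2 + Complex.I * b / 2)) * Complex.sinh (Real.pi * b * (b1 + a3 + Complex.I * b / 2)) *
      JJ W sg (mk6 (a1 + Complex.I * b / 2) a2 a3 (b1 - Complex.I * b / 2) b2 b3) := by
  have hb := h.hb
  have hbQ := h.hbQ
  have hsim : a1.im + a2.im + a3.im + b1.im + b2.im + b3.im = -(2 * Q) := by
    have := congrArg Complex.im hs
    simpa using this
  rw [abs_lt] at ha1 hb1
  set t : ℂ := Complex.I * b / 2 with ht
  have htim : t.im = b / 2 := by simp [ht]
  set s1 := Complex.sinh (Real.pi * b * (a1 + b2 + t)) * Complex.sinh (Real.pi * b * (a1 + b3 + t)) with hs1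
  set s2 := Complex.sinh (Real.pi * b * (b1 + a2 + t)) * Complex.sinh (Real.pi * b * (b1 + a3 + t)) with hs2
  have hsh := PP_shift h sg sg_abs sg_sum (mk6 a1 (a2 + t) (a3 + t) b1 (b2 + t) (b3 + t)) (b/2) (by linarith) (by
    apply mk6_forall (fun z => |z.im| + b / 2 < Q / 2) <;> rw [← lt_sub_iff_add_lt, abs_lt] <;>
      (try simp only [Complex.add_im, htim]) <;> constructor <;> linarith) (by
    rw [mk6_sum]; simp only [Complex.add_im, htim]; linarith)
  have e1 : (fun i => mk6 a1 (a2 + t) (a3 + t) b1 (b2 + t) (b3 + t) i + (sg i : ℂ) * ((b/2 : ℝ) : ℂ) * Complex.I) =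
      mk6 (a1 + t) (a2 + t + t) (a3 + t + t) (b1 - t) b2 b3 := by
    have := mk6_shift a1 (a2 + t) (a3 + t) b1 (b2 + t) (b3 + t) t
    rw [add_sub_cancel_right, add_sub_cancel_right] at this
    rw [← this]; funext i; rw [ht]; push_cast; ring
  have e2 : (fun i => mk6 a1 (a2 + t) (a3 + t) b1 (b2 + t) (b3 + t) i - (sg i : ℂ) * ((b/2 : ℝ) : ℂ) * Complex.I) =
      mk6 (a1 - t) a2 a3 (b1 + t) (b2 + t + t) (b3 + t + t) := by
    have := mk6_shift a1 (a2 + t) (a3 + t) b1 (b2 + t) (b3 + t) (-t)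
    simp only [← sub_eq_add_neg, sub_neg_eq_add] at this
    rw [add_sub_cancel_right, add_sub_cancel_right] at this
    rw [← this]; funext i; rw [ht]; push_cast; ring
  rw [e1, e2] at hsh
  have gint : ∀ c1 c2 c3 d1 d2 d3 : ℂ, |c1.im| < Q / 2 → |c2.im| < Q / 2 → |c3.im| < Q / 2 → |d1.im| < Q / 2 →
      |d2.im| < Q / 2 → |d3.im| < Q / 2 → c1.im + c2.im + c3.im + d1.im + d2.im + d3.im < 0 →
      Integrable (fun x : ℝ => PP W sg (mk6 c1 c2 c3 d1 d2 d3) x) := by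
    intro c1 c2 c3 d1 d2 d3 h1 h2 h3 h4 h5 h6 h7
    refine PP_int h sg sg_abs _ ⟨?_, by rwa [mk6_sum]⟩
    exact mk6_forall (fun z => |z.im| < Q / 2) _ _ _ _ _ _ h1 h2 h3 h4 h5 h6
  have i1 := gint (a1 + t) (a2 + t + t) (a3 + t + t) (b1 - t) b2 b3
  have i2 := gint (a1 - t) a2 a3 (b1 + t) (b2 + t + t) (b3 + t + t)
  have i3 := gint (a1 - t) a2 a3 (b1 + t) b2 b3
  have i4 := gint (a1 + t) a2 a3 (b1 - t) b2 b3
  simp only [abs_lt, Complex.add_im, Complex.sub_im, htim] at i1 i2 i3 i4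
  have hrel : ∀ x : ℝ, PP W sg (mk6 (a1 + t) (a2 + t + t) (a3 + t + t) (b1 - t) b2 b3) x -
      PP W sg (mk6 (a1 - t) a2 a3 (b1 + t) (b2 + t + t) (b3 + t + t)) x =
      κ ^ 2 * s1 * PP W sg (mk6 (a1 - t) a2 a3 (b1 + t) b2 b3) x - κ ^ 2 * s2 * PP W sg (mk6 (a1 + t) a2 a3 (b1 - t) b2 b3) x := by
    intro x
    simp only [PP6]
    have f1 := h.FE (x + a1) (by rw [abs_lt]; simp only [Complex.add_im, Complex.ofReal_im]; constructor <;> linarith)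
    have f2 := h.FE (x + a2 + t) (by rw [abs_lt]; simp only [Complex.add_im, Complex.ofReal_im, htim]; constructor <;> linarith)
    have f3 := h.FE (x + a3 + t) (by rw [abs_lt]; simp only [Complex.add_im, Complex.ofReal_im, htim]; constructor <;> linarith)
    have g1 := h.FE (-x + b1) (by rw [abs_lt]; simp only [Complex.add_im, Complex.neg_im, Complex.ofReal_im]; constructor <;> linarith)
    have g2 := h.FE (-x + b2 + t) (by rw [abs_lt]; simp only [Complex.add_im, Complex.neg_im, Complex.ofReal_im, htim]; constructor <;> linarith)
    have g3 := h.FE (-x + b3 + t) (by rw [abs_lt]; simp only [Complex.add_im, Complex.neg_im, Complex.ofReal_im, htim]; constructor <;> linarith)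
    rw [← ht] at f1 f2 f3 g1 g2 g3
    rw [add_sub_cancel_right] at f2 f3 g2 g3
    simp only [← add_assoc, ← add_sub_assoc]
    rw [f1, f2, f3, g1, g2, g3]
    have tr := trig_id (Real.pi * b * x) (Real.pi * b * a1) (Real.pi * b * (a2 + t)) (Real.pi * b * (a3 + t))
      (Real.pi * b * b1) (Real.pi * b * (b2 + t)) (Real.pi * b * (b3 + t)) (by
        have hbb : (b:ℂ) * (Q - b) = 1 := by exact_mod_cast h.hbb
        rw [ht]
        linear_combination (Real.pi * b) * hs - 2 * Real.pi * Complex.I * hbb)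
    simp only [← mul_add, ← mul_neg] at tr
    simp only [← add_assoc] at tr
    rw [hs1, hs2]
    linear_combination κ ^ 3 * W (x + a1 - t) * W (x + a2) * W (x + a3) * W (-x + b1 - t) * W (-x + b2) * W (-x + b3) * tr
  have hint := congrArg (fun f : ℝ → ℂ => ∫ x, f x) (funext hrel)
  rw [integral_sub, integral_sub, integral_const_mul, integral_const_mul] at hint
  · unfold JJ at hsh ⊢
    rw [hsh, sub_self] at hint
    have hk : κ ^ 2 ≠ 0 := pow_ne_zero _ h.hκ
    apply mul_left_cancel₀ hk
    linear_combination -hint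
  · apply Integrable.const_mul
    apply i3 <;> (try constructor) <;> linarith
  · apply Integrable.const_mul
    apply i4 <;> (try constructor) <;> linarith
  · apply i1 <;> (try constructor) <;> linarith
  · apply i2 <;> (try constructor) <;> linarith
end

section
open MeasureTheory Filter Topology

abbrev V6 := Fin 3 ⊕ Fin 3 → ℂ

noncomputable def RR (W : ℂ → ℂ) (Q : ℝ) (P : V6) : ℂ := ∏ i, ∏ j, W (P (.inl i) + P (.inr j) + Complex.I * Q / 2)
noncomputable def FF (W : ℂ → ℂ) (Q : ℝ) (P : V6) : ℂ := JJ W sg P / RR W Q P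

def Om (Q : ℝ) : Set V6 := {P | (∀ i, |(P i).im| < Q / 2) ∧
  ∀ i j, -Q < (P (.inl i)).im + (P (.inr j)).im ∧ (P (.inl i)).im + (P (.inr j)).im < 0}

theorem Om_good {Q : ℝ} {P : V6} (hP : P ∈ Om Q) : Good Q P := by
  refine ⟨hP.1, ?_⟩
  rw [Fintype.sum_sum_type, ← Finset.sum_add_distrib]
  exact Finset.sum_neg (fun i _ => (hP.2 i i).2) ⟨0, Finset.mem_univ _⟩

theorem RR6 (W : ℂ → ℂ) (Q : ℝ) (a1 a2 a3 b1 b2 b3 : ℂ) :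
    RR W Q (mk6 a1 a2 a3 b1 b2 b3) =
      W (a1 + b1 + Complex.I * Q / 2) * W (a1 + b2 + Complex.I * Q / 2) * W (a1 + b3 + Complex.I * Q / 2) *
      (W (a2 + b1 + Complex.I * Q / 2) * W (a2 + b2 + Complex.I * Q / 2) * W (a2 + b3 + Complex.I * Q / 2)) *
      (W (a3 + b1 + Complex.I * Q / 2) * W (a3 + b2 + Complex.I * Q / 2) * W (a3 + b3 + Complex.I * Q / 2)) := by
  simp [RR, Fin.prod_univ_three, mk6]

variable {b Q : ℝ} {W : ℂ → ℂ} {κ : ℂ}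

theorem imQ (z : ℂ) (Q : ℝ) : (z + Complex.I * Q / 2).im = z.im + Q / 2 := by simp

theorem RR_arg {P : V6} (hP : P ∈ Om Q) (i j) : |(P (.inl i) + P (.inr j) + Complex.I * Q / 2).im| < Q / 2 := by
  rw [imQ, Complex.add_im, abs_lt]
  have := hP.2 i j
  constructor <;> linarith

theorem RR_ne (h : QW b Q W κ) {P : V6} (hP : P ∈ Om Q) : RR W Q P ≠ 0 :=
  Finset.prod_ne_zero_iff.mpr fun i _ => Finset.prod_ne_zero_iff.mpr fun j _ => h.ne _ (RR_arg hP i j)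

theorem FF_diff (h : QW b Q W κ) (P v : V6) (s0 : ℂ) (hP : P + s0 • v ∈ Om Q) :
    DifferentiableAt ℂ (fun s : ℂ => FF W Q (P + s • v)) s0 := by
  unfold FF
  refine (JJ_diff h sg sg_abs P v s0 (Om_good hP)).div ?_ (RR_ne h hP)
  unfold RR
  apply DifferentiableAt.fun_finset_prod
  intro i _
  apply DifferentiableAt.fun_finset_prod
  intro j _
  have := h.diff _ (RR_arg hP i j)
  exact DifferentiableAt.comp (f := fun s : ℂ => (P + s • v) (.inl i) + (P + s • v) (.inr j) + Complex.I * Q / 2) s0 this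
    (by simp)

theorem FE_sinh (h : QW b Q W κ) (y : ℂ) (h1 : -Q + b / 2 < y.im) (h2 : y.im < -(b / 2)) :
    W (y + Complex.I * b / 2 + Complex.I * Q / 2) =
      κ * Complex.I * Complex.sinh (Real.pi * b * (y + Complex.I * b / 2)) * W (y - Complex.I * b / 2 + Complex.I * Q / 2) := by
  have := h.FE (y + Complex.I * Q / 2) (by rw [imQ, abs_lt]; constructor <;> linarith)
  have e : Complex.cosh (Real.pi * b * (y + Complex.I * Q / 2)) = Complex.I * Complex.sinh (Real.pi * b * (y + Complex.I * b / 2)) := by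
    have hbb : (b:ℂ) * (Q - b) = 1 := by exact_mod_cast h.hbb
    rw [show Real.pi * b * (y + Complex.I * Q / 2) = Real.pi * b * (y + Complex.I * b / 2) + (Real.pi / 2) * Complex.I by
      linear_combination (Real.pi * Complex.I / 2) * hbb]
    rw [Complex.cosh_add, Complex.cosh_mul_I, Complex.sinh_mul_I, Complex.cos_pi_div_two, Complex.sin_pi_div_two]
    ring
  rw [e] at this
  rw [show y + Complex.I * b / 2 + Complex.I * Q / 2 = y + Complex.I * Q / 2 + Complex.I * b / 2 by ring, this]
  ring_nf

theorem tel_FF (h : QW b Q W κ) (a1 a2 a3 b1 b2 b3 : ℂ)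
    (hs : a1 + a2 + a3 + b1 + b2 + b3 = -(2 * Q * Complex.I))
    (ha1 : |a1.im| < (Q - b) / 2) (hb1 : |b1.im| < (Q - b) / 2)
    (ha2 : -(Q / 2) < a2.im) (ha2' : a2.im + b < Q / 2) (ha3 : -(Q / 2) < a3.im) (ha3' : a3.im + b < Q / 2)
    (hb2 : -(Q / 2) < b2.im) (hb2' : b2.im + b < Q / 2) (hb3 : -(Q / 2) < b3.im) (hb3' : b3.im + b < Q / 2)
    (h12 : -Q + b / 2 < (a1 + b2).im) (h12' : (a1 + b2).im < -(b / 2))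
    (h13 : -Q + b / 2 < (a1 + b3).im) (h13' : (a1 + b3).im < -(b / 2))
    (h21 : -Q + b / 2 < (b1 + a2).im) (h21' : (b1 + a2).im < -(b / 2))
    (h31 : -Q + b / 2 < (b1 + a3).im) (h31' : (b1 + a3).im < -(b / 2))
    (hO1 : mk6 (a1 + Complex.I * b / 2) a2 a3 (b1 - Complex.I * b / 2) b2 b3 ∈ Om Q)
    (hO2 : mk6 (a1 - Complex.I * b / 2) a2 a3 (b1 + Complex.I * b / 2) b2 b3 ∈ Om Q) :
    FF W Q (mk6 (a1 + Complex.I * b / 2) a2 a3 (b1 - Complex.I * b / 2) b2 b3) =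
    FF W Q (mk6 (a1 - Complex.I * b / 2) a2 a3 (b1 + Complex.I * b / 2) b2 b3) := by
  have hti := tel_int h a1 a2 a3 b1 b2 b3 hs ha1 hb1 ha2 ha2' ha3 ha3' hb2 hb2' hb3 hb3'
  have hR1 := RR_ne h hO1
  have hR2 := RR_ne h hO2
  unfold FF
  rw [div_eq_div_iff hR1 hR2]
  have f1 := FE_sinh h _ h12 h12'
  have f2 := FE_sinh h _ h13 h13'
  have g1 := FE_sinh h _ h21 h21'
  have g2 := FE_sinh h _ h31 h31'
  set t : ℂ := Complex.I * b / 2 with ht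
  set q : ℂ := Complex.I * Q / 2 with hq
  generalize JJ W sg (mk6 (a1 + t) a2 a3 (b1 - t) b2 b3) = J1 at *
  generalize JJ W sg (mk6 (a1 - t) a2 a3 (b1 + t) b2 b3) = J2 at *
  rw [RR6, RR6, ← hq]
  rw [show a1 + t + (b1 - t) + q = a1 + b1 + q by ring, show a1 + t + b2 + q = a1 + b2 + t + q by ring,
    show a1 + t + b3 + q = a1 + b3 + t + q by ring, show a2 + (b1 - t) + q = b1 + a2 - t + q by ring,
    show a3 + (b1 - t) + q = b1 + a3 - t + q by ring]
  rw [show a1 - t + (b1 + t) + q = a1 + b1 + q by ring, show a1 - t + b2 + q = a1 + b2 - t + q by ring,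
    show a1 - t + b3 + q = a1 + b3 - t + q by ring, show a2 + (b1 + t) + q = b1 + a2 + t + q by ring,
    show a3 + (b1 + t) + q = b1 + a3 + t + q by ring]
  rw [f1, f2]
  rw [g1, g2]
  linear_combination (-(κ ^ 2 * Complex.I ^ 2 * W (a1 + b1 + q) ^ 1 * W (a1 + b2 - t + q) * W (a1 + b3 - t + q) *
    W (b1 + a2 - t + q) * W (a2 + b2 + q) * W (a2 + b3 + q) * W (b1 + a3 - t + q) * W (a3 + b2 + q) * W (a3 + b3 + q))) * hti
end

section
open MeasureTheory Filter Topology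

theorem per_liouville (f : ℂ → ℂ) (b δ M : ℝ) (hb : 0 < b) (hδ : 0 < δ) (hδb : δ ≤ b / 2)
    (hd : ∀ s : ℂ, |s.im| < b / 2 + δ → DifferentiableAt ℂ f s)
    (hbd : ∀ s : ℂ, |s.im| ≤ b / 2 → ‖f s‖ ≤ M)
    (hp : ∀ s : ℂ, |s.im| < δ → f (s + Complex.I * b / 2) = f (s - Complex.I * b / 2)) :
    ∀ s : ℂ, |s.im| < b / 2 → f s = f 0 := by
  set n : ℂ → ℤ := fun s => round (s.im / b) with hn
  set g : ℂ → ℂ := fun s => f (s - Complex.I * b * n s) with hg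
  have him : ∀ (s : ℂ) (m : ℤ), (s - Complex.I * b * m).im = s.im - b * m := by
    intro s m; simp
  have hnb : ∀ s : ℂ, |s.im - b * n s| ≤ b / 2 := by
    intro s
    have h1 := abs_sub_round (s.im / b)
    have h2 : s.im - b * n s = b * (s.im / b - round (s.im / b)) := by
      field_simp; rfl
    rw [h2, abs_mul, abs_of_pos hb]
    nlinarith
  have key : ∀ (s : ℂ) (m : ℤ), |s.im - b * m| < b / 2 + δ → g s = f (s - Complex.I * b * m) := by
    intro s m hm
    have h1 := hnb s
    simp only [hg]
    generalize n s = k at *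
    rw [abs_lt] at hm
    rw [abs_le] at h1
    have h3 : (m:ℝ) - k < 2 := by
      by_contra hc
      nlinarith
    have h4 : (k:ℝ) - m < 2 := by
      by_contra hc
      nlinarith
    have h3' : m - k < 2 := by exact_mod_cast h3
    have h4' : k - m < 2 := by exact_mod_cast h4
    have : m = k ∨ m = k + 1 ∨ k = m + 1 := by omega
    rcases this with rfl | rfl | rfl
    · rfl
    · have := hp (s - Complex.I * b * k - Complex.I * b / 2) (by
        have : (s - Complex.I * b * k - Complex.I * b / 2).im = s.im - b * k - b / 2 := by simp
        rw [this, abs_lt]; push_cast at hm; constructor <;> linarith)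
      rw [sub_add_cancel] at this
      rw [this]; congr 1; push_cast; ring
    · have := hp (s - Complex.I * b * m - Complex.I * b / 2) (by
        have : (s - Complex.I * b * m - Complex.I * b / 2).im = s.im - b * m - b / 2 := by simp
        rw [this, abs_lt]; push_cast at h1; constructor <;> linarith)
      rw [sub_add_cancel] at this
      rw [this]; congr 1; push_cast; ring
  have hgd : Differentiable ℂ g := by
    intro s0
    have ho : IsOpen {s : ℂ | |s.im - b * n s0| < b / 2 + δ} := isOpen_lt (by fun_prop) (by fun_prop)
    have hmem : s0 ∈ {s : ℂ | |s.im - b * n s0| < b / 2 + δ} := by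
      have := hnb s0
      simp only [Set.mem_setOf_eq]; linarith
    have hev : g =ᶠ[𝓝 s0] fun s => f (s - Complex.I * b * n s0) := by
      filter_upwards [ho.mem_nhds hmem] with s hs using key s _ hs
    refine DifferentiableAt.congr_of_eventuallyEq ?_ hev
    have := hd (s0 - Complex.I * b * n s0) (by rw [him]; exact hmem)
    exact DifferentiableAt.comp (f := fun s : ℂ => s - Complex.I * b * n s0) s0 this (by fun_prop)
  have hgb : Bornology.IsBounded (Set.range g) := by
    rw [isBounded_iff_forall_norm_le]
    refine ⟨M, ?_⟩
    rintro _ ⟨s, rfl⟩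
    exact hbd _ (by rw [him]; exact hnb s)
  intro s hs
  have e1 := key s 0 (by simpa using hs.trans (by linarith))
  have e2 := key 0 0 (by simp; linarith)
  have e3 := hgd.apply_eq_apply_of_bounded hgb s 0
  rw [e1, e2] at e3
  simpa using e3

variable {b Q : ℝ} {W : ℂ → ℂ} {κ : ℂ}

theorem FF_bdd (h : QW b Q W κ) (a1 a2 a3 b1 b2 b3 : ℂ) (c d : ℝ) (hd : d < Q / 2) (hc : 0 ≤ c)
    (hs : a1 + a2 + a3 + b1 + b2 + b3 = -(2 * Q * Complex.I))
    (hO : mk6 a1 a2 a3 b1 b2 b3 ∈ Om Q)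
    (ha1 : |a1.im| + c ≤ d) (hb1 : |b1.im| + c ≤ d)
    (ha2 : |a2.im| ≤ d) (ha3 : |a3.im| ≤ d) (hb2 : |b2.im| ≤ d) (hb3 : |b3.im| ≤ d)
    (h12 : |(a1 + b2 + Complex.I * Q / 2).im| + c ≤ d) (h13 : |(a1 + b3 + Complex.I * Q / 2).im| + c ≤ d)
    (h21 : |(a2 + b1 + Complex.I * Q / 2).im| + c ≤ d) (h31 : |(a3 + b1 + Complex.I * Q / 2).im| + c ≤ d) :
    ∃ M : ℝ, ∀ s : ℂ, |s.im| ≤ c → ‖FF W Q (mk6 (a1 + s) a2 a3 (b1 - s) b2 b3)‖ ≤ M := by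
  have hsim : a1.im + a2.im + a3.im + b1.im + b2.im + b3.im = -(2 * Q) := by
    have := congrArg Complex.im hs
    simpa using this
  have hp := Real.pi_pos
  obtain ⟨C, hC, hB⟩ := h.bd d (|a1.re| + |a2.re| + |a3.re| + |b1.re| + |b2.re| + |b3.re|) hd
  have h11 : -Q < a1.im + b1.im ∧ a1.im + b1.im < 0 := hO.2 0 0
  have hcc : 0 < Real.pi * (2 * Q + 2 * (a1.im + b1.im)) := by nlinarith
  set K := ∫ x : ℝ, Real.exp (-(Real.pi * (2 * Q + 2 * (a1.im + b1.im))) * |x|) with hK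
  set N5 := ‖W (a1 + b1 + Complex.I * Q / 2)‖ * ‖W (a2 + b2 + Complex.I * Q / 2)‖ * ‖W (a2 + b3 + Complex.I * Q / 2)‖ *
    ‖W (a3 + b2 + Complex.I * Q / 2)‖ * ‖W (a3 + b3 + Complex.I * Q / 2)‖ with hN5
  have hN5p : 0 < N5 := by
    have e11 := h.ne _ (RR_arg hO 0 0)
    have e22 := h.ne _ (RR_arg hO 1 1)
    have e23 := h.ne _ (RR_arg hO 1 2)
    have e32 := h.ne _ (RR_arg hO 2 1)
    have e33 := h.ne _ (RR_arg hO 2 2)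
    simp only [mk6, Sum.elim_inl, Sum.elim_inr, Matrix.cons_val_zero, Matrix.cons_val_one, Matrix.cons_val] at e11 e22 e23 e32 e33
    positivity
  refine ⟨C ^ 10 * K / N5, fun s hsc => ?_⟩
  set r := s.re with hr
  set E := Real.exp (Real.pi * (a1.im + b1.im) * |r|) with hE
  have hEp : 0 < E := Real.exp_pos _
  have hJ : ‖JJ W sg (mk6 (a1 + s) a2 a3 (b1 - s) b2 b3)‖ ≤ C ^ 6 * E * K := by
    unfold JJ
    rw [hK, ← integral_const_mul]
    refine norm_integral_le_of_norm_le ((integrable_exp_abs hcc).const_mul _) (Eventually.of_forall fun x => ?_)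
    rw [PP6]
    simp only [norm_mul]
    have A1 := abs_nonneg a1.re
    have A2 := abs_nonneg a2.re
    have A3 := abs_nonneg a3.re
    have B1 := abs_nonneg b1.re
    have B2 := abs_nonneg b2.re
    have B3 := abs_nonneg b3.re
    have w1 := (hB (x + r) (x + (a1 + s)) (by
      simp only [Complex.add_im, Complex.ofReal_im, zero_add]
      exact (abs_add_le _ _).trans (by linarith)) (by
      simp only [Complex.add_re, Complex.ofReal_re]
      rw [show x + (a1.re + s.re) - (x + r) = a1.re by rw [hr]; ring]; linarith)).1
    have w2 := (hB x (x + a2) (by simpa using ha2) (by simp; linarith)).1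
    have w3 := (hB x (x + a3) (by simpa using ha3) (by simp; linarith)).1
    have v1 := (hB (-(x + r)) (-x + (b1 - s)) (by
      simp only [Complex.add_im, Complex.neg_im, Complex.sub_im, Complex.ofReal_im, neg_zero, zero_add]
      exact (abs_sub _ _).trans (by linarith)) (by
      simp only [Complex.add_re, Complex.neg_re, Complex.sub_re, Complex.ofReal_re]
      rw [show -x + (b1.re - s.re) - (-(x + r)) = b1.re by rw [hr]; ring]; linarith)).1
    have v2 := (hB (-x) (-x + b2) (by simpa using hb2) (by simp; linarith)).1
    have v3 := (hB (-x) (-x + b3) (by simpa using hb3) (by simp; linarith)).1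
    rw [abs_neg] at v1 v2 v3
    simp only [Complex.add_im, Complex.neg_im, Complex.sub_im, Complex.ofReal_im, neg_zero, zero_add] at w1 w2 w3 v1 v2 v3
    calc _ ≤ C * Real.exp (Real.pi * (a1.im + s.im) * |x + r|) * (C * Real.exp (Real.pi * a2.im * |x|)) *
          (C * Real.exp (Real.pi * a3.im * |x|)) * (C * Real.exp (Real.pi * (b1.im - s.im) * |x + r|) *
          (C * Real.exp (Real.pi * b2.im * |x|)) * (C * Real.exp (Real.pi * b3.im * |x|))) := by gcongr
      _ = C ^ 6 * Real.exp (Real.pi * (a1.im + b1.im) * |x + r| + Real.pi * (a2.im + a3.im + b2.im + b3.im) * |x|) := by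
        rw [show Real.pi * (a1.im + b1.im) * |x + r| + Real.pi * (a2.im + a3.im + b2.im + b3.im) * |x| =
          Real.pi * (a1.im + s.im) * |x + r| + Real.pi * a2.im * |x| + Real.pi * a3.im * |x| + Real.pi * (b1.im - s.im) * |x + r| +
          Real.pi * b2.im * |x| + Real.pi * b3.im * |x| by ring]
        simp only [Real.exp_add]; ring
      _ ≤ C ^ 6 * (E * Real.exp (-(Real.pi * (2 * Q + 2 * (a1.im + b1.im))) * |x|)) := by
        rw [hE, ← Real.exp_add]
        refine mul_le_mul_of_nonneg_left (Real.exp_le_exp.mpr ?_) (by positivity)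
        have ht : |r| ≤ |x + r| + |x| := by
          have := abs_sub (x + r) x
          rwa [add_sub_cancel_left] at this
        rw [show a2.im + a3.im + b2.im + b3.im = -(2 * Q) - (a1.im + b1.im) by linarith]
        nlinarith [mul_pos hp (neg_pos.mpr h11.2)]
      _ = _ := by ring
  have hE4 : E ≤ C ^ 4 * (‖W (a1 + s + b2 + Complex.I * Q / 2)‖ * ‖W (a1 + s + b3 + Complex.I * Q / 2)‖ *
      ‖W (a2 + (b1 - s) + Complex.I * Q / 2)‖ * ‖W (a3 + (b1 - s) + Complex.I * Q / 2)‖) := by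
    have A1 := abs_nonneg a1.re
    have A2 := abs_nonneg a2.re
    have A3 := abs_nonneg a3.re
    have B1 := abs_nonneg b1.re
    have B2 := abs_nonneg b2.re
    have B3 := abs_nonneg b3.re
    rw [imQ] at h12 h13 h21 h31
    have gen : ∀ p q : ℂ, |p.im + q.im + Q / 2| + c ≤ d → |p.re| + |q.re| ≤ |a1.re| + |a2.re| + |a3.re| + |b1.re| + |b2.re| + |b3.re| →
        ∀ s' : ℂ, |s'.im| ≤ c → |s'.re| = |r| → ∀ z : ℂ, z = p + q + s' + Complex.I * Q / 2 →
        Real.exp (Real.pi * (p.im + q.im + Q / 2 + s'.im) * |r|) ≤ C * ‖W z‖ := by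
      intro p q h1 h2 s' hs' hr' z hz
      have hzim : z.im = p.im + q.im + Q / 2 + s'.im := by rw [hz]; simp; ring
      have hzre : z.re = p.re + q.re + s'.re := by rw [hz]; simp
      have := (hB s'.re z (by rw [hzim]; exact (abs_add_le _ _).trans (by linarith)) (by
        rw [hzre, add_sub_cancel_right]; exact (abs_add_le _ _).trans h2)).2
      rwa [hzim, hr'] at this
    have hns : |(-s).im| ≤ c := by simpa using hsc
    have g1 := gen a1 b2 h12 (by linarith) s hsc rfl _ (show a1 + s + b2 + Complex.I * Q / 2 = _ by ring)
    have g2 := gen a1 b3 h13 (by linarith) s hsc rfl _ (show a1 + s + b3 + Complex.I * Q / 2 = _ by ring)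
    have g3 := gen a2 b1 h21 (by linarith) (-s) hns (by simp [hr]) _ (show a2 + (b1 - s) + Complex.I * Q / 2 = _ by ring)
    have g4 := gen a3 b1 h31 (by linarith) (-s) hns (by simp [hr]) _ (show a3 + (b1 - s) + Complex.I * Q / 2 = _ by ring)
    calc E = Real.exp (Real.pi * (a1.im + b2.im + Q / 2 + s.im) * |r|) * Real.exp (Real.pi * (a1.im + b3.im + Q / 2 + s.im) * |r|) *
          Real.exp (Real.pi * (a2.im + b1.im + Q / 2 + (-s).im) * |r|) * Real.exp (Real.pi * (a3.im + b1.im + Q / 2 + (-s).im) * |r|) := by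
          rw [hE, ← Real.exp_add, ← Real.exp_add, ← Real.exp_add]
          congr 1
          rw [Complex.neg_im]
          linear_combination (-Real.pi * |r|) * hsim
      _ ≤ _ := by
        refine (mul_le_mul (mul_le_mul (mul_le_mul g1 g2 ?_ ?_) g3 ?_ ?_) g4 ?_ ?_).trans (le_of_eq ?_)
        any_goals positivity
        ring
  unfold FF
  rw [RR6, norm_div]
  simp only [norm_mul]
  rw [show a1 + s + (b1 - s) + Complex.I * Q / 2 = a1 + b1 + Complex.I * Q / 2 by ring]
  have hK0 : 0 ≤ K := integral_nonneg fun x => (Real.exp_pos _).le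
  generalize ‖W (a1 + s + b2 + Complex.I * Q / 2)‖ = n1 at *
  generalize ‖W (a1 + s + b3 + Complex.I * Q / 2)‖ = n2 at *
  generalize ‖W (a2 + (b1 - s) + Complex.I * Q / 2)‖ = n3 at *
  generalize ‖W (a3 + (b1 - s) + Complex.I * Q / 2)‖ = n4 at *
  have hN4 : 0 < n1 * n2 * n3 * n4 := by
    have h1 := hEp.trans_le hE4
    exact (mul_pos_iff_of_pos_left (by positivity)).mp h1
  calc _ = ‖JJ W sg (mk6 (a1 + s) a2 a3 (b1 - s) b2 b3)‖ / ((n1 * n2 * n3 * n4) * N5) := by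
        rw [hN5]; congr 1; ring
    _ ≤ (C ^ 6 * (C ^ 4 * (n1 * n2 * n3 * n4)) * K) / ((n1 * n2 * n3 * n4) * N5) := by
        gcongr
        refine hJ.trans ?_
        gcongr
    _ = _ := by
        generalize n1 * n2 * n3 * n4 = m at hN4
        have := hN4.ne'
        field_simp
end

section
open MeasureTheory Filter Topology

variable {b Q : ℝ} {W : ℂ → ℂ} {κ : ℂ}

theorem mk6_Om (a1 a2 a3 b1 b2 b3 : ℂ) (h1 : |a1.im| < Q / 2) (h2 : |a2.im| < Q / 2) (h3 : |a3.im| < Q / 2)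
    (h4 : |b1.im| < Q / 2) (h5 : |b2.im| < Q / 2) (h6 : |b3.im| < Q / 2)
    (h7 : ∀ a ∈ [a1, a2, a3], ∀ b ∈ [b1, b2, b3], -Q < a.im + b.im ∧ a.im + b.im < 0) :
    mk6 a1 a2 a3 b1 b2 b3 ∈ Om Q := by
  refine ⟨mk6_forall (fun z => |z.im| < Q / 2) _ _ _ _ _ _ h1 h2 h3 h4 h5 h6, fun i j => ?_⟩
  apply h7 <;> simp only [mk6, Sum.elim_inl, Sum.elim_inr]
  · fin_cases i <;> simp
  · fin_cases j <;> simp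

def dd : V6 := mk6 1 0 0 (-1) 0 0

theorem mk6_dd (a1 a2 a3 b1 b2 b3 s : ℂ) : mk6 a1 a2 a3 b1 b2 b3 + s • dd = mk6 (a1 + s) a2 a3 (b1 - s) b2 b3 := by
  funext i
  rcases i with i | i <;> fin_cases i <;> simp [mk6, dd, sub_eq_add_neg]

def bal (Q : ℝ) (P : V6) : Prop := ∑ i, P i = -(2 * Q * Complex.I)

def Nr (Q : ℝ) : Set V6 := {P | |(P (.inl 0)).im + Q / 10| < Q / 100 ∧ |(P (.inr 0)).im + Q / 10| < Q / 100 ∧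
  |(P (.inl 1)).im + 9 * Q / 20| < Q / 100 ∧ |(P (.inl 2)).im + 9 * Q / 20| < Q / 100 ∧
  |(P (.inr 1)).im + 9 * Q / 20| < Q / 100 ∧ |(P (.inr 2)).im + 9 * Q / 20| < Q / 100}

theorem Nr_open : IsOpen (Nr Q) := by
  unfold Nr
  simp only [Set.setOf_and]
  refine IsOpen.inter ?_ (IsOpen.inter ?_ (IsOpen.inter ?_ (IsOpen.inter ?_ (IsOpen.inter ?_ ?_))))
  all_goals exact isOpen_lt (by fun_prop) continuous_const

theorem near_const (h : QW b Q W κ) (P : V6) (hP : P ∈ Nr Q) (hbal : bal Q P) (s : ℂ) (hs : |s.im| < b / 2) :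
    FF W Q (P + s • dd) = FF W Q P := by
  have hQ := h.Qpos
  have hb := h.hb
  have hbQ := h.hbQ
  rw [mk6_eta P] at *
  generalize P (.inl 0) = a1 at *
  generalize P (.inl 1) = a2 at *
  generalize P (.inl 2) = a3 at *
  generalize P (.inr 0) = b1 at *
  generalize P (.inr 1) = b2 at *
  generalize P (.inr 2) = b3 at *
  obtain ⟨n1, n4, n2, n3, n5, n6⟩ := hP
  simp only [mk6, Sum.elim_inl, Sum.elim_inr, Matrix.cons_val_zero, Matrix.cons_val_one, Matrix.cons_val] at n1 n2 n3 n4 n5 n6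
  have hbal' : a1 + a2 + a3 + b1 + b2 + b3 = -(2 * Q * Complex.I) := by
    rw [← hbal]
    simp [Fin.sum_univ_three, mk6]; ring
  rw [abs_lt] at n1 n2 n3 n4 n5 n6
  have hOm : ∀ s : ℂ, |s.im| < b / 2 + Q / 100 → mk6 (a1 + s) a2 a3 (b1 - s) b2 b3 ∈ Om Q := by
    intro s hs
    rw [abs_lt] at hs
    apply mk6_Om <;> simp only [Complex.add_im, Complex.sub_im, abs_lt, List.forall_mem_cons, List.not_mem_nil, IsEmpty.forall_iff, implies_true, and_true] <;>
      refine_lift ?_ <;> (try constructorm* _ ∧ _) <;> linarith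
  have hper := per_liouville (fun s => FF W Q (mk6 a1 a2 a3 b1 b2 b3 + s • dd)) b (min (Q / 100) (b / 2))
  obtain ⟨M, hM⟩ := FF_bdd h a1 a2 a3 b1 b2 b3 (b / 2) (47 * Q / 100) (by linarith) (by linarith) hbal'
    (by simpa using hOm 0 (by simp; linarith))
    (by rw [← le_sub_iff_add_le, abs_le]; constructor <;> linarith)
    (by rw [← le_sub_iff_add_le, abs_le]; constructor <;> linarith)
    (by rw [abs_le]; constructor <;> linarith) (by rw [abs_le]; constructor <;> linarith)
    (by rw [abs_le]; constructor <;> linarith) (by rw [abs_le]; constructor <;> linarith)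
    (by rw [imQ, Complex.add_im, ← le_sub_iff_add_le, abs_le]; constructor <;> linarith)
    (by rw [imQ, Complex.add_im, ← le_sub_iff_add_le, abs_le]; constructor <;> linarith)
    (by rw [imQ, Complex.add_im, ← le_sub_iff_add_le, abs_le]; constructor <;> linarith)
    (by rw [imQ, Complex.add_im, ← le_sub_iff_add_le, abs_le]; constructor <;> linarith)
  have := hper M hb (by positivity) (min_le_right _ _) ?_ ?_ ?_ s hs
  · simpa using this
  · intro s hs
    apply FF_diff h
    rw [mk6_dd]
    exact hOm s (hs.trans_le (by gcongr; exact min_le_left _ _))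
  · intro s hs
    simp only [mk6_dd]
    exact hM s hs
  · intro s hs
    have hs' := hs.trans_le (min_le_left _ _)
    rw [abs_lt] at hs'
    simp only [mk6_dd]
    have t1 : (Complex.I * b / 2).im = b / 2 := by simp
    have o1 := hOm (s + Complex.I * b / 2) (by rw [Complex.add_im, t1, abs_lt]; constructor <;> linarith)
    have o2 := hOm (s - Complex.I * b / 2) (by rw [Complex.sub_im, t1, abs_lt]; constructor <;> linarith)
    rw [← add_assoc, ← sub_sub] at o1 ⊢
    rw [← add_sub_assoc, ← sub_add] at o2 ⊢
    apply tel_FF h (a1 + s) a2 a3 (b1 - s) b2 b3 (by linear_combination hbal') <;>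
      (try simp only [Complex.add_im, Complex.sub_im, abs_lt])
    all_goals (try assumption)
    all_goals (try constructor) <;> linarith
end

section
open MeasureTheory Filter Topology

variable {b Q : ℝ} {W : ℂ → ℂ} {κ : ℂ}

theorem Om_open : IsOpen (Om Q) := by
  unfold Om
  simp only [Set.setOf_and, Set.setOf_forall]
  refine IsOpen.inter (isOpen_iInter_of_finite fun i => isOpen_lt (by fun_prop) continuous_const)
    (isOpen_iInter_of_finite fun i => isOpen_iInter_of_finite fun j =>
      IsOpen.inter (isOpen_lt continuous_const (by fun_prop)) (isOpen_lt (by fun_prop) continuous_const))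

theorem Om_convex : Convex ℝ (Om Q) := by
  intro x hx y hy p q hp hq hpq
  have hq' : q = 1 - p := by linarith
  subst hq'
  refine ⟨fun i => ?_, fun i j => ?_⟩
  · have h1 := abs_lt.mp (hx.1 i)
    have h2 := abs_lt.mp (hy.1 i)
    simp only [Pi.add_apply, Pi.smul_apply, Complex.add_im, Complex.smul_im, smul_eq_mul, abs_lt]
    rcases hp.eq_or_lt with rfl | hp'
    · simpa using h2
    · constructor <;> nlinarith
  · have h1 := hx.2 i j
    have h2 := hy.2 i j
    simp only [Pi.add_apply, Pi.smul_apply, Complex.add_im, Complex.smul_im, smul_eq_mul]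
    rcases hp.eq_or_lt with rfl | hp'
    · simpa using h2
    · constructor <;> nlinarith

theorem line_open (P v : V6) : IsOpen {l : ℂ | P + l • v ∈ Om Q} :=
  Om_open.preimage (f := fun l : ℂ => P + l • v) (by fun_prop)

theorem line_convex (P v : V6) : Convex ℝ {l : ℂ | P + l • v ∈ Om Q} := by
  intro x hx y hy p q hp hq hpq
  have := Om_convex hx hy hp hq hpq
  simp only [Set.mem_setOf_eq]
  convert this using 1
  have e : P = p • P + q • P := by rw [← add_smul, hpq, one_smul]
  conv_lhs => rw [e]
  funext i
  simp
  ring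

theorem line_eq (h : QW b Q W κ) (P v P' v' : V6) (h0 : P ∈ Om Q) (h1 : P + v ∈ Om Q)
    (h0' : P' ∈ Om Q) (h1' : P' + v' ∈ Om Q)
    (hev : ∀ᶠ l : ℂ in 𝓝 0, FF W Q (P + l • v) = FF W Q (P' + l • v')) : FF W Q (P + v) = FF W Q (P' + v') := by
  set U : Set ℂ := {l : ℂ | P + l • v ∈ Om Q} ∩ {l : ℂ | P' + l • v' ∈ Om Q} with hU
  have hUo : IsOpen U := (line_open P v).inter (line_open P' v')
  have hUc : IsPreconnected U := ((line_convex P v).inter (line_convex P' v')).isPreconnected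
  have a1 : AnalyticOnNhd ℂ (fun l : ℂ => FF W Q (P + l • v)) U :=
    DifferentiableOn.analyticOnNhd (fun l hl => (FF_diff h P v l hl.1).differentiableWithinAt) hUo
  have a2 : AnalyticOnNhd ℂ (fun l : ℂ => FF W Q (P' + l • v')) U :=
    DifferentiableOn.analyticOnNhd (fun l hl => (FF_diff h P' v' l hl.2).differentiableWithinAt) hUo
  have hz : (0:ℂ) ∈ U := by simp [hU, h0, h0']
  have ho : (1:ℂ) ∈ U := by simp [hU, h1, h1']
  have := a1.eqOn_of_preconnected_of_eventuallyEq a2 hUc hz hev ho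
  simpa using this

noncomputable def Pz (Q : ℝ) : V6 := mk6 (-(Q / 10) * Complex.I) (-(9 * Q / 20) * Complex.I) (-(9 * Q / 20) * Complex.I)
   (-(Q / 10) * Complex.I) (-(9 * Q / 20) * Complex.I) (-(9 * Q / 20) * Complex.I)

theorem Pz_Nr (hQ : 0 < Q) : Pz Q ∈ Nr Q := by
  have e1 : (-((Q:ℂ) / 10) * Complex.I).im = -(Q / 10) := by
    rw [show -((Q:ℂ) / 10) * Complex.I = ((-(Q/10) : ℝ) : ℂ) * Complex.I by push_cast; ring]; simp
  have e2 : (-(9 * (Q:ℂ) / 20) * Complex.I).im = -(9 * Q / 20) := by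
    rw [show -(9 * (Q:ℂ) / 20) * Complex.I = ((-(9 * Q / 20) : ℝ) : ℂ) * Complex.I by push_cast; ring]; simp
  simp only [Nr, Pz, mk6, Set.mem_setOf_eq, Sum.elim_inl, Sum.elim_inr, Matrix.cons_val_zero, Matrix.cons_val_one, Matrix.cons_val, e1, e2]
  simp [hQ]

theorem Pz_Om (hQ : 0 < Q) : Pz Q ∈ Om Q := by
  have e1 : (-((Q:ℂ) / 10) * Complex.I).im = -(Q / 10) := by
    rw [show -((Q:ℂ) / 10) * Complex.I = ((-(Q/10) : ℝ) : ℂ) * Complex.I by push_cast; ring]; simp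
  have e2 : (-(9 * (Q:ℂ) / 20) * Complex.I).im = -(9 * Q / 20) := by
    rw [show -(9 * (Q:ℂ) / 20) * Complex.I = ((-(9 * Q / 20) : ℝ) : ℂ) * Complex.I by push_cast; ring]; simp
  apply mk6_Om <;> simp only [e1, e2, abs_lt, List.forall_mem_cons, List.not_mem_nil, IsEmpty.forall_iff, implies_true, and_true] <;>
      refine_lift ?_ <;> (try constructorm* _ ∧ _) <;> linarith

theorem Pz_bal : bal Q (Pz Q) := by
  simp [bal, Pz, Fin.sum_univ_three, mk6]; ring

theorem bal_add {P v : V6} (hP : bal Q P) (hv : ∑ i, v i = 0) (l : ℂ) : bal Q (P + l • v) := by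
  unfold bal at *
  simp only [Pi.add_apply, Pi.smul_apply, smul_eq_mul, Finset.sum_add_distrib, ← Finset.mul_sum, hv, hP]
  simp

theorem bal_sub {P P' : V6} (hP : bal Q P) (hP' : bal Q P') : ∑ i, (P - P') i = 0 := by
  unfold bal at *
  simp only [Pi.sub_apply, Finset.sum_sub_distrib]
  rw [hP, hP', sub_self]

theorem claim1 (h : QW b Q W κ) (P : V6) (hP : P ∈ Om Q) (hb : bal Q P) (τ : ℂ) (hP' : P + τ • dd ∈ Om Q) :
    FF W Q (P + τ • dd) = FF W Q P := by
  have hQ := h.Qpos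
  have := line_eq h (Pz Q) (P + τ • dd - Pz Q) (Pz Q) (P - Pz Q) (Pz_Om hQ) (by simpa using hP') (Pz_Om hQ) (by simpa using hP) ?_
  · simpa using this
  · have c1 : Continuous fun l : ℂ => Pz Q + l • (P - Pz Q) := by fun_prop
    have c2 : Continuous fun l : ℂ => |(l * τ).im| := by fun_prop
    filter_upwards [c1.continuousAt.preimage_mem_nhds (Nr_open.mem_nhds (by simpa using Pz_Nr hQ)),
      c2.continuousAt.preimage_mem_nhds (Iio_mem_nhds (show |((0:ℂ) * τ).im| < b / 2 by simp [h.hb]))] with l h1 h2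
    have e : Pz Q + l • (P + τ • dd - Pz Q) = (Pz Q + l • (P - Pz Q)) + (l * τ) • dd := by
      rw [mul_smul]; module
    rw [e]
    exact near_const h _ h1 (bal_add Pz_bal (bal_sub hb Pz_bal) l) _ h2

def ee (i j : Fin 3) : Fin 3 ⊕ Fin 3 ≃ Fin 3 ⊕ Fin 3 := Equiv.sumCongr (Equiv.swap 0 i) (Equiv.swap 0 j)

theorem FF_ee (P : V6) (i j : Fin 3) : FF W Q (P ∘ ee i j) = FF W Q P := by
  unfold FF
  congr 1
  · have := JJ_equiv W (ee i j) sg P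
    rwa [show sg ∘ ee i j = sg from ?_] at this
    funext k
    rcases k with k | k <;> simp [sg, ee]
  · unfold RR
    simp only [Function.comp, ee, Equiv.sumCongr_apply, Sum.map_inl, Sum.map_inr]
    rw [Equiv.prod_comp (Equiv.swap 0 i) (fun k => ∏ l, W (P (.inl k) + P (.inr ((Equiv.swap 0 j) l)) + Complex.I * Q / 2))]
    refine Finset.prod_congr rfl fun k _ => ?_
    exact Equiv.prod_comp (Equiv.swap 0 j) (fun l => W (P (.inl k) + P (.inr l) + Complex.I * Q / 2))

theorem Om_ee {P : V6} (hP : P ∈ Om Q) (i j : Fin 3) : P ∘ ee i j ∈ Om Q := by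
  refine ⟨fun k => hP.1 _, fun k l => ?_⟩
  simp only [Function.comp, ee, Equiv.sumCongr_apply, Sum.map_inl, Sum.map_inr]
  exact hP.2 _ _

theorem bal_ee {P : V6} (hP : bal Q P) (i j : Fin 3) : bal Q (P ∘ ee i j) := by
  unfold bal at *
  rw [← hP]
  exact Equiv.sum_comp (ee i j) P

theorem ee_ee (P : V6) (i j : Fin 3) : (P ∘ ee i j) ∘ ee i j = P := by
  funext k
  rcases k with k | k <;> simp [ee]

theorem claim1' (h : QW b Q W κ) (i j : Fin 3) (P : V6) (hP : P ∈ Om Q) (hb : bal Q P) (τ : ℂ)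
    (hP' : P + τ • (dd ∘ ee i j) ∈ Om Q) :
    FF W Q (P + τ • (dd ∘ ee i j)) = FF W Q P := by
  have e : (P + τ • (dd ∘ ee i j)) ∘ ee i j = P ∘ ee i j + τ • dd := by
    conv_rhs => rw [← ee_ee dd i j]
    rfl
  rw [← FF_ee _ i j, ← FF_ee P i j, e]
  apply claim1 h _ (Om_ee hP i j) (bal_ee hb i j)
  rw [← e]
  exact Om_ee hP' i j

theorem dd_sum (i j : Fin 3) : ∑ k, (dd ∘ ee i j) k = 0 := by
  have : ∑ k, (dd ∘ ee i j) k = ∑ k, dd k := Equiv.sum_comp (ee i j) dd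
  rw [this]
  simp [dd, mk6, Fin.sum_univ_three]

theorem claim2 (h : QW b Q W κ) (P P' : V6) (hP : P ∈ Om Q) (hb : bal Q P) (hP' : P' ∈ Om Q) (hb' : bal Q P') :
    FF W Q P' = FF W Q P := by
  have := line_eq h P (P' - P) P 0 hP (by simpa using hP') hP (by simpa using hP) ?_
  · simpa using this
  · have hv := bal_sub hb' hb
    set v := P' - P
    have hv' : v (.inl 0) + v (.inl 1) + v (.inl 2) + v (.inr 0) + v (.inr 1) + v (.inr 2) = 0 := by
      rw [← hv]; simp [Fin.sum_univ_three]; ring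
    set v1 := v (.inl 1) • (dd ∘ ee 1 0) with hv1
    set v2 := v1 + v (.inl 2) • (dd ∘ ee 2 0) with hv2
    set v3 := v2 + (-v (.inr 1)) • (dd ∘ ee 0 1) with hv3
    set v4 := v3 + (-v (.inr 2)) • (dd ∘ ee 0 2) with hv4
    have hv5 : v = v4 + (v (.inl 0) + v (.inr 1) + v (.inr 2)) • (dd ∘ ee 0 0) := by
      rw [hv4, hv3, hv2, hv1]
      funext k
      have s1 : dd (Sum.inl 0) = 1 := rfl
      have s2 : dd (Sum.inl 1) = 0 := rfl
      have s3 : dd (Sum.inl 2) = 0 := rfl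
      have s4 : dd (Sum.inr 0) = -1 := rfl
      have s5 : dd (Sum.inr 1) = 0 := rfl
      have s6 : dd (Sum.inr 2) = 0 := rfl
      rcases k with k | k <;> fin_cases k <;> simp [ee, Equiv.swap_apply_def, s1, s2, s3, s4, s5, s6]
      all_goals first | (ring; done) | linear_combination hv' | linear_combination -hv'
    have sum1 : ∑ k, v1 k = 0 := by
      rw [hv1]; simp only [Pi.smul_apply, smul_eq_mul, ← Finset.mul_sum, dd_sum, mul_zero]
    have sum2 : ∑ k, v2 k = 0 := by
      rw [hv2]; simp only [Pi.add_apply, Pi.smul_apply, smul_eq_mul, ← Finset.mul_sum, Finset.sum_add_distrib, dd_sum, sum1, mul_zero, add_zero]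
    have sum3 : ∑ k, v3 k = 0 := by
      rw [hv3]; simp only [Pi.add_apply, Pi.smul_apply, smul_eq_mul, ← Finset.mul_sum, Finset.sum_add_distrib, dd_sum, sum2, mul_zero, add_zero]
    have sum4 : ∑ k, v4 k = 0 := by
      rw [hv4]; simp only [Pi.add_apply, Pi.smul_apply, smul_eq_mul, ← Finset.mul_sum, Finset.sum_add_distrib, dd_sum, sum3, mul_zero, add_zero]
    have nb : ∀ w : V6, ∀ᶠ l : ℂ in 𝓝 0, P + l • w ∈ Om Q := fun w =>
      (line_open P w).mem_nhds (by simpa using hP)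
    have step : ∀ (l c : ℂ) (w : V6) (i j : Fin 3), ∑ k, w k = 0 → P + l • w ∈ Om Q → P + l • (w + c • (dd ∘ ee i j)) ∈ Om Q →
        FF W Q (P + l • (w + c • (dd ∘ ee i j))) = FF W Q (P + l • w) := by
      intro l c w i j hw h1 h2
      have e : P + l • (w + c • (dd ∘ ee i j)) = (P + l • w) + (l * c) • (dd ∘ ee i j) := by
        rw [mul_smul]; module
      rw [e] at h2 ⊢
      exact claim1' h i j _ h1 (bal_add hb hw l) _ h2
    filter_upwards [nb v1, nb v2, nb v3, nb v4, nb v] with l m1 m2 m3 m4 m5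
    rw [hv5, step l _ v4 0 0 sum4 m4 (by rw [← hv5]; exact m5), hv4, step l _ v3 0 2 sum3 m3 m4,
      hv3, step l _ v2 0 1 sum2 m2 m3, hv2, step l _ v1 2 0 sum1 m1 m2]
    have := step l (v (.inl 1)) 0 1 0 (by simp) (by simpa using hP) (by rw [zero_add]; exact m1)
    rw [zero_add] at this
    rw [hv1, this]
    try simp

theorem FF_const (h : QW b Q W κ) : ∃ k : ℂ, k ≠ 0 ∧ ∀ P ∈ Om Q, bal Q P → FF W Q P = k := by
  have hQ := h.Qpos
  set c : ℂ := -((Q:ℂ) / 3) * Complex.I with hc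
  have hcim : c.im = -(Q/3) := by
    rw [hc, show -((Q:ℂ) / 3) * Complex.I = ((-(Q/3) : ℝ) : ℂ) * Complex.I by push_cast; ring]; simp
  have hcre : c.re = 0 := by
    rw [hc, show -((Q:ℂ) / 3) * Complex.I = ((-(Q/3) : ℝ) : ℂ) * Complex.I by push_cast; ring]; simp
  have hO : mk6 c c c c c c ∈ Om Q := by
    apply mk6_Om <;> simp only [hcim, abs_lt, List.forall_mem_cons, List.not_mem_nil, IsEmpty.forall_iff, implies_true, and_true] <;>
      refine_lift ?_ <;> (try constructorm* _ ∧ _) <;> linarith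
  have hB : bal Q (mk6 c c c c c c) := by
    simp [bal, Fin.sum_univ_three, mk6, hc]; ring
  refine ⟨FF W Q (mk6 c c c c c c), ?_, fun P hP hb => claim2 h _ P hO hB hP hb⟩
  unfold FF
  refine div_ne_zero ?_ (RR_ne h hO)
  have hcast : ∀ x : ℝ, ∃ r : ℝ, 0 < r ∧ PP W sg (mk6 c c c c c c) x = (r:ℂ) := by
    intro x
    obtain ⟨r, hr, e⟩ := h.pos (x + c) (by
      simp only [Complex.add_im, Complex.ofReal_im, hcim, abs_lt]; constructor <;> linarith)
    refine ⟨r ^ 3, by positivity, ?_⟩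
    have ec : -(starRingEnd ℂ) ((x:ℂ) + c) = -x + c := by
      apply Complex.ext <;> simp [hcre]
    rw [ec] at e
    rw [PP6]
    push_cast
    rw [← e]; ring
  choose r hr hre using hcast
  have hint := PP_int h sg sg_abs _ (Om_good hO)
  have hcont := PP_cont h sg _ hO.1
  unfold JJ
  have e : (fun x : ℝ => PP W sg (mk6 c c c c c c) x) = fun x => ((r x : ℝ) : ℂ) := funext hre
  rw [e] at hint hcont ⊢
  rw [integral_complex_ofReal]
  have hi : Integrable r := by
    have := hint.re
    simpa using this
  have hrc : Continuous r := by
    have := Complex.continuous_re.comp hcont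
    simpa [Function.comp_def] using this
  have hpos : 0 < ∫ x, r x := by
    rw [integral_pos_iff_support_of_nonneg (fun x => (hr x).le) hi]
    have : Function.support r = Set.univ := by
      ext x; simp [(hr x).ne']
    rw [this]; simp
  exact_mod_cast hpos.ne'
end

section
open MeasureTheory Filter Topology

variable {b Q : ℝ} {W : ℂ → ℂ} {κ : ℂ}

noncomputable def Dw (W : ℂ → ℂ) (a z : ℂ) : ℂ := W (a + z) * W (a - z)

theorem Dw_even (W : ℂ → ℂ) (a z : ℂ) : Dw W a (-z) = Dw W a z := by
  unfold Dw
  rw [sub_neg_eq_add, ← sub_eq_add_neg, mul_comm]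

theorem Dw_inv (h : QW b Q W κ) (a : ℂ) (ha : |a.im| < Q / 2) (x : ℝ) : Dw W a x * Dw W (-a) x = 1 := by
  unfold Dw
  have h1 := h.inv (a + x) (by simpa using ha)
  have h2 := h.inv (a - x) (by simpa using ha)
  rw [show -a + (x:ℂ) = -(a - x) by ring, show -a - (x:ℂ) = -(a + x) by ring]
  linear_combination h1 + (W (a + x) * W (-(a + x))) * (h2 - 1) - (h1 - 1) + (h1 - 1) - h1 + h1

theorem star_tri (h : QW b Q W κ) : ∃ k : ℂ, k ≠ 0 ∧ ∀ (α β γ : ℂ) (u v w : ℝ),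
    α + β + γ = -(Q * Complex.I) → -(Q / 2) < α.im → α.im < 0 → -(Q / 2) < β.im → β.im < 0 →
    -(Q / 2) < γ.im → γ.im < 0 →
    ∫ x : ℝ, Dw W α (x - u) * Dw W β (x - v) * Dw W γ (x - w) =
      k * (W (2 * α + Complex.I * Q / 2) * W (2 * β + Complex.I * Q / 2) * W (2 * γ + Complex.I * Q / 2)) *
      (Dw W (-(Complex.I * Q / 2) - α) (v - w) * Dw W (-(Complex.I * Q / 2) - β) (u - w) *
        Dw W (-(Complex.I * Q / 2) - γ) (u - v)) := by
  obtain ⟨k, hk, hF⟩ := FF_const h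
  refine ⟨k, hk, fun α β γ u v w hs a1 a2 b1 b2 c1 c2 => ?_⟩
  have hsim : α.im + β.im + γ.im = -Q := by
    have := congrArg Complex.im hs
    simpa using this
  have hO : mk6 (α - u) (β - v) (γ - w) (α + u) (β + v) (γ + w) ∈ Om Q := by
    apply mk6_Om <;> simp only [Complex.add_im, Complex.sub_im, Complex.ofReal_im, abs_lt, List.forall_mem_cons, List.not_mem_nil, IsEmpty.forall_iff, implies_true, and_true] <;>
      refine_lift ?_ <;> (try constructorm* _ ∧ _) <;> linarith
  have hB : bal Q (mk6 (α - u) (β - v) (γ - w) (α + u) (β + v) (γ + w)) := by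
    simp [bal, Fin.sum_univ_three, mk6]; linear_combination 2 * hs
  have := hF _ hO hB
  unfold FF at this
  rw [div_eq_iff (RR_ne h hO), RR6] at this
  have e : JJ W sg (mk6 (α - u) (β - v) (γ - w) (α + u) (β + v) (γ + w)) =
      ∫ x : ℝ, Dw W α (x - u) * Dw W β (x - v) * Dw W γ (x - w) := by
    unfold JJ
    congr 1; funext x
    rw [PP6]
    unfold Dw
    rw [show α + ((x:ℂ) - u) = x + (α - u) by ring, show β + ((x:ℂ) - v) = x + (β - v) by ring,
      show γ + ((x:ℂ) - w) = x + (γ - w) by ring, show α - ((x:ℂ) - u) = -x + (α + u) by ring,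
      show β - ((x:ℂ) - v) = -x + (β + v) by ring, show γ - ((x:ℂ) - w) = -x + (γ + w) by ring]
    ring
  rw [← e, this]
  unfold Dw
  set q := Complex.I * Q / 2 with hq
  have hs' : α + β + γ = - q - q := by rw [hs, hq]; ring
  rw [show -q - α + ((v:ℂ) - w) = γ - w + (β + v) + q by linear_combination -hs',
    show -q - α - ((v:ℂ) - w) = β - v + (γ + w) + q by linear_combination -hs',
    show -q - β + ((u:ℂ) - w) = γ - w + (α + u) + q by linear_combination -hs',
    show -q - β - ((u:ℂ) - w) = α - u + (γ + w) + q by linear_combination -hs',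
    show -q - γ + ((u:ℂ) - v) = β - v + (α + u) + q by linear_combination -hs',
    show -q - γ - ((u:ℂ) - v) = α - u + (β + v) + q by linear_combination -hs',
    show 2 * α + q = α - u + (α + u) + q by ring, show 2 * β + q = β - v + (β + v) + q by ring,
    show 2 * γ + q = γ - w + (γ + w) + q by ring]
  ring

theorem Dw_bd (h : QW b Q W κ) (a : ℂ) (ha : |a.im| < Q / 2) :
    ∃ C : ℝ, 0 < C ∧ ∀ x : ℝ, ‖Dw W a x‖ ≤ C * Real.exp (2 * Real.pi * a.im * |x|) := by
  obtain ⟨C, hC, hB⟩ := h.bd |a.im| |a.re| ha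
  refine ⟨C * C, by positivity, fun x => ?_⟩
  have h1 := (hB x (a + x) (by simp) (by simp)).1
  have h2 := (hB (-x) (a - x) (by simp) (by simp)).1
  unfold Dw
  rw [norm_mul]
  refine (mul_le_mul h1 h2 (norm_nonneg _) (by positivity)).trans (le_of_eq ?_)
  simp only [Complex.add_im, Complex.sub_im, Complex.ofReal_im, add_zero, sub_zero, abs_neg]
  rw [show 2 * Real.pi * a.im * |x| = Real.pi * a.im * |x| + Real.pi * a.im * |x| by ring, Real.exp_add]
  ring

theorem Dw_cont (h : QW b Q W κ) (a : ℂ) (ha : |a.im| < Q / 2) : Continuous fun x : ℝ => Dw W a x := by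
  rw [continuous_iff_continuousAt]
  intro x
  unfold Dw
  have h1 := (h.diff (a + x) (by simpa using ha)).continuousAt
  have h2 := (h.diff (a - x) (by simpa using ha)).continuousAt
  exact (ContinuousAt.comp (f := fun x : ℝ => a + (x:ℂ)) h1 (by fun_prop)).mul
    (ContinuousAt.comp (f := fun x : ℝ => a - (x:ℂ)) h2 (by fun_prop))

theorem Dw_int2 (h : QW b Q W κ) (α β : ℂ) (u v : ℝ) (a1 : -(Q / 2) < α.im) (a2 : α.im < 0) (b1 : -(Q / 2) < β.im)
    (b2 : β.im < 0) : Integrable fun x : ℝ => Dw W α (x - u) * Dw W β (x - v) := by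
  have ha : |α.im| < Q / 2 := by rw [abs_lt]; constructor <;> linarith
  have hb : |β.im| < Q / 2 := by rw [abs_lt]; constructor <;> linarith
  obtain ⟨C, hC, hB⟩ := Dw_bd h α ha
  obtain ⟨C', hC', hB'⟩ := Dw_bd h β hb
  have hp := Real.pi_pos
  have hc : 0 < 2 * Real.pi * -α.im := by nlinarith
  have hi := ((integrable_exp_abs hc).comp_sub_right u).const_mul (C * C')
  have c1 := (Dw_cont h α ha).comp (continuous_sub_right u)
  have c2 := (Dw_cont h β hb).comp (continuous_sub_right v)
  simp only [Function.comp_def, Complex.ofReal_sub] at c1 c2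
  refine hi.mono' (c1.mul c2).aestronglyMeasurable (Eventually.of_forall fun x => ?_)
  have h1 := hB (x - u)
  have h2 := hB' (x - v)
  rw [Complex.ofReal_sub] at h1 h2
  rw [norm_mul]
  have h3 : Real.exp (2 * Real.pi * β.im * |x - v|) ≤ 1 := by
    rw [Real.exp_le_one_iff]
    have := abs_nonneg (x - v)
    have : 2 * Real.pi * β.im ≤ 0 := by nlinarith
    nlinarith
  calc _ ≤ (C * Real.exp (2 * Real.pi * α.im * |x - u|)) * (C' * 1) := by
        refine mul_le_mul h1 (h2.trans ?_) (norm_nonneg _) (by positivity)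
        gcongr
    _ = _ := by
        rw [show 2 * Real.pi * α.im = -(2 * Real.pi * -α.im) by ring]; ring
end

section
open MeasureTheory Filter Topology

variable {b Q : ℝ} {W : ℂ → ℂ} {κ : ℂ}

theorem fubini4 (h : QW b Q W κ) (δ : ℂ) (d1 : -(Q / 2) < δ.im) (d2 : δ.im < 0) (F G : ℝ → ℂ)
    (hF : Integrable F) (hG : Integrable G) :
    ∫ x : ℝ, (∫ y : ℝ, F y * Dw W δ (y - x)) * G x = ∫ y : ℝ, F y * ∫ x : ℝ, Dw W δ (x - y) * G x := by
  have hd : |δ.im| < Q / 2 := by rw [abs_lt]; constructor <;> linarith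
  obtain ⟨C, hC, hB⟩ := Dw_bd h δ hd
  have hc : Continuous fun p : ℝ × ℝ => Dw W δ ((p.2 - p.1 : ℝ) : ℂ) :=
    (Dw_cont h δ hd).comp (continuous_snd.sub continuous_fst)
  have hi : Integrable (fun p : ℝ × ℝ => Dw W δ ((p.2 - p.1 : ℝ) : ℂ) * (G p.1 * F p.2)) (volume.prod volume) := by
    refine Integrable.bdd_mul (c := C) (hG.mul_prod hF) hc.aestronglyMeasurable (Eventually.of_forall fun p => ?_)
    refine (hB _).trans ?_
    refine mul_le_of_le_one_right hC.le ?_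
    rw [Real.exp_le_one_iff]
    have := abs_nonneg (p.2 - p.1)
    have hp := Real.pi_pos
    have : 2 * Real.pi * δ.im ≤ 0 := by nlinarith
    exact mul_nonpos_of_nonpos_of_nonneg this (abs_nonneg _)
  have := integral_integral_swap (f := fun x y : ℝ => Dw W δ ((y - x : ℝ) : ℂ) * (G x * F y)) hi
  calc _ = ∫ x : ℝ, ∫ y : ℝ, Dw W δ ((y - x : ℝ) : ℂ) * (G x * F y) := by
        congr 1; funext x
        rw [← integral_mul_const]
        congr 1; funext y
        push_cast; ring
    _ = _ := by
        rw [this]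
        congr 1; funext y
        rw [← integral_const_mul]
        congr 1; funext x
        rw [← Dw_even W δ (x - y)]
        push_cast
        rw [neg_sub]; ring

theorem D4_nice (h : QW b Q W κ) (α β γ ω : ℂ) (u v w z : ℝ)
    (hs : α + β + γ + ω = -(Q * Complex.I))
    (a1 : -(Q / 2) < α.im) (a2 : α.im < 0) (b1 : -(Q / 2) < β.im) (b2 : β.im < 0)
    (c1 : -(Q / 2) < γ.im) (c2 : γ.im < 0) (o1 : -(Q / 2) < ω.im) (o2 : ω.im < 0)
    (ab : -(Q / 2) < (α + β).im) :
    ∫ x : ℝ, Dw W α (x - u) * Dw W β (x - v) * Dw W γ (x - w) * Dw W ω (x - z) =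
      W (2 * α + Complex.I * Q / 2) * W (2 * β + Complex.I * Q / 2) *
        W (2 * γ + Complex.I * Q / 2) * W (2 * ω + Complex.I * Q / 2) *
      (Dw W (α + β + Complex.I * Q / 2) (u - v) / Dw W (α + β + Complex.I * Q / 2) (w - z)) *
      ∫ x : ℝ, Dw W (-(Complex.I * Q / 2) - α) (x - v) * Dw W (-(Complex.I * Q / 2) - β) (x - u) *
        Dw W (-(Complex.I * Q / 2) - γ) (x - z) * Dw W (-(Complex.I * Q / 2) - ω) (x - w) := by
  obtain ⟨k, hk, hst⟩ := star_tri h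
  have ab2 : (α + β).im < 0 := by simp; linarith
  have hqi : (Complex.I * Q / 2).im = Q / 2 := by
    rw [show Complex.I * Q / 2 = ((Q / 2 : ℝ) : ℂ) * Complex.I by push_cast; ring]; simp
  set q := Complex.I * Q / 2 with hq
  have hs' : α + β + γ + ω = - q - q := by rw [hs, hq]; ring
  have hQq : -(Q * Complex.I : ℂ) = - q - q := by rw [hq]; ring
  have im2 : ∀ a : ℂ, (2 * a + q).im = 2 * a.im + Q / 2 := by intro a; simp [hqi]
  have ims : ∀ a : ℂ, (-q - a).im = -(Q / 2) - a.im := by intro a; simp [hqi]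
  have hQ := h.Qpos
  have key := fubini4 h (α + β) ab ab2 (fun y : ℝ => Dw W (-q - β) (y - u) * Dw W (-q - α) (y - v))
    (fun x : ℝ => Dw W γ (x - w) * Dw W ω (x - z))
    (Dw_int2 h _ _ u v (by rw [ims]; linarith) (by rw [ims]; linarith) (by rw [ims]; linarith) (by rw [ims]; linarith))
    (Dw_int2 h _ _ w z c1 c2 o1 o2)
  have e1 : ∀ x : ℝ, ∫ y : ℝ, Dw W (-q - β) (y - u) * Dw W (-q - α) (y - v) * Dw W (α + β) (y - x) =
      k * (W (-(2 * β + q)) * W (-(2 * α + q)) * W (2 * (α + β) + q)) *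
        (Dw W β (x - v) * Dw W α (x - u) * Dw W (-(α + β + q)) (u - v)) := by
    intro x
    rw [hst (-q - β) (-q - α) (α + β) u v x (by rw [hQq]; ring) (by rw [ims]; linarith) (by rw [ims]; linarith)
      (by rw [ims]; linarith) (by rw [ims]; linarith) ab ab2]
    rw [← Dw_even W _ ((v:ℂ) - x), ← Dw_even W _ ((u:ℂ) - x)]
    rw [show 2 * (-q - β) + q = -(2 * β + q) by ring, show 2 * (-q - α) + q = -(2 * α + q) by ring,
      show -q - (-q - β) = β by ring, show -q - (-q - α) = α by ring, show -q - (α + β) = -(α + β + q) by ring,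
      neg_sub, neg_sub]
  have e2 : ∀ y : ℝ, ∫ x : ℝ, Dw W (α + β) (x - y) * (Dw W γ (x - w) * Dw W ω (x - z)) =
      k * (W (2 * (α + β) + q) * W (2 * γ + q) * W (2 * ω + q)) *
        (Dw W (-(α + β + q)) (w - z) * Dw W (-q - γ) (y - z) * Dw W (-q - ω) (y - w)) := by
    intro y
    have := hst (α + β) γ ω y w z (by rw [hQq, ← hs']) ab ab2 c1 c2 o1 o2
    rw [show -q - (α + β) = -(α + β + q) by ring] at this
    rw [← this]
    congr 1; funext x; ring
  simp only [e1, e2] at key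
  have e3 : ∀ x : ℝ, k * (W (-(2 * β + q)) * W (-(2 * α + q)) * W (2 * (α + β) + q)) *
        (Dw W β (x - v) * Dw W α (x - u) * Dw W (-(α + β + q)) (u - v)) * (Dw W γ (x - w) * Dw W ω (x - z)) =
      (k * (W (-(2 * β + q)) * W (-(2 * α + q)) * W (2 * (α + β) + q)) * Dw W (-(α + β + q)) (u - v)) *
        (Dw W α (x - u) * Dw W β (x - v) * Dw W γ (x - w) * Dw W ω (x - z)) := by intro x; ring
  have e4 : ∀ x : ℝ, Dw W (-q - β) (x - u) * Dw W (-q - α) (x - v) *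
      (k * (W (2 * (α + β) + q) * W (2 * γ + q) * W (2 * ω + q)) *
        (Dw W (-(α + β + q)) (w - z) * Dw W (-q - γ) (x - z) * Dw W (-q - ω) (x - w))) =
      (k * (W (2 * (α + β) + q) * W (2 * γ + q) * W (2 * ω + q)) * Dw W (-(α + β + q)) (w - z)) *
      (Dw W (-q - α) (x - v) * Dw W (-q - β) (x - u) * Dw W (-q - γ) (x - z) * Dw W (-q - ω) (x - w)) := by
    intro x; ring
  simp only [e3, e4] at key
  rw [integral_const_mul, integral_const_mul] at key
  have hx : W (2 * (α + β) + q) ≠ 0 := h.ne _ (by rw [im2, abs_lt]; constructor <;> linarith)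
  have iα := h.inv (2 * α + q) (by rw [im2, abs_lt]; constructor <;> linarith)
  have iβ := h.inv (2 * β + q) (by rw [im2, abs_lt]; constructor <;> linarith)
  have hdd : |(α + β + q).im| < Q / 2 := by
    rw [Complex.add_im, hqi, abs_lt]; constructor <;> linarith
  have d1 := Dw_inv h (α + β + q) hdd (u - v)
  have d2 := Dw_inv h (α + β + q) hdd (w - z)
  rw [Complex.ofReal_sub] at d1 d2
  generalize (∫ x : ℝ, Dw W α (x - u) * Dw W β (x - v) * Dw W γ (x - w) * Dw W ω (x - z)) = J1 at *
  generalize (∫ x : ℝ, Dw W (-q - α) (x - v) * Dw W (-q - β) (x - u) * Dw W (-q - γ) (x - z) * Dw W (-q - ω) (x - w)) = J2 at *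
  generalize Dw W (-(α + β + q)) (u - v) = A at *
  generalize Dw W (-(α + β + q)) (w - z) = B at *
  generalize Dw W (α + β + q) (u - v) = A' at *
  generalize Dw W (α + β + q) (w - z) = B' at *
  have hB' : B' ≠ 0 := by rintro rfl; simp at d2
  have hBi : B = B'⁻¹ := eq_inv_of_mul_eq_one_right d2
  generalize W (-(2 * α + q)) = wa at *
  generalize W (-(2 * β + q)) = wbb at *
  generalize W (2 * α + q) = wa' at *
  generalize W (2 * β + q) = wbb' at *
  generalize W (2 * γ + q) = wc at *
  generalize W (2 * ω + q) = wo at *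
  generalize W (2 * (α + β) + q) = X at *
  have hkX : k * X ≠ 0 := mul_ne_zero hk hx
  have key2 : wbb * wa * A * J1 = wc * wo * B * J2 := by
    apply mul_left_cancel₀ hkX
    linear_combination key
  rw [div_eq_mul_inv, ← hBi]
  have t : (wa' * wa) * (wbb' * wbb) * (A' * A) * J1 = wa' * wbb' * A' * (wc * wo * B * J2) := by
    rw [← key2]; ring
  rw [iα, iβ, d1] at t
  linear_combination t
end

section
open MeasureTheory Filter Topology

variable {b Q : ℝ} {W : ℂ → ℂ} {κ : ℂ}

def sg8 : Fin 4 ⊕ Fin 4 → ℝ := Sum.elim (fun _ => 1) (fun _ => -1)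
noncomputable def mk8 (α β γ ω u v w z : ℂ) : Fin 4 ⊕ Fin 4 → ℂ :=
  Sum.elim ![α - u, β - v, γ - w, ω - z] ![α + u, β + v, γ + w, ω + z]
def dir8 : Fin 4 ⊕ Fin 4 → ℂ := Sum.elim ![1, 0, -1, 0] ![1, 0, -1, 0]

theorem sg8_abs (i) : |sg8 i| = 1 := by rcases i with i | i <;> simp [sg8]

theorem PP8 (α β γ ω : ℂ) (u v w z : ℂ) (x : ℂ) : PP W sg8 (mk8 α β γ ω u v w z) x =
    Dw W α (x - u) * Dw W β (x - v) * Dw W γ (x - w) * Dw W ω (x - z) := by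
  unfold PP Dw
  rw [Fintype.prod_sum_type, Fin.prod_univ_four, Fin.prod_univ_four]
  simp only [sg8, mk8, Sum.elim_inl, Sum.elim_inr, Matrix.cons_val_zero, Matrix.cons_val_one, Matrix.cons_val,
    Complex.ofReal_one, Complex.ofReal_neg]
  rw [show α + ((x:ℂ) - u) = 1 * x + (α - u) by ring, show β + ((x:ℂ) - v) = 1 * x + (β - v) by ring,
      show γ + ((x:ℂ) - w) = 1 * x + (γ - w) by ring, show ω + ((x:ℂ) - z) = 1 * x + (ω - z) by ring,
      show α - ((x:ℂ) - u) = -1 * x + (α + u) by ring,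
      show β - ((x:ℂ) - v) = -1 * x + (β + v) by ring, show γ - ((x:ℂ) - w) = -1 * x + (γ + w) by ring,
      show ω - ((x:ℂ) - z) = -1 * x + (ω + z) by ring]
  ring

theorem Good8 (α β γ ω : ℂ) (u v w z : ℝ)
    (a1 : -(Q / 2) < α.im) (a2 : α.im < 0) (b1 : -(Q / 2) < β.im) (b2 : β.im < 0)
    (c1 : -(Q / 2) < γ.im) (c2 : γ.im < 0) (o1 : -(Q / 2) < ω.im) (o2 : ω.im < 0) :
    Good Q (mk8 α β γ ω u v w z) := by
  have A : |α.im| < Q / 2 := by rw [abs_lt]; constructor <;> linarith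
  have B : |β.im| < Q / 2 := by rw [abs_lt]; constructor <;> linarith
  have C : |γ.im| < Q / 2 := by rw [abs_lt]; constructor <;> linarith
  have O : |ω.im| < Q / 2 := by rw [abs_lt]; constructor <;> linarith
  refine ⟨?_, ?_⟩
  · rintro (i | i) <;> fin_cases i <;> simpa [mk8]
  · rw [Fintype.sum_sum_type, Fin.sum_univ_four, Fin.sum_univ_four]
    simp [mk8]
    linarith

theorem mk8_line (α β γ ω u v w z s : ℂ) :
    mk8 α β γ ω u v w z + s • dir8 = mk8 (α + s) β (γ - s) ω u v w z := by
  funext i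
  rcases i with i | i <;> fin_cases i <;> simp [mk8, dir8] <;> ring

theorem D4_int (h : QW b Q W κ) (α β γ ω : ℂ) (u v w z : ℝ)
    (a1 : -(Q / 2) < α.im) (a2 : α.im < 0) (b1 : -(Q / 2) < β.im) (b2 : β.im < 0)
    (c1 : -(Q / 2) < γ.im) (c2 : γ.im < 0) (o1 : -(Q / 2) < ω.im) (o2 : ω.im < 0) :
    Integrable fun x : ℝ => Dw W α (x - u) * Dw W β (x - v) * Dw W γ (x - w) * Dw W ω (x - z) := by
  have := PP_int h sg8 sg8_abs _ (Good8 α β γ ω u v w z a1 a2 b1 b2 c1 c2 o1 o2)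
  simpa only [PP8] using this

theorem D4_diff (h : QW b Q W κ) (α β γ ω : ℂ) (u v w z : ℝ) (s : ℂ)
    (a1 : -(Q / 2) < (α + s).im) (a2 : (α + s).im < 0) (b1 : -(Q / 2) < β.im) (b2 : β.im < 0)
    (c1 : -(Q / 2) < (γ - s).im) (c2 : (γ - s).im < 0) (o1 : -(Q / 2) < ω.im) (o2 : ω.im < 0) :
    DifferentiableAt ℂ (fun s : ℂ => ∫ x : ℝ, Dw W (α + s) (x - u) * Dw W β (x - v) * Dw W (γ - s) (x - w) * Dw W ω (x - z)) s := by
  have := JJ_diff h sg8 sg8_abs (mk8 α β γ ω u v w z) dir8 s (by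
    rw [mk8_line]; exact Good8 _ β _ ω u v w z a1 a2 b1 b2 c1 c2 o1 o2)
  simpa only [mk8_line, JJ, PP8] using this

theorem D4_gen (h : QW b Q W κ) (α β γ ω : ℂ) (u v w z : ℝ)
    (hs : α + β + γ + ω = -(Q * Complex.I))
    (a1 : -(Q / 2) < α.im) (a2 : α.im < 0) (b1 : -(Q / 2) < β.im) (b2 : β.im < 0)
    (c1 : -(Q / 2) < γ.im) (c2 : γ.im < 0) (o1 : -(Q / 2) < ω.im) (o2 : ω.im < 0) :
    ∫ x : ℝ, Dw W α (x - u) * Dw W β (x - v) * Dw W γ (x - w) * Dw W ω (x - z) =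
      W (2 * α + Complex.I * Q / 2) * W (2 * β + Complex.I * Q / 2) *
        W (2 * γ + Complex.I * Q / 2) * W (2 * ω + Complex.I * Q / 2) *
      (Dw W (α + β + Complex.I * Q / 2) (u - v) / Dw W (α + β + Complex.I * Q / 2) (w - z)) *
      ∫ x : ℝ, Dw W (-(Complex.I * Q / 2) - α) (x - v) * Dw W (-(Complex.I * Q / 2) - β) (x - u) *
        Dw W (-(Complex.I * Q / 2) - γ) (x - z) * Dw W (-(Complex.I * Q / 2) - ω) (x - w) := by
  have hsim : α.im + β.im + γ.im + ω.im = -Q := by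
    have := congrArg Complex.im hs
    simpa using this
  have hQ := h.Qpos
  have nice := fun s : ℂ => D4_nice h (α + s) β (γ - s) ω u v w z (by rw [← hs]; ring)
  have hqi : (Complex.I * Q / 2).im = Q / 2 := by
    rw [show Complex.I * Q / 2 = ((Q / 2 : ℝ) : ℂ) * Complex.I by push_cast; ring]; simp
  set q := Complex.I * Q / 2 with hq
  set U : Set ℂ := {s | -(Q / 2) < (α + s).im} ∩ {s | (α + s).im < 0} ∩ ({s | -(Q / 2) < (γ - s).im} ∩ {s | (γ - s).im < 0}) with hU
  have im1 : ∀ s, (α + s).im = α.im + s.im := fun s => by simp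
  have im2 : ∀ s, (γ - s).im = γ.im - s.im := fun s => by simp
  have hUo : IsOpen U := by
    refine ((isOpen_lt ?_ ?_).inter (isOpen_lt ?_ ?_)).inter ((isOpen_lt ?_ ?_).inter (isOpen_lt ?_ ?_)) <;> fun_prop
  have hUe : U = Complex.imLm ⁻¹' (Set.Ioo (max (-(Q/2) - α.im) γ.im) (min (-α.im) (γ.im + Q/2))) := by
    ext s
    simp only [hU, Set.mem_inter_iff, Set.mem_setOf_eq, im1, im2, Set.mem_preimage, Complex.imLm_coe, Set.mem_Ioo, max_lt_iff, lt_min_iff]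
    constructor
    · rintro ⟨⟨_, _⟩, _, _⟩; refine ⟨⟨?_, ?_⟩, ?_, ?_⟩ <;> linarith
    · rintro ⟨⟨_, _⟩, _, _⟩; refine ⟨⟨?_, ?_⟩, ?_, ?_⟩ <;> linarith
  have hUc : IsPreconnected U := by
    rw [hUe]
    exact ((convex_Ioo _ _).linear_preimage Complex.imLm).isPreconnected
  have hWd : ∀ (a : ℂ) (f : ℂ → ℂ) (s : ℂ), Differentiable ℂ f → |(f s).im| < Q / 2 → DifferentiableAt ℂ (fun s => W (f s)) s :=
    fun a f s hf hs => DifferentiableAt.comp s (h.diff (f s) hs) (hf s)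
  have A1 : AnalyticOnNhd ℂ (fun s : ℂ => ∫ x : ℝ, Dw W (α + s) (x - u) * Dw W β (x - v) * Dw W (γ - s) (x - w) * Dw W ω (x - z)) U :=
    DifferentiableOn.analyticOnNhd (fun s hs => (D4_diff h α β γ ω u v w z s hs.1.1 hs.1.2 b1 b2 hs.2.1 hs.2.2 o1 o2).differentiableWithinAt) hUo
  have A2 : AnalyticOnNhd ℂ (fun s : ℂ => W (2 * (α + s) + q) * W (2 * β + q) * W (2 * (γ - s) + q) * W (2 * ω + q) *
      (Dw W (α + s + β + q) (u - v) / Dw W (α + s + β + q) (w - z)) *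
      ∫ x : ℝ, Dw W (-q - (α + s)) (x - v) * Dw W (-q - β) (x - u) *
        Dw W (-q - (γ - s)) (x - z) * Dw W (-q - ω) (x - w)) U := by
    refine DifferentiableOn.analyticOnNhd (fun s hs => DifferentiableAt.differentiableWithinAt ?_) hUo
    obtain ⟨⟨s1, s2⟩, s3, s4⟩ := hs
    simp only [Set.mem_setOf_eq, im1, im2] at s1 s2 s3 s4
    have D1 : DifferentiableAt ℂ (fun s => W (2 * (α + s) + q)) s := hWd 0 _ s (by fun_prop) (by
      rw [abs_lt]; simp [hqi]; constructor <;> linarith)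
    have D2 : DifferentiableAt ℂ (fun s => W (2 * (γ - s) + q)) s := hWd 0 _ s (by fun_prop) (by
      rw [abs_lt]; simp [hqi]; constructor <;> linarith)
    have him : |(α + s + β + q).im| < Q / 2 := by
      rw [abs_lt]; simp [hqi]; constructor <;> linarith
    have D3 : ∀ y : ℝ, DifferentiableAt ℂ (fun s => Dw W (α + s + β + q) y) s := by
      intro y
      unfold Dw
      exact (hWd 0 _ s (by fun_prop) (by simpa using him)).mul (hWd 0 _ s (by fun_prop) (by simpa using him))
    have D3u := D3 (u - v)
    have D3w := D3 (w - z)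
    have hne : Dw W (α + s + β + q) ((w - z : ℝ) : ℂ) ≠ 0 := left_ne_zero_of_mul_eq_one (Dw_inv h _ him (w - z))
    rw [Complex.ofReal_sub] at hne D3u D3w
    have D4 := D4_diff h (-q - γ) (-q - ω) (-q - α) (-q - β) z w v u s
      (by simp [hqi]; linarith) (by simp [hqi]; linarith) (by simp [hqi]; linarith) (by simp [hqi]; linarith)
      (by simp [hqi]; linarith) (by simp [hqi]; linarith) (by simp [hqi]; linarith) (by simp [hqi]; linarith)
    have e : (fun s : ℂ => ∫ x : ℝ, Dw W (-q - (α + s)) (x - v) * Dw W (-q - β) (x - u) *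
        Dw W (-q - (γ - s)) (x - z) * Dw W (-q - ω) (x - w)) = (fun s : ℂ => ∫ x : ℝ, Dw W (-q - γ + s) (x - z) * Dw W (-q - ω) (x - w) * Dw W (-q - α - s) (x - v) * Dw W (-q - β) (x - u)) := by
      funext s
      congr 1; funext x
      rw [show -q - γ + s = -q - (γ - s) by ring, show -q - α - s = -q - (α + s) by ring]
      ring
    rw [← e] at D4
    exact ((((D1.mul_const _).mul D2).mul_const _).mul (D3u.div D3w hne)).mul D4
  obtain ⟨t, ht1, ht2⟩ := exists_between (show max (max (-(Q/2) - α.im) γ.im) (-(Q/2) - α.im - β.im) < min (-α.im) (γ.im + Q/2) by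
    simp only [max_lt_iff, lt_min_iff]
    (constructorm* _ ∧ _) <;> linarith)
  rw [max_lt_iff] at ht1
  have htU : (t * Complex.I : ℂ) ∈ U := by
    rw [hUe]; simp only [Set.mem_preimage, Complex.imLm_coe]
    simpa using ⟨max_lt_iff.mp ht1.1, lt_min_iff.mp ht2⟩
  have h0 : (0 : ℂ) ∈ U := by
    simp only [hU, Set.mem_inter_iff, Set.mem_setOf_eq, add_zero, sub_zero]
    exact ⟨⟨a1, a2⟩, c1, c2⟩
  have hO : IsOpen {s : ℂ | -(Q / 2) < (α + s + β).im} := isOpen_lt (by fun_prop) (by fun_prop)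
  have := A1.eqOn_of_preconnected_of_eventuallyEq A2 hUc htU ?_ h0
  · simpa only [add_zero, sub_zero] using this
  · filter_upwards [hUo.mem_nhds htU, hO.mem_nhds (show -(Q / 2) < (α + t * Complex.I + β).im by
      simp; linarith [ht1.2])] with s hs hs2
    exact nice s hs.1.1 hs.1.2 b1 b2 hs.2.1 hs.2.2 o1 o2 hs2
end

/-- The four-factor integral identity
(identity `(D4)` of the paper). -/
theorem Dfun_four_factor_identity (b ε : ℝ) (hb : 0 < b) (hε0 : 0 < ε)
    (hε : ε < Real.pi * min b b⁻¹) (α β γ ω : ℂ)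
    (hsum : α + β + γ + ω = -(Complex.I * (((b + b⁻¹) : ℝ) : ℂ)))
    (hα1 : -((b + b⁻¹) / 2) < α.im) (hα2 : α.im < 0)
    (hβ1 : -((b + b⁻¹) / 2) < β.im) (hβ2 : β.im < 0)
    (hγ1 : -((b + b⁻¹) / 2) < γ.im) (hγ2 : γ.im < 0)
    (hω1 : -((b + b⁻¹) / 2) < ω.im) (hω2 : ω.im < 0)
    (u v w z : ℝ) :
    Integrable (fun x : ℝ =>
        Dfun b ε α ((x : ℂ) - (u : ℂ)) * Dfun b ε β ((x : ℂ) - (v : ℂ)) *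
          Dfun b ε γ ((x : ℂ) - (w : ℂ)) * Dfun b ε ω ((x : ℂ) - (z : ℂ))) ∧
    Integrable (fun x : ℝ =>
        Dfun b ε (-(Complex.I * (((b + b⁻¹) / 2 : ℝ) : ℂ)) - α) ((x : ℂ) - (v : ℂ)) *
          Dfun b ε (-(Complex.I * (((b + b⁻¹) / 2 : ℝ) : ℂ)) - β) ((x : ℂ) - (u : ℂ)) *
          Dfun b ε (-(Complex.I * (((b + b⁻¹) / 2 : ℝ) : ℂ)) - γ) ((x : ℂ) - (z : ℂ)) *
          Dfun b ε (-(Complex.I * (((b + b⁻¹) / 2 : ℝ) : ℂ)) - ω) ((x : ℂ) - (w : ℂ))) ∧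
      ∫ x : ℝ,
          Dfun b ε α ((x : ℂ) - (u : ℂ)) * Dfun b ε β ((x : ℂ) - (v : ℂ)) *
            Dfun b ε γ ((x : ℂ) - (w : ℂ)) * Dfun b ε ω ((x : ℂ) - (z : ℂ)) =
        wb b ε (2 * α + Complex.I * (((b + b⁻¹) / 2 : ℝ) : ℂ)) *
          wb b ε (2 * β + Complex.I * (((b + b⁻¹) / 2 : ℝ) : ℂ)) *
          wb b ε (2 * γ + Complex.I * (((b + b⁻¹) / 2 : ℝ) : ℂ)) *
          wb b ε (2 * ω + Complex.I * (((b + b⁻¹) / 2 : ℝ) : ℂ)) *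
          (Dfun b ε (α + β + Complex.I * (((b + b⁻¹) / 2 : ℝ) : ℂ)) ((u : ℂ) - (v : ℂ)) /
            Dfun b ε (α + β + Complex.I * (((b + b⁻¹) / 2 : ℝ) : ℂ)) ((w : ℂ) - (z : ℂ))) *
          ∫ x : ℝ,
            Dfun b ε (-(Complex.I * (((b + b⁻¹) / 2 : ℝ) : ℂ)) - α) ((x : ℂ) - (v : ℂ)) *
              Dfun b ε (-(Complex.I * (((b + b⁻¹) / 2 : ℝ) : ℂ)) - β) ((x : ℂ) - (u : ℂ)) *
              Dfun b ε (-(Complex.I * (((b + b⁻¹) / 2 : ℝ) : ℂ)) - γ) ((x : ℂ) - (z : ℂ)) *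
              Dfun b ε (-(Complex.I * (((b + b⁻¹) / 2 : ℝ) : ℂ)) - ω) ((x : ℂ) - (w : ℂ)) := by
  have h1 : ε < Real.pi * b := hε.trans_le (mul_le_mul_of_nonneg_left (min_le_left _ _) Real.pi_pos.le)
  have h2 : ε < Real.pi * b⁻¹ := hε.trans_le (mul_le_mul_of_nonneg_left (min_le_right _ _) Real.pi_pos.le)
  have hbi : 0 < b⁻¹ := inv_pos.mpr hb
  have hA : Adm b ε := ⟨hb, hε0, by
      have := mul_lt_mul_of_pos_left h2 hb
      rwa [mul_comm Real.pi, ← mul_assoc, mul_inv_cancel₀ hb.ne', one_mul] at this, by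
      have := mul_lt_mul_of_pos_left h1 hbi
      rwa [mul_comm Real.pi, ← mul_assoc, inv_mul_cancel₀ hb.ne', one_mul] at this⟩
  obtain ⟨b', κ, hW⟩ := QW_exists hA
  have hD : ∀ (a : ℂ), |a.im| < (b + b⁻¹) / 2 → ∀ x y : ℝ,
      Dfun b ε a ((x : ℂ) - (y : ℂ)) = Dw (wb b ε) a ((x : ℂ) - (y : ℂ)) := fun a ha x y =>
    Dfun_eq hA a _ (by simpa using ha) (by simpa using ha)
  have hc : Complex.I * (((b + b⁻¹) / 2 : ℝ) : ℂ) = Complex.I * ((b + b⁻¹ : ℝ) : ℂ) / 2 := by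
    push_cast; ring
  have hqi : (Complex.I * ((b + b⁻¹ : ℝ) : ℂ) / 2).im = (b + b⁻¹) / 2 := by
    rw [← hc, Complex.I_mul_im, Complex.ofReal_re]
  have hsim : α.im + β.im + γ.im + ω.im = -(b + b⁻¹) := by
    have := congrArg Complex.im hsum
    rw [Complex.neg_im, Complex.I_mul_im, Complex.ofReal_re] at this
    simpa only [Complex.add_im] using this
  have ims : ∀ a : ℂ, (-(Complex.I * ((b + b⁻¹ : ℝ) : ℂ) / 2) - a).im = -((b + b⁻¹) / 2) - a.im := fun a => by
    rw [Complex.sub_im, Complex.neg_im, hqi]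
  have ima : (α + β + Complex.I * ((b + b⁻¹ : ℝ) : ℂ) / 2).im = α.im + β.im + (b + b⁻¹) / 2 := by
    rw [Complex.add_im, Complex.add_im, hqi]
  have g := D4_gen hW α β γ ω u v w z (by rw [hsum, mul_comm]) hα1 hα2 hβ1 hβ2 hγ1 hγ2 hω1 hω2
  have i1 := D4_int hW α β γ ω u v w z hα1 hα2 hβ1 hβ2 hγ1 hγ2 hω1 hω2
  have i2 := D4_int hW (-(Complex.I * ((b + b⁻¹ : ℝ) : ℂ) / 2) - α) (-(Complex.I * ((b + b⁻¹ : ℝ) : ℂ) / 2) - β)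
    (-(Complex.I * ((b + b⁻¹ : ℝ) : ℂ) / 2) - γ) (-(Complex.I * ((b + b⁻¹ : ℝ) : ℂ) / 2) - ω) v u z w
    (by rw [ims]; linarith) (by rw [ims]; linarith) (by rw [ims]; linarith) (by rw [ims]; linarith)
    (by rw [ims]; linarith) (by rw [ims]; linarith) (by rw [ims]; linarith) (by rw [ims]; linarith)
  rw [hc]
  simp only [hD α (by rw [abs_lt]; constructor <;> linarith), hD β (by rw [abs_lt]; constructor <;> linarith),
    hD γ (by rw [abs_lt]; constructor <;> linarith), hD ω (by rw [abs_lt]; constructor <;> linarith),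
    hD (-(Complex.I * ((b + b⁻¹ : ℝ) : ℂ) / 2) - α) (by rw [ims, abs_lt]; constructor <;> linarith),
    hD (-(Complex.I * ((b + b⁻¹ : ℝ) : ℂ) / 2) - β) (by rw [ims, abs_lt]; constructor <;> linarith),
    hD (-(Complex.I * ((b + b⁻¹ : ℝ) : ℂ) / 2) - γ) (by rw [ims, abs_lt]; constructor <;> linarith),
    hD (-(Complex.I * ((b + b⁻¹ : ℝ) : ℂ) / 2) - ω) (by rw [ims, abs_lt]; constructor <;> linarith),
    hD (α + β + Complex.I * ((b + b⁻¹ : ℝ) : ℂ) / 2) (by rw [ima, abs_lt]; constructor <;> linarith)]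
  exact ⟨i1, i2, g⟩
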